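/- Fix an integer m ≥ 3 and a ∈ ℂ^{m−1}. Then there exists an injective sequence (λ_n)_{n∈ℕ} of eigenvalues of H(m,a) whose range contains all but finitely many eigenvalues of H, such that λ_n = ( Γ(3/2 + 1/m) √π (n − 1/2) / ( sin(π/m) Γ(1 + 1/m) ) )^{2m/(m+2)} · (1 + o(1)) as n → +∞, where the error term o(1) is a complex-valued sequence tending to 0. -/

import Mathlib

open Complex Real Filter Set MeasureTheory Asymptotics

/-- The polynomial `P(z) = a₁ z^{m-1} + a₂ z^{m-2} + ⋯ + a_{m-1} z`. -/
noncomputable def Ppoly (m : ℕ) (a : ℕ → ℂ) (z : ℂ) : ℂ :=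
  ∑ j ∈ Finset.Icc 1 (m - 1), a j * z ^ (m - j)

/-- `u` is an eigenfunction of `H(m,a)` associated with the eigenvalue `lam`:
`u` is a nonconstant entire solution of `-u'' - ((iz)^m + P(iz)) u = lam u` decaying
along the rays `arg z = -π/2 ± 2π/(m+2)`. -/
def IsEigenfunction (m : ℕ) (a : ℕ → ℂ) (lam : ℂ) (u : ℂ → ℂ) : Prop :=
  Differentiable ℂ u ∧
  (¬ ∃ c : ℂ, ∀ z : ℂ, u z = c) ∧
  (∀ z : ℂ, -(deriv (deriv u) z)
      - ((Complex.I * z) ^ m + Ppoly m a (Complex.I * z)) * u z = lam * u z) ∧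
  Filter.Tendsto (fun r : ℝ =>
      u ((r : ℂ) * Complex.exp (((-(Real.pi / 2) + 2 * Real.pi / ((m : ℝ) + 2) : ℝ) : ℂ)
        * Complex.I))) Filter.atTop (nhds 0) ∧
  Filter.Tendsto (fun r : ℝ =>
      u ((r : ℂ) * Complex.exp (((-(Real.pi / 2) - 2 * Real.pi / ((m : ℝ) + 2) : ℝ) : ℂ)
        * Complex.I))) Filter.atTop (nhds 0)

/-- `lam` is an eigenvalue of `H(m,a)`. -/
def IsEigenvalue (m : ℕ) (a : ℕ → ℂ) (lam : ℂ) : Prop :=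
  ∃ u : ℂ → ℂ, IsEigenfunction m a lam u


namespace Sib

theorem paramInt {μ : Measure ℝ} {U : Set ℂ} (hU : IsOpen U) {G : ℂ → ℝ → ℂ} {b : ℝ → ℝ}
    (hm : ∀ u ∈ U, AEStronglyMeasurable (G u) μ)
    (hd : ∀ᵐ t ∂μ, DifferentiableOn ℂ (fun u => G u t) U)
    (hb : ∀ᵐ t ∂μ, ∀ u ∈ U, ‖G u t‖ ≤ b t) (hbi : Integrable b μ) :
    ∀ u ∈ U, HasDerivAt (fun u => ∫ t, G u t ∂μ) (∫ t, deriv (fun u => G u t) u ∂μ) u := by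
  intro u0 hu0
  obtain ⟨r, hr, hrU⟩ := Metric.isOpen_iff.1 hU u0 hu0
  have hr2 : 0 < r / 2 := by linarith
  have hball : ∀ u ∈ Metric.ball u0 (r/2), Metric.closedBall u (r/3) ⊆ U := by
    intro u hu z hz
    apply hrU
    rw [Metric.mem_ball] at hu ⊢
    rw [Metric.mem_closedBall] at hz
    linarith [dist_triangle z u u0]
  have hmem : ∀ u ∈ Metric.ball u0 (r/2), u ∈ U := fun u hu =>
    hball u hu (Metric.mem_closedBall_self (by linarith))
  refine (hasDerivAt_integral_of_dominated_loc_of_deriv_le (bound := fun t => b t / (r/3))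
    (F' := fun u t => deriv (fun u => G u t) u)
    (Metric.ball_mem_nhds u0 hr2) ?_ ?_ ?_ ?_ ?_ ?_).2
  · filter_upwards [hU.mem_nhds hu0] with u hu using hm u hu
  · refine Integrable.mono' hbi (hm u0 hu0) ?_
    filter_upwards [hb] with t ht using ht u0 hu0
  · have hseq : Tendsto (fun n : ℕ => u0 + (((r/2) / ((n : ℝ) + 2) : ℝ) : ℂ)) atTop (nhdsWithin u0 {u0}ᶜ) := by
      rw [tendsto_nhdsWithin_iff]
      constructor
      · have h1 : Tendsto (fun n : ℕ => (r/2) / ((n : ℝ) + 2)) atTop (nhds 0) := by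
          apply Tendsto.div_atTop tendsto_const_nhds
          exact tendsto_atTop_add_const_right _ _ tendsto_natCast_atTop_atTop
        have h2 := (Complex.continuous_ofReal.tendsto 0).comp h1
        simpa using h2.const_add u0
      · filter_upwards with n
        simp only [mem_compl_iff, mem_singleton_iff, add_eq_left, Complex.ofReal_eq_zero]
        positivity
    have hUn : ∀ n : ℕ, u0 + (((r/2) / ((n : ℝ) + 2) : ℝ) : ℂ) ∈ U := by
      intro n
      apply hmem
      rw [Metric.mem_ball, dist_eq_norm]
      simp only [add_sub_cancel_left, Complex.norm_real, Real.norm_eq_abs]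
      rw [abs_of_pos (by positivity), div_lt_iff₀ (by positivity)]
      nlinarith [(Nat.cast_nonneg n : (0:ℝ) ≤ n)]
    refine aestronglyMeasurable_of_tendsto_ae atTop
      (f := fun (n : ℕ) t => slope (fun u => G u t) u0 (u0 + (((r/2) / ((n : ℝ) + 2) : ℝ) : ℂ))) ?_ ?_
    · intro n
      simp only [slope_def_field, div_eq_mul_inv]
      exact ((hm _ (hUn n)).sub (hm u0 hu0)).mul_const _
    · filter_upwards [hd] with t ht
      have := ((ht u0 hu0).differentiableAt (hU.mem_nhds hu0)).hasDerivAt.tendsto_slope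
      exact this.comp hseq
  · filter_upwards [hd, hb] with t ht hbt u hu
    apply Complex.norm_deriv_le_of_forall_mem_sphere_norm_le (by linarith)
    · apply DifferentiableOn.diffContOnCl
      refine ht.mono ?_
      exact (closure_minimal Metric.ball_subset_closedBall Metric.isClosed_closedBall).trans (hball u hu)
    · intro z hz
      exact hbt z (hball u hu (Metric.sphere_subset_closedBall hz))
  · exact hbi.div_const _
  · filter_upwards [hd] with t ht u hu
    exact ((ht u (hmem u hu)).differentiableAt (hU.mem_nhds (hmem u hu))).hasDerivAt

theorem paramInt_diff {μ : Measure ℝ} {U : Set ℂ} (hU : IsOpen U) {G : ℂ → ℝ → ℂ} {b : ℝ → ℝ}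
    (hm : ∀ u ∈ U, AEStronglyMeasurable (G u) μ)
    (hd : ∀ᵐ t ∂μ, DifferentiableOn ℂ (fun u => G u t) U)
    (hb : ∀ᵐ t ∂μ, ∀ u ∈ U, ‖G u t‖ ≤ b t) (hbi : Integrable b μ) :
    DifferentiableOn ℂ (fun u => ∫ t, G u t ∂μ) U := fun u hu =>
  (paramInt hU hm hd hb hbi u hu).differentiableAt.differentiableWithinAt

theorem integral_Ioi_shift (f : ℝ → ℂ) (t τ : ℝ) :
    ∫ s in Ioi t, f (τ + s) = ∫ s in Ioi (τ + t), f s := by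
  have h := (measurePreserving_add_left (volume : Measure ℝ) τ).setIntegral_preimage_emb
    (MeasurableEquiv.addLeft τ).measurableEmbedding f (Ioi (τ + t))
  rw [← h]
  congr 2
  ext x; simp

theorem tail_hasDeriv {k : ℝ → ℂ} (hc : ContinuousOn k (Ici 0)) (hi : IntegrableOn k (Ioi 0)) :
    ∀ t ∈ Ici (0:ℝ), HasDerivWithinAt (fun t => ∫ s in Ioi t, k s) (-k t) (Ici 0) t := by
  intro t ht
  have hhI : ∀ u ∈ Ici (0:ℝ), IntervalIntegrable k volume 0 u := by
    intro u hu
    rw [intervalIntegrable_iff_integrableOn_Ioc_of_le hu]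
    exact hi.mono_set Ioc_subset_Ioi_self
  have heq : ∀ u ∈ Ici (0:ℝ), (∫ s in Ioi u, k s) = (∫ s in Ioi 0, k s) - ∫ s in (0:ℝ)..u, k s := by
    intro u hu
    rw [← intervalIntegral.integral_Ioi_sub_Ioi hi hu]; ring
  have hsub : HasDerivWithinAt (fun u => ∫ s in (0:ℝ)..u, k s) (k t) (Ici 0) t := by
    rcases eq_or_lt_of_le (show (0:ℝ) ≤ t from ht) with h0 | h0
    · subst h0
      refine intervalIntegral.integral_hasDerivWithinAt_right (by simp) (t := Ioi 0) ?_ ?_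
      · exact (hc.mono Ioi_subset_Ici_self).stronglyMeasurableAtFilter_nhdsWithin measurableSet_Ioi 0
      · exact (hc 0 (by simp)).mono Ioi_subset_Ici_self
    · have hct : ContinuousAt k t := hc.continuousAt (Ici_mem_nhds h0)
      refine (intervalIntegral.integral_hasDerivAt_right (hhI t ht) ?_ hct).hasDerivWithinAt
      exact (hc.mono Ioi_subset_Ici_self).stronglyMeasurableAtFilter isOpen_Ioi t h0
  have := (hasDerivWithinAt_const t (Ici 0) (∫ s in Ioi 0, k s)).sub hsub
  rw [zero_sub] at this
  exact this.congr heq (heq t ht)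

end Sib


namespace Sib

noncomputable def VK (E g : ℝ → ℂ) : ℕ → ℝ → ℂ
  | 0, _ => 1
  | n + 1, t => -(1/2) * ∫ s in Ioi t, (1 - Complex.exp (2 * (E t - E s))) * (g s * VK E g n s)

noncomputable def VH (E g : ℝ → ℂ) (t : ℝ) : ℂ := ∑' n, VK E g n t

noncomputable def VB (E g : ℝ → ℂ) (t : ℝ) : ℂ :=
  ∫ s in Ioi t, Complex.exp (2 * (E t - E s)) * (g s * VH E g s)

structure Vol (E g : ℝ → ℂ) (b : ℝ → ℝ) : Prop where
  Ec : ContinuousOn E (Ici 0)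
  gc : ContinuousOn g (Ici 0)
  mono : ∀ t s : ℝ, 0 ≤ t → t ≤ s → (E t).re ≤ (E s).re
  bd : ∀ t : ℝ, 0 ≤ t → ‖g t‖ ≤ b t
  bi : IntegrableOn b (Ioi 0)
  half : ∫ t in Ioi 0, b t ≤ 1/2

namespace Vol
variable {E g : ℝ → ℂ} {b : ℝ → ℝ}

theorem bnn (h : Vol E g b) {t : ℝ} (ht : 0 ≤ t) : 0 ≤ b t := (norm_nonneg _).trans (h.bd t ht)

theorem bint_nn (h : Vol E g b) : 0 ≤ ∫ t in Ioi 0, b t :=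
  setIntegral_nonneg measurableSet_Ioi (fun _ ht => h.bnn (le_of_lt ht))

theorem kint (h : Vol E g b) {k : ℝ → ℂ} {M : ℝ} (hk : ContinuousOn k (Ici 0))
    (hkb : ∀ t : ℝ, 0 ≤ t → ‖k t‖ ≤ M * b t) : IntegrableOn k (Ioi 0) := by
  refine Integrable.mono' (h.bi.const_mul M) ?_ ?_
  · exact (hk.mono Ioi_subset_Ici_self).aestronglyMeasurable measurableSet_Ioi
  · exact (ae_restrict_iff' measurableSet_Ioi).2 (ae_of_all _ fun t ht => hkb t (le_of_lt ht))

theorem norm_exp_le (h : Vol E g b) {t s : ℝ} (ht : 0 ≤ t) (hs : t ≤ s) :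
    ‖Complex.exp (2 * (E t - E s))‖ ≤ 1 := by
  rw [Complex.norm_exp]
  have := h.mono t s ht hs
  apply Real.exp_le_one_iff.2
  simp; linarith

theorem econt (h : Vol E g b) {k : ℝ → ℂ} (hk : ContinuousOn k (Ici 0)) (t : ℝ) :
    ContinuousOn (fun s => Complex.exp (2 * (E t - E s)) * k s) (Ici 0) :=
  (Complex.continuous_exp.comp_continuousOn
    (continuousOn_const.mul (continuousOn_const.sub h.Ec))).mul hk

theorem kint_exp (h : Vol E g b) {k : ℝ → ℂ} {M : ℝ} (hk : ContinuousOn k (Ici 0))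
    (hkb : ∀ t : ℝ, 0 ≤ t → ‖k t‖ ≤ M * b t) {t : ℝ} (ht : 0 ≤ t) :
    IntegrableOn (fun s => Complex.exp (2 * (E t - E s)) * k s) (Ioi t) := by
  refine Integrable.mono' ((h.bi.mono_set (Ioi_subset_Ioi ht)).const_mul M) ?_ ?_
  · exact ((h.econt hk t).mono (Ioi_subset_Ici ht)).aestronglyMeasurable measurableSet_Ioi
  · refine (ae_restrict_iff' measurableSet_Ioi).2 (ae_of_all _ fun s hs => ?_)
    rw [norm_mul]
    have h1 := h.norm_exp_le ht (le_of_lt hs)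
    have h2 := hkb s (ht.trans (le_of_lt hs))
    nlinarith [norm_nonneg (k s)]

/-- e-weighted tail -/
theorem tailE (h : Vol E g b) {k : ℝ → ℂ} {M : ℝ} (hk : ContinuousOn k (Ici 0))
    (hkb : ∀ t : ℝ, 0 ≤ t → ‖k t‖ ≤ M * b t) :
    ContinuousOn (fun t => ∫ s in Ioi t, Complex.exp (2 * (E t - E s)) * k s) (Ici 0) ∧
    (∀ R : ℝ → ℂ, (∀ t ∈ Ici (0:ℝ), HasDerivWithinAt E (R t) (Ici 0) t) → ∀ t ∈ Ici (0:ℝ),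
      HasDerivWithinAt (fun t => ∫ s in Ioi t, Complex.exp (2 * (E t - E s)) * k s)
        (2 * R t * (∫ s in Ioi t, Complex.exp (2 * (E t - E s)) * k s) - k t) (Ici 0) t) := by
  have hq : ContinuousOn (fun s => Complex.exp (2 * (E 0 - E s)) * k s) (Ici 0) := h.econt hk 0
  have hqi := h.kint_exp hk hkb (le_refl 0)
  have hT := tail_hasDeriv hq hqi
  have key : ∀ t, (∫ s in Ioi t, Complex.exp (2 * (E t - E s)) * k s) =
      Complex.exp (2 * (E t - E 0)) * ∫ s in Ioi t, Complex.exp (2 * (E 0 - E s)) * k s := by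
    intro t
    rw [← integral_const_mul]
    congr 1; ext s
    rw [← mul_assoc, ← Complex.exp_add]; ring_nf
  simp only [key]
  constructor
  · refine ContinuousOn.mul ?_ (fun t ht => (hT t ht).continuousWithinAt)
    exact Complex.continuous_exp.comp_continuousOn (continuousOn_const.mul (h.Ec.sub continuousOn_const))
  · intro R hR t ht
    have h1 : HasDerivWithinAt (fun t => 2 * (E t - E 0)) (2 * R t) (Ici 0) t :=
      ((hR t ht).sub_const (E 0)).const_mul 2
    have h2 := h1.cexp.mul (hT t ht)
    refine h2.congr_deriv ?_
    have h3 : Complex.exp (2 * (E t - E 0)) * Complex.exp (2 * (E 0 - E t)) = 1 := by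
      rw [← Complex.exp_add]; ring_nf; simp
    linear_combination (-k t) * h3

theorem split (h : Vol E g b) {k : ℝ → ℂ} {M : ℝ} (hk : ContinuousOn k (Ici 0))
    (hkb : ∀ t : ℝ, 0 ≤ t → ‖k t‖ ≤ M * b t) {t : ℝ} (ht : 0 ≤ t) :
    (∫ s in Ioi t, (1 - Complex.exp (2 * (E t - E s))) * k s) =
     (∫ s in Ioi t, k s) - ∫ s in Ioi t, Complex.exp (2 * (E t - E s)) * k s := by
  rw [← integral_sub ((h.kint hk hkb).mono_set (Ioi_subset_Ioi ht)) (h.kint_exp hk hkb ht)]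
  congr 1; ext s; ring

theorem tail_le (h : Vol E g b) {t : ℝ} (ht : 0 ≤ t) :
    ∫ s in Ioi t, b s ≤ ∫ s in Ioi 0, b s := by
  refine setIntegral_mono_set h.bi ?_ ?_
  · exact (ae_restrict_iff' measurableSet_Ioi).2 (ae_of_all _ fun t ht => h.bnn (le_of_lt ht))
  · exact (Ioi_subset_Ioi ht).eventuallyLE

theorem expTail_bd (h : Vol E g b) {k : ℝ → ℂ} {M : ℝ} (hM : 0 ≤ M)
    (hkb : ∀ t : ℝ, 0 ≤ t → ‖k t‖ ≤ M * b t) {t : ℝ} (ht : 0 ≤ t) :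
    ‖∫ s in Ioi t, Complex.exp (2 * (E t - E s)) * k s‖ ≤ M * ∫ s in Ioi 0, b s := by
  have h1 : ‖∫ s in Ioi t, Complex.exp (2 * (E t - E s)) * k s‖ ≤ ∫ s in Ioi t, M * b s := by
    refine norm_integral_le_of_norm_le ((h.bi.mono_set (Ioi_subset_Ioi ht)).const_mul M) ?_
    refine (ae_restrict_iff' measurableSet_Ioi).2 (ae_of_all _ fun s hs => ?_)
    rw [norm_mul]
    have h1 := h.norm_exp_le ht (le_of_lt hs)
    have h2 := hkb s (ht.trans (le_of_lt hs))
    nlinarith [norm_nonneg (k s)]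
  rw [integral_const_mul] at h1
  exact h1.trans (mul_le_mul_of_nonneg_left (h.tail_le ht) hM)

theorem kerTail_bd (h : Vol E g b) {k : ℝ → ℂ} {M : ℝ} (hM : 0 ≤ M)
    (hkb : ∀ t : ℝ, 0 ≤ t → ‖k t‖ ≤ M * b t) {t : ℝ} (ht : 0 ≤ t) :
    ‖-(1/2) * ∫ s in Ioi t, (1 - Complex.exp (2 * (E t - E s))) * k s‖ ≤ M * ∫ s in Ioi 0, b s := by
  have h1 : ‖∫ s in Ioi t, (1 - Complex.exp (2 * (E t - E s))) * k s‖ ≤ ∫ s in Ioi t, (2 * M) * b s := by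
    refine norm_integral_le_of_norm_le ((h.bi.mono_set (Ioi_subset_Ioi ht)).const_mul _) ?_
    refine (ae_restrict_iff' measurableSet_Ioi).2 (ae_of_all _ fun s hs => ?_)
    rw [norm_mul]
    have h1 := h.norm_exp_le ht (le_of_lt hs)
    have h2 := hkb s (ht.trans (le_of_lt hs))
    have h3 : ‖1 - Complex.exp (2 * (E t - E s))‖ ≤ 2 := by
      refine (norm_sub_le _ _).trans ?_
      rw [norm_one]; linarith
    nlinarith [norm_nonneg (k s)]
  rw [integral_const_mul] at h1
  rw [norm_mul]
  have h4 : ‖(-(1/2) : ℂ)‖ = 1/2 := by norm_num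
  rw [h4]
  have := mul_le_mul_of_nonneg_left (h.tail_le ht) hM
  linarith

theorem VK_prop (h : Vol E g b) (n : ℕ) : ContinuousOn (VK E g n) (Ici 0) ∧
    ∀ t : ℝ, 0 ≤ t → ‖VK E g n t‖ ≤ (∫ s in Ioi 0, b s) ^ n := by
  induction n with
  | zero => exact ⟨continuousOn_const, fun t _ => by simp [VK]⟩
  | succ n ih =>
    have hk : ContinuousOn (fun s => g s * VK E g n s) (Ici 0) := h.gc.mul ih.1
    have hkb : ∀ t : ℝ, 0 ≤ t → ‖g t * VK E g n t‖ ≤ (∫ s in Ioi 0, b s) ^ n * b t := by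
      intro t ht
      rw [norm_mul, mul_comm]
      exact mul_le_mul (ih.2 t ht) (h.bd t ht) (norm_nonneg _) (pow_nonneg h.bint_nn _)
    constructor
    · have : ContinuousOn (fun t => -(1/2) * ((∫ s in Ioi t, g s * VK E g n s) -
          ∫ s in Ioi t, Complex.exp (2 * (E t - E s)) * (g s * VK E g n s))) (Ici 0) :=
        continuousOn_const.mul (ContinuousOn.sub
          (fun t ht => (tail_hasDeriv hk (h.kint hk hkb) t ht).continuousWithinAt) (h.tailE hk hkb).1)
      refine this.congr fun t ht => ?_
      simp only [VK]
      rw [h.split hk hkb ht]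
    · intro t ht
      rw [pow_succ]
      exact h.kerTail_bd (pow_nonneg h.bint_nn _) hkb ht

theorem pow_le (h : Vol E g b) (n : ℕ) : (∫ s in Ioi 0, b s) ^ n ≤ (1/2 : ℝ) ^ n :=
  pow_le_pow_left₀ h.bint_nn h.half n

theorem VK_le (h : Vol E g b) (n : ℕ) {t : ℝ} (ht : 0 ≤ t) : ‖VK E g n t‖ ≤ (1/2 : ℝ) ^ n :=
  ((h.VK_prop n).2 t ht).trans (h.pow_le n)

theorem VK_summable (h : Vol E g b) {t : ℝ} (ht : 0 ≤ t) : Summable fun n => VK E g n t :=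
  Summable.of_norm_bounded summable_geometric_two (fun n => h.VK_le n ht)

theorem VH_cont (h : Vol E g b) : ContinuousOn (VH E g) (Ici 0) :=
  continuousOn_tsum (fun n => (h.VK_prop n).1) summable_geometric_two (fun n _ ht => h.VK_le n ht)

theorem VH_le (h : Vol E g b) {t : ℝ} (ht : 0 ≤ t) : ‖VH E g t‖ ≤ 2 := by
  rw [← tsum_geometric_two]
  exact tsum_of_norm_bounded summable_geometric_two.hasSum (fun n => h.VK_le n ht)

theorem gVH_cont (h : Vol E g b) : ContinuousOn (fun s => g s * VH E g s) (Ici 0) := h.gc.mul h.VH_cont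

theorem gVH_bd (h : Vol E g b) : ∀ t : ℝ, 0 ≤ t → ‖g t * VH E g t‖ ≤ 2 * b t := by
  intro t ht
  rw [norm_mul, mul_comm]
  exact mul_le_mul (h.VH_le ht) (h.bd t ht) (norm_nonneg _) (by norm_num)

theorem VH_eq (h : Vol E g b) {t : ℝ} (ht : 0 ≤ t) :
    VH E g t = 1 + -(1/2) * ∫ s in Ioi t, (1 - Complex.exp (2 * (E t - E s))) * (g s * VH E g s) := by
  have h0 : VH E g t = VK E g 0 t + ∑' n, VK E g (n+1) t := by
    rw [VH, (h.VK_summable ht).tsum_eq_zero_add]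
  have hkb : ∀ n, ∀ t : ℝ, 0 ≤ t → ‖g t * VK E g n t‖ ≤ (1/2:ℝ) ^ n * b t := by
    intro n t ht
    rw [norm_mul, mul_comm]
    exact mul_le_mul (h.VK_le n ht) (h.bd t ht) (norm_nonneg _) (by positivity)
  have hcont : ∀ n, ContinuousOn (fun s => (1 - Complex.exp (2 * (E t - E s))) * (g s * VK E g n s)) (Ici 0) := by
    intro n
    refine ContinuousOn.mul (continuousOn_const.sub (Complex.continuous_exp.comp_continuousOn
      (continuousOn_const.mul (continuousOn_const.sub h.Ec)))) (h.gc.mul (h.VK_prop n).1)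
  have hbd : ∀ n, ∀ s ∈ Ioi t, ‖(1 - Complex.exp (2 * (E t - E s))) * (g s * VK E g n s)‖ ≤
      2 * ((1/2:ℝ) ^ n * b s) := by
    intro n s hs
    rw [norm_mul]
    have h1 := h.norm_exp_le ht (le_of_lt hs)
    have h3 : ‖1 - Complex.exp (2 * (E t - E s))‖ ≤ 2 := by
      refine (norm_sub_le _ _).trans ?_
      rw [norm_one]; linarith
    exact mul_le_mul h3 (hkb n s (ht.trans (le_of_lt hs))) (norm_nonneg _) (by norm_num)
  have hbt : IntegrableOn b (Ioi t) := h.bi.mono_set (Ioi_subset_Ioi ht)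
  have hhI : ∀ n, IntegrableOn (fun s => (1 - Complex.exp (2 * (E t - E s))) * (g s * VK E g n s)) (Ioi t) := by
    intro n
    refine Integrable.mono' ((hbt.const_mul ((1/2:ℝ)^n)).const_mul 2) ?_ ?_
    · exact ((hcont n).mono (Ioi_subset_Ici ht)).aestronglyMeasurable measurableSet_Ioi
    · exact (ae_restrict_iff' measurableSet_Ioi).2 (ae_of_all _ fun s hs => hbd n s hs)
  have hsum := MeasureTheory.hasSum_integral_of_summable_integral_norm hhI (by
    refine Summable.of_nonneg_of_le (fun n => integral_nonneg fun _ => norm_nonneg _) (fun n => ?_)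
      ((summable_geometric_two.mul_left (2 * ∫ s in Ioi t, b s)))
    calc _ ≤ ∫ s in Ioi t, 2 * ((1/2:ℝ) ^ n * b s) := by
          refine setIntegral_mono_on (hhI n).norm ((hbt.const_mul ((1/2:ℝ)^n)).const_mul 2) measurableSet_Ioi (hbd n)
      _ = _ := by rw [integral_const_mul, integral_const_mul]; ring)
  rw [h0]
  congr 1
  simp only [VK]
  rw [tsum_mul_left, hsum.tsum_eq]
  congr 1
  refine setIntegral_congr_fun measurableSet_Ioi fun s hs => ?_
  simp only [VH]
  rw [tsum_mul_left, tsum_mul_left]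

theorem VH_sub_one (h : Vol E g b) {t : ℝ} (ht : 0 ≤ t) : ‖VH E g t - 1‖ ≤ 2 * ∫ s in Ioi 0, b s := by
  rw [h.VH_eq ht, add_sub_cancel_left]
  exact h.kerTail_bd (by norm_num) h.gVH_bd ht

theorem VB_le (h : Vol E g b) {t : ℝ} (ht : 0 ≤ t) : ‖VB E g t‖ ≤ 2 * ∫ s in Ioi 0, b s :=
  h.expTail_bd (by norm_num) h.gVH_bd ht

theorem VB_deriv (h : Vol E g b) {R : ℝ → ℂ}
    (hR : ∀ t ∈ Ici (0:ℝ), HasDerivWithinAt E (R t) (Ici 0) t) {t : ℝ} (ht : 0 ≤ t) :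
    HasDerivWithinAt (VB E g) (2 * R t * VB E g t - g t * VH E g t) (Ici 0) t :=
  (h.tailE h.gVH_cont h.gVH_bd).2 R hR t ht

theorem VH_deriv (h : Vol E g b) {R : ℝ → ℂ}
    (hR : ∀ t ∈ Ici (0:ℝ), HasDerivWithinAt E (R t) (Ici 0) t) {t : ℝ} (ht : 0 ≤ t) :
    HasDerivWithinAt (VH E g) (R t * VB E g t) (Ici 0) t := by
  have heq : ∀ t ∈ Ici (0:ℝ), VH E g t = 1 + -(1/2) * ((∫ s in Ioi t, g s * VH E g s) - VB E g t) := by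
    intro t ht
    rw [h.VH_eq ht, h.split h.gVH_cont h.gVH_bd ht]; rfl
  have h1 := (((tail_hasDeriv h.gVH_cont (h.kint h.gVH_cont h.gVH_bd) t ht).sub
    (h.VB_deriv hR ht)).const_mul (-(1/2))).const_add 1
  refine (h1.congr heq (heq t ht)).congr_deriv ?_
  ring

end Vol

theorem VK_shift (E g : ℝ → ℂ) (τ : ℝ) (n : ℕ) (t : ℝ) :
    VK (fun s => E (τ + s)) (fun s => g (τ + s)) n t = VK E g n (τ + t) := by
  induction n generalizing t with
  | zero => rfl
  | succ n ih =>
    simp only [VK, ih]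
    rw [integral_Ioi_shift (fun s => (1 - Complex.exp (2 * (E (τ + t) - E s))) * (g s * VK E g n s))]

theorem VH_shift (E g : ℝ → ℂ) (τ t : ℝ) :
    VH (fun s => E (τ + s)) (fun s => g (τ + s)) t = VH E g (τ + t) := by
  simp only [VH, VK_shift]

theorem VB_shift (E g : ℝ → ℂ) (τ t : ℝ) :
    VB (fun s => E (τ + s)) (fun s => g (τ + s)) t = VB E g (τ + t) := by
  simp only [VB, VH_shift]
  rw [integral_Ioi_shift (fun s => Complex.exp (2 * (E (τ + t) - E s)) * (g s * VH E g s))]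

section param
variable {U : Set ℂ} {E g : ℂ → ℝ → ℂ} {b : ℝ → ℝ}

theorem VK_diff (hU : IsOpen U) (h : ∀ u ∈ U, Vol (E u) (g u) b)
    (hE : ∀ t : ℝ, 0 ≤ t → DifferentiableOn ℂ (fun u => E u t) U)
    (hg : ∀ t : ℝ, 0 ≤ t → DifferentiableOn ℂ (fun u => g u t) U) (n : ℕ) :
    ∀ t : ℝ, 0 ≤ t → DifferentiableOn ℂ (fun u => VK (E u) (g u) n t) U := by
  rcases U.eq_empty_or_nonempty with rfl | ⟨u0, hu0⟩
  · intro t _; exact differentiableOn_empty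
  induction n with
  | zero => intro t _; exact differentiableOn_const _
  | succ n ih =>
    intro t ht
    simp only [VK]
    refine DifferentiableOn.const_mul ?_ _
    refine paramInt_diff hU (b := fun s => 2 * ((1/2:ℝ)^n * b s)) ?_ ?_ ?_ ?_
    · intro u hu
      refine (ContinuousOn.mono ?_ (Ioi_subset_Ici ht)).aestronglyMeasurable measurableSet_Ioi
      refine ContinuousOn.mul (continuousOn_const.sub (Complex.continuous_exp.comp_continuousOn
      (continuousOn_const.mul (continuousOn_const.sub (h u hu).Ec)))) ((h u hu).gc.mul ((h u hu).VK_prop n).1)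
    · refine (ae_restrict_iff' measurableSet_Ioi).2 (ae_of_all _ fun s hs => ?_)
      have hs0 : 0 ≤ s := ht.trans (le_of_lt hs)
      exact (((((hE t ht).sub (hE s hs0)).const_mul 2).cexp).const_sub 1).mul ((hg s hs0).mul (ih s hs0))
    · refine (ae_restrict_iff' measurableSet_Ioi).2 (ae_of_all _ fun s hs u hu => ?_)
      have hs0 : 0 ≤ s := ht.trans (le_of_lt hs)
      rw [norm_mul, norm_mul]
      have h1 := (h u hu).norm_exp_le ht (le_of_lt hs)
      have h3 : ‖1 - Complex.exp (2 * (E u t - E u s))‖ ≤ 2 := by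
        refine (norm_sub_le _ _).trans ?_
        rw [norm_one]; linarith
      refine mul_le_mul h3 ?_ (by positivity) (by norm_num)
      rw [mul_comm]
      exact mul_le_mul ((h u hu).VK_le n hs0) ((h u hu).bd s hs0) (norm_nonneg _) (by positivity)
    · exact ((((h u0 hu0).bi.mono_set (Ioi_subset_Ioi ht)).const_mul _).const_mul _)

theorem VH_diff (hU : IsOpen U) (h : ∀ u ∈ U, Vol (E u) (g u) b)
    (hE : ∀ t : ℝ, 0 ≤ t → DifferentiableOn ℂ (fun u => E u t) U)
    (hg : ∀ t : ℝ, 0 ≤ t → DifferentiableOn ℂ (fun u => g u t) U) :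
    ∀ t : ℝ, 0 ≤ t → DifferentiableOn ℂ (fun u => VH (E u) (g u) t) U := by
  intro t ht
  exact Complex.differentiableOn_tsum_of_summable_norm summable_geometric_two
    (fun n => VK_diff hU h hE hg n t ht) hU (fun n u hu => (h u hu).VK_le n ht)

theorem VB_diff (hU : IsOpen U) (h : ∀ u ∈ U, Vol (E u) (g u) b)
    (hE : ∀ t : ℝ, 0 ≤ t → DifferentiableOn ℂ (fun u => E u t) U)
    (hg : ∀ t : ℝ, 0 ≤ t → DifferentiableOn ℂ (fun u => g u t) U) :
    ∀ t : ℝ, 0 ≤ t → DifferentiableOn ℂ (fun u => VB (E u) (g u) t) U := by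
  intro t ht
  rcases U.eq_empty_or_nonempty with rfl | ⟨u0, hu0⟩
  · exact differentiableOn_empty
  refine paramInt_diff hU (b := fun s => 2 * b s) ?_ ?_ ?_ ?_
  · intro u hu
    exact (((h u hu).econt (h u hu).gVH_cont t).mono (Ioi_subset_Ici ht)).aestronglyMeasurable measurableSet_Ioi
  · refine (ae_restrict_iff' measurableSet_Ioi).2 (ae_of_all _ fun s hs => ?_)
    have hs0 : 0 ≤ s := ht.trans (le_of_lt hs)
    exact ((((hE t ht).sub (hE s hs0)).const_mul 2).cexp).mul ((hg s hs0).mul (VH_diff hU h hE hg s hs0))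
  · refine (ae_restrict_iff' measurableSet_Ioi).2 (ae_of_all _ fun s hs u hu => ?_)
    have hs0 : 0 ≤ s := ht.trans (le_of_lt hs)
    rw [norm_mul]
    have h1 := (h u hu).norm_exp_le ht (le_of_lt hs)
    have h2 := (h u hu).gVH_bd s hs0
    nlinarith [norm_nonneg (g u s * VH (E u) (g u) s)]
  · exact ((h u0 hu0).bi.mono_set (Ioi_subset_Ioi ht)).const_mul _

end param
end Sib


namespace Sib

noncomputable def ps (c : ℕ → ℂ) (z : ℂ) : ℂ := ∑' n, c n * z ^ n

def Ent (c : ℕ → ℂ) : Prop := ∀ r : ℝ, 0 ≤ r → ∃ C : ℝ, ∀ n, ‖c n‖ * r ^ n ≤ C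

noncomputable def dc (c : ℕ → ℂ) (n : ℕ) : ℂ := ((n : ℂ) + 1) * c (n + 1)

theorem Ent.dc {c : ℕ → ℂ} (h : Ent c) : Ent (dc c) := by
  intro r hr
  obtain ⟨C, hC⟩ := h (2 * r + 1) (by linarith)
  refine ⟨C, fun n => ?_⟩
  refine le_trans ?_ (hC (n + 1))
  simp only [Sib.dc, norm_mul]
  have h1 : ‖((n:ℂ) + 1)‖ ≤ 2 ^ n := by
    have : ((n:ℂ) + 1) = ((n + 1 : ℕ) : ℂ) := by push_cast; rfl
    rw [this, Complex.norm_natCast]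
    exact_mod_cast Nat.succ_le_of_lt (Nat.lt_two_pow_self)
  have h2 : (2 * r) ^ n ≤ (2 * r + 1) ^ (n + 1) := by
    rw [pow_succ]
    have : (2 * r) ^ n ≤ (2 * r + 1) ^ n := pow_le_pow_left₀ (by linarith) (by linarith) n
    have h3 : 0 ≤ (2 * r + 1) ^ n := by positivity
    nlinarith
  calc ‖((n:ℂ) + 1)‖ * ‖c (n + 1)‖ * r ^ n ≤ 2 ^ n * ‖c (n + 1)‖ * r ^ n := by gcongr
    _ = ‖c (n+1)‖ * (2 * r) ^ n := by rw [mul_pow]; ring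
    _ ≤ _ := by gcongr

theorem ps_bd {c : ℕ → ℂ} {r C : ℝ} (hC : ∀ n, ‖c n‖ * (2 * r) ^ n ≤ C)
    {z : ℂ} (hz : ‖z‖ ≤ r) (n : ℕ) : ‖c n * z ^ n‖ ≤ C * (1/2) ^ n := by
  have := hC n
  rw [norm_mul, norm_pow]
  calc ‖c n‖ * ‖z‖ ^ n ≤ ‖c n‖ * r ^ n := by gcongr
    _ = (‖c n‖ * (2 * r) ^ n) * (1/2) ^ n := by
      rw [mul_pow, mul_assoc, mul_right_comm (2 ^ n), ← mul_pow]; norm_num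
    _ ≤ _ := by gcongr

theorem Ent.summable {c : ℕ → ℂ} (h : Ent c) (z : ℂ) : Summable (fun n => ‖c n * z ^ n‖) := by
  obtain ⟨C, hC⟩ := h (2 * ‖z‖) (by positivity)
  exact Summable.of_nonneg_of_le (fun _ => norm_nonneg _) (ps_bd hC le_rfl)
    (summable_geometric_two.mul_left C)

theorem Ent.hasDerivAt {c : ℕ → ℂ} (h : Ent c) (z : ℂ) : HasDerivAt (ps c) (ps (Sib.dc c) z) z := by
  obtain ⟨C, hC⟩ := h (2 * (‖z‖ + 1)) (by positivity)
  have hz : z ∈ Metric.ball (0:ℂ) (‖z‖ + 1) := by simp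
  have hd : ∀ n : ℕ, DifferentiableOn ℂ (fun z : ℂ => c n * z ^ n) (Metric.ball (0:ℂ) (‖z‖ + 1)) := by
    intro n; fun_prop
  have hb : ∀ (n : ℕ), ∀ w ∈ Metric.ball (0:ℂ) (‖z‖ + 1), ‖c n * w ^ n‖ ≤ C * (1/2) ^ n := by
    intro n w hw
    rw [mem_ball_zero_iff] at hw
    exact ps_bd hC hw.le n
  have hs : Summable fun n : ℕ => C * (1/2 : ℝ) ^ n := summable_geometric_two.mul_left C
  have h1 := Complex.hasSum_deriv_of_summable_norm hs hd Metric.isOpen_ball hb hz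
  have h2 := (Complex.differentiableOn_tsum_of_summable_norm hs hd Metric.isOpen_ball hb).differentiableAt
    (Metric.isOpen_ball.mem_nhds hz)
  have h3 : deriv (ps c) z = ps (Sib.dc c) z := by
    unfold ps
    rw [← h1.tsum_eq, h1.summable.tsum_eq_zero_add]
    simp only [deriv_const_mul_field, pow_zero, deriv_const, mul_zero, zero_add, Sib.dc]
    congr 1; ext n
    simp; ring
  rw [← h3]
  exact h2.hasDerivAt

noncomputable def pc (q : ℕ → ℂ) (c0 c1 : ℂ) : ℕ → ℂ
  | 0 => c0
  | 1 => c1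
  | n + 2 => (∑ k : Fin (n + 1), q (n - k) * pc q c0 c1 k) / (((n : ℂ) + 1) * ((n : ℂ) + 2))
  decreasing_by omega

theorem pc_bound {q : ℕ → ℂ} {r Bq : ℝ} (hr : 0 ≤ r)
    (hB : ∀ n, ∑ k ∈ Finset.range (n + 1), ‖q k‖ * r ^ k ≤ Bq) (c0 c1 : ℂ) (n : ℕ) :
    ‖pc q c0 c1 n‖ * r ^ n ≤ (‖c0‖ + ‖c1‖ * r) * Real.exp (r ^ 2 * Bq * (1 - 1 / ((n : ℝ) + 1))) := by
  set M := ‖c0‖ + ‖c1‖ * r with hM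
  have hM0 : 0 ≤ M := by positivity
  have hB0 : 0 ≤ Bq := le_trans (Finset.sum_nonneg fun _ _ => by positivity) (hB 0)
  set X := r ^ 2 * Bq with hX
  have hX0 : 0 ≤ X := by positivity
  induction n using Nat.strong_induction_on with
  | _ n ih =>
    match n, ih with
    | 0, _ => simp [pc, hM]; positivity
    | 1, _ =>
      have : 1 ≤ Real.exp (X * (1 - 1 / (((1:ℕ) : ℝ) + 1))) := by
        apply Real.one_le_exp; apply mul_nonneg hX0; norm_num
      have h2 : ‖pc q c0 c1 1‖ * r ^ 1 ≤ M := by simp [pc, hM]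
      nlinarith
    | n + 2, ih =>
      have hn1 : (0:ℝ) < (n:ℝ) + 1 := by positivity
      have hn2 : (0:ℝ) < (n:ℝ) + 2 := by positivity
      have hden : ‖((n : ℂ) + 1) * ((n : ℂ) + 2)‖ = ((n:ℝ) + 1) * ((n:ℝ) + 2) := by
        have : ((n : ℂ) + 1) * ((n : ℂ) + 2) = ((((n:ℝ) + 1) * ((n:ℝ) + 2) : ℝ) : ℂ) := by push_cast; rfl
        rw [this, Complex.norm_real, Real.norm_of_nonneg (by positivity)]
      set en := Real.exp (X * (1 - 1 / ((n : ℝ) + 1))) with hen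
      have hsum : ‖∑ k : Fin (n + 1), q (n - k) * pc q c0 c1 k‖ * r ^ n ≤ Bq * (M * en) := by
        calc _ ≤ (∑ k : Fin (n + 1), ‖q (n - k) * pc q c0 c1 k‖) * r ^ n := by
              gcongr; exact norm_sum_le _ _
          _ = ∑ k : Fin (n + 1), (‖q (n - k)‖ * r ^ (n - (k:ℕ))) * (‖pc q c0 c1 k‖ * r ^ (k:ℕ)) := by
              rw [Finset.sum_mul]
              refine Finset.sum_congr rfl fun k _ => ?_
              have : r ^ n = r ^ (n - (k:ℕ)) * r ^ (k:ℕ) := by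
                rw [← pow_add, Nat.sub_add_cancel (Nat.lt_succ_iff.1 k.2)]
              rw [norm_mul, this]; ring
          _ ≤ ∑ k : Fin (n + 1), (‖q (n - k)‖ * r ^ (n - (k:ℕ))) * (M * en) := by
              refine Finset.sum_le_sum fun k _ => ?_
              refine mul_le_mul_of_nonneg_left ?_ (by positivity)
              refine (ih k (by have := k.2; omega)).trans ?_
              refine mul_le_mul_of_nonneg_left ?_ hM0
              apply Real.exp_le_exp.2
              apply mul_le_mul_of_nonneg_left _ hX0
              have : (k:ℝ) + 1 ≤ (n:ℝ) + 1 := by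
                have := k.2
                have h2 : (k:ℕ) ≤ n := by omega
                have h3 : ((k:ℕ):ℝ) ≤ n := by exact_mod_cast h2
                linarith
              have := one_div_le_one_div_of_le (by positivity : (0:ℝ) < (k:ℝ) + 1) this
              linarith
          _ = (∑ k ∈ Finset.range (n + 1), ‖q k‖ * r ^ k) * (M * en) := by
              rw [← Finset.sum_mul]
              congr 1
              rw [Finset.sum_fin_eq_sum_range, ← Finset.sum_range_reflect]
              refine Finset.sum_congr rfl fun k hk => ?_
              have hk' := Finset.mem_range.1 hk
              rw [dif_pos (by omega)]
              have : n - (n + 1 - 1 - k) = k := by omega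
              simp only [this]
          _ ≤ _ := by gcongr; exact hB n
      rw [pc, norm_div, hden]
      have e1 : X / (((n:ℝ) + 1) * ((n:ℝ) + 2)) ≤ Real.exp (X * (1 / ((n:ℝ) + 1) - 1 / ((n:ℝ) + 3))) := by
        have h3 : X / (((n:ℝ) + 1) * ((n:ℝ) + 2)) ≤ X * (1 / ((n:ℝ) + 1) - 1 / ((n:ℝ) + 3)) := by
          rw [div_eq_mul_inv]
          apply mul_le_mul_of_nonneg_left _ hX0
          rw [inv_eq_one_div, div_sub_div _ _ (by positivity) (by positivity), div_le_div_iff₀ (by positivity) (by positivity)]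
          nlinarith
        exact h3.trans (by linarith [Real.add_one_le_exp (X * (1 / ((n:ℝ) + 1) - 1 / ((n:ℝ) + 3)))])
      have e2 : Real.exp (X * (1 - 1 / (((n + 2 : ℕ) : ℝ) + 1))) =
          en * Real.exp (X * (1 / ((n:ℝ) + 1) - 1 / ((n:ℝ) + 3))) := by
        rw [hen, ← Real.exp_add]; congr 1; push_cast; ring
      rw [e2]
      have hen0 : 0 < en := Real.exp_pos _
      calc _ = (‖∑ k : Fin (n + 1), q (n - k) * pc q c0 c1 k‖ * r ^ n) * (r ^ 2 / (((n:ℝ) + 1) * ((n:ℝ) + 2))) := by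
            rw [pow_add]; ring
        _ ≤ (Bq * (M * en)) * (r ^ 2 / (((n:ℝ) + 1) * ((n:ℝ) + 2))) := by gcongr
        _ = (M * en) * (X / (((n:ℝ) + 1) * ((n:ℝ) + 2))) := by rw [hX]; ring
        _ ≤ (M * en) * Real.exp (X * (1 / ((n:ℝ) + 1) - 1 / ((n:ℝ) + 3))) := by gcongr
        _ = _ := by ring

open Polynomial in
noncomputable def qcoef (p : Polynomial ℂ) (lam : ℂ) (n : ℕ) : ℂ := (p + Polynomial.C lam).coeff n

theorem qcoef_bound (p : Polynomial ℂ) {lam : ℂ} {L r : ℝ} (hr : 0 ≤ r) (hl : ‖lam‖ ≤ L) (n : ℕ) :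
    ∑ k ∈ Finset.range (n + 1), ‖qcoef p lam k‖ * r ^ k ≤
      L + ∑ k ∈ Finset.range (p.natDegree + 1), ‖p.coeff k‖ * r ^ k := by
  have h1 : ∀ k, ‖qcoef p lam k‖ * r ^ k ≤ ‖p.coeff k‖ * r ^ k + if k = 0 then L else 0 := by
    intro k
    simp only [qcoef, Polynomial.coeff_add, Polynomial.coeff_C]
    split_ifs with h
    · subst h; simp; exact (norm_add_le _ _).trans (by linarith)
    · simp
  refine (Finset.sum_le_sum fun k _ => h1 k).trans ?_
  rw [Finset.sum_add_distrib, Finset.sum_ite_eq' ]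
  simp only [Finset.mem_range, Nat.zero_lt_succ, if_true]
  rw [add_comm]
  gcongr 1
  have : ∀ k, k ∉ Finset.range (p.natDegree + 1) → ‖p.coeff k‖ * r ^ k = 0 := by
    intro k hk
    rw [Polynomial.coeff_eq_zero_of_natDegree_lt (by simpa [Nat.lt_succ_iff] using hk)]; simp
  calc _ ≤ ∑ k ∈ Finset.range (n + 1) ∪ Finset.range (p.natDegree + 1), ‖p.coeff k‖ * r ^ k :=
        Finset.sum_le_sum_of_subset_of_nonneg Finset.subset_union_left (fun _ _ _ => by positivity)
    _ = _ := (Finset.sum_subset Finset.subset_union_right (fun k _ hk => this k hk)).symm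

noncomputable def phi (p : Polynomial ℂ) (c0 c1 lam z : ℂ) : ℂ := ps (pc (qcoef p lam) c0 c1) z
noncomputable def phid (p : Polynomial ℂ) (c0 c1 lam z : ℂ) : ℂ := ps (dc (pc (qcoef p lam) c0 c1)) z

variable (p : Polynomial ℂ) (c0 c1 : ℂ)

theorem pc_unif (L r : ℝ) (hr : 0 ≤ r) : ∃ C : ℝ, ∀ lam : ℂ, ‖lam‖ ≤ L → ∀ n,
    ‖pc (qcoef p lam) c0 c1 n‖ * r ^ n ≤ C := by
  refine ⟨(‖c0‖ + ‖c1‖ * r) * Real.exp (r ^ 2 *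
    (L + ∑ k ∈ Finset.range (p.natDegree + 1), ‖p.coeff k‖ * r ^ k)), fun lam hl n => ?_⟩
  refine (pc_bound hr (qcoef_bound p hr hl) c0 c1 n).trans ?_
  have hL : 0 ≤ L := (norm_nonneg _).trans hl
  have h1 : 0 ≤ r ^ 2 * (L + ∑ k ∈ Finset.range (p.natDegree + 1), ‖p.coeff k‖ * r ^ k) := by positivity
  have h2 : 0 ≤ 1 / ((n:ℝ) + 1) := by positivity
  refine mul_le_mul_of_nonneg_left (Real.exp_le_exp.2 ?_) (by positivity)
  exact mul_le_of_le_one_right h1 (by linarith)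

theorem pc_ent (lam : ℂ) : Ent (pc (qcoef p lam) c0 c1) := fun r hr => by
  obtain ⟨C, hC⟩ := pc_unif p c0 c1 ‖lam‖ r hr
  exact ⟨C, hC lam le_rfl⟩

theorem phi_hasDeriv (lam z : ℂ) : HasDerivAt (phi p c0 c1 lam) (phid p c0 c1 lam z) z :=
  (pc_ent p c0 c1 lam).hasDerivAt z

theorem phi_zero (lam : ℂ) : phi p c0 c1 lam 0 = c0 := by
  unfold phi ps
  rw [tsum_eq_single 0 (by intro n hn; simp [hn])]; simp [pc]

theorem phid_zero (lam : ℂ) : phid p c0 c1 lam 0 = c1 := by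
  unfold phid ps
  rw [tsum_eq_single 0 (by intro n hn; simp [hn])]; simp [pc, dc]

theorem phid_hasDeriv (lam z : ℂ) :
    HasDerivAt (phid p c0 c1 lam) ((p.eval z + lam) * phi p c0 c1 lam z) z := by
  have h1 := (pc_ent p c0 c1 lam).dc.hasDerivAt z
  refine h1.congr_deriv ?_
  have hq : Summable fun n => ‖qcoef p lam n * z ^ n‖ := by
    apply summable_of_ne_finset_zero (s := Finset.range ((p + Polynomial.C lam).natDegree + 1))
    intro n hn
    rw [qcoef, Polynomial.coeff_eq_zero_of_natDegree_lt (by simpa [Nat.lt_succ_iff] using hn)]; simp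
  have hq2 : p.eval z + lam = ∑' n, qcoef p lam n * z ^ n := by
    rw [tsum_eq_sum (s := Finset.range ((p + Polynomial.C lam).natDegree + 1))]
    · simp only [qcoef]; rw [← Polynomial.eval_eq_sum_range]; simp
    · intro n hn
      rw [qcoef, Polynomial.coeff_eq_zero_of_natDegree_lt (by simpa [Nat.lt_succ_iff] using hn)]; simp
  rw [hq2, phi, ps, ps, tsum_mul_tsum_eq_tsum_sum_range_of_summable_norm hq ((pc_ent p c0 c1 lam).summable z)]
  congr 1; ext n
  have hn1 : ((n:ℂ) + 1) ≠ 0 := by exact_mod_cast Nat.succ_ne_zero n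
  have hn2 : ((n:ℂ) + 2) ≠ 0 := by exact_mod_cast Nat.succ_ne_zero (n+1)
  have : dc (dc (pc (qcoef p lam) c0 c1)) n = ∑ k : Fin (n + 1), qcoef p lam (n - k) * pc (qcoef p lam) c0 c1 k := by
    simp only [dc]
    rw [pc]; push_cast; field_simp; ring
  rw [this, Finset.sum_fin_eq_sum_range, Finset.sum_mul, ← Finset.sum_range_reflect]
  refine Finset.sum_congr rfl fun k hk => ?_
  have hk' := Finset.mem_range.1 hk
  rw [dif_pos (by omega)]
  have e : n - (n + 1 - 1 - k) = k := by omega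
  have e3 : n + 1 - 1 - k = n - k := by omega
  simp only [e3]
  have e2 : z ^ n = z ^ k * z ^ (n - k) := by rw [← pow_add]; congr 1; omega
  rw [e2]
  have e4 : n - (n - k) = k := by omega
  rw [e4]
  ring

theorem pc_diff (n : ℕ) : Differentiable ℂ fun lam => pc (qcoef p lam) c0 c1 n := by
  induction n using Nat.strong_induction_on with
  | _ n ih =>
    match n, ih with
    | 0, _ => simp [pc]
    | 1, _ => simp [pc]
    | n + 2, ih =>
      simp only [pc]
      refine Differentiable.div_const ?_ _
      refine Differentiable.fun_sum fun k _ => ?_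
      refine Differentiable.mul ?_ (ih k (by have := k.2; omega))
      simp only [qcoef, Polynomial.coeff_add, Polynomial.coeff_C]
      split_ifs <;> fun_prop

theorem phi_diff_lam (z : ℂ) : Differentiable ℂ fun lam => phi p c0 c1 lam z := by
  intro lam
  have hl : lam ∈ Metric.ball (0:ℂ) (‖lam‖ + 1) := by simp
  obtain ⟨C, hC⟩ := pc_unif p c0 c1 (‖lam‖ + 1) (2 * ‖z‖) (by positivity)
  refine (Complex.differentiableOn_tsum_of_summable_norm (u := fun n => C * (1/2:ℝ)^n)
    (summable_geometric_two.mul_left C) (fun n => ?_) Metric.isOpen_ball ?_).differentiableAt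
    (Metric.isOpen_ball.mem_nhds hl)
  · exact ((pc_diff p c0 c1 n).mul_const _).differentiableOn
  · intro n w hw
    rw [mem_ball_zero_iff] at hw
    exact ps_bd (hC w hw.le) le_rfl n

theorem phid_diff_lam (z : ℂ) : Differentiable ℂ fun lam => phid p c0 c1 lam z := by
  intro lam
  have hl : lam ∈ Metric.ball (0:ℂ) (‖lam‖ + 1) := by simp
  obtain ⟨C, hC⟩ := pc_unif p c0 c1 (‖lam‖ + 1) (2 * (2 * ‖z‖) + 1) (by positivity)
  have hC' : ∀ lam' : ℂ, ‖lam'‖ ≤ ‖lam‖ + 1 → ∀ n, ‖dc (pc (qcoef p lam') c0 c1) n‖ * (2 * ‖z‖) ^ n ≤ C := by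
    intro lam' hl' n
    refine le_trans ?_ (hC lam' hl' (n + 1))
    simp only [Sib.dc, norm_mul]
    have h1 : ‖((n:ℂ) + 1)‖ ≤ 2 ^ n := by
      have : ((n:ℂ) + 1) = ((n + 1 : ℕ) : ℂ) := by push_cast; rfl
      rw [this, Complex.norm_natCast]
      exact_mod_cast Nat.succ_le_of_lt (Nat.lt_two_pow_self)
    set r := 2 * ‖z‖ with hr
    have hr0 : 0 ≤ r := by positivity
    have h2 : (2 * r) ^ n ≤ (2 * r + 1) ^ (n + 1) := by
      rw [pow_succ]
      have : (2 * r) ^ n ≤ (2 * r + 1) ^ n := pow_le_pow_left₀ (by linarith) (by linarith) n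
      have h3 : 0 ≤ (2 * r + 1) ^ n := by positivity
      nlinarith
    calc ‖((n:ℂ) + 1)‖ * ‖pc (qcoef p lam') c0 c1 (n + 1)‖ * r ^ n
        ≤ 2 ^ n * ‖pc (qcoef p lam') c0 c1 (n + 1)‖ * r ^ n := by gcongr
      _ = ‖pc (qcoef p lam') c0 c1 (n+1)‖ * (2 * r) ^ n := by rw [mul_pow 2 r]; ring
      _ ≤ _ := by gcongr
  refine (Complex.differentiableOn_tsum_of_summable_norm (u := fun n => C * (1/2:ℝ)^n)
    (summable_geometric_two.mul_left C) (fun n => ?_) Metric.isOpen_ball ?_).differentiableAt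
    (Metric.isOpen_ball.mem_nhds hl)
  · exact (((pc_diff p c0 c1 (n+1)).const_mul _).mul_const _).differentiableOn
  · intro n w hw
    rw [mem_ball_zero_iff] at hw
    exact ps_bd (hC' w hw.le) le_rfl n

end Sib


namespace Sib

structure PB (m : ℕ) (p : Polynomial ℂ) (A : ℝ) : Prop where
  hm : 3 ≤ m
  A1 : 1 ≤ A
  h0 : p.eval 0 = 0
  lo : ∀ z : ℂ, ‖p.eval z - z ^ m‖ ≤ A * (1 + ‖z‖) ^ (m - 1)
  lo1 : ∀ z : ℂ, ‖p.eval z - (z + 1) ^ m‖ ≤ A * (1 + ‖z‖) ^ (m - 1)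
  d1 : ∀ z : ℂ, ‖p.derivative.eval z‖ ≤ A * (1 + ‖z‖) ^ (m - 1)
  d2 : ∀ z : ℂ, ‖p.derivative.derivative.eval z‖ ≤ A * (1 + ‖z‖) ^ (m - 2)

theorem poly_bd (p : Polynomial ℂ) (n : ℕ) (h : p.natDegree ≤ n) :
    ∃ A : ℝ, ∀ z : ℂ, ‖p.eval z‖ ≤ A * (1 + ‖z‖) ^ n := by
  refine ⟨∑ k ∈ Finset.range (p.natDegree + 1), ‖p.coeff k‖, fun z => ?_⟩
  rw [Polynomial.eval_eq_sum_range, Finset.sum_mul]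
  refine (norm_sum_le _ _).trans (Finset.sum_le_sum fun k hk => ?_)
  rw [norm_mul, norm_pow]
  have hk' : k ≤ n := by have := Finset.mem_range.1 hk; omega
  refine mul_le_mul_of_nonneg_left ?_ (norm_nonneg _)
  calc ‖z‖ ^ k ≤ (1 + ‖z‖) ^ k := by gcongr; linarith
    _ ≤ _ := pow_le_pow_right₀ (by linarith [norm_nonneg z]) hk'

noncomputable def qp (m : ℕ) (a : ℕ → ℂ) : Polynomial ℂ :=
  Polynomial.X ^ m + ∑ j ∈ Finset.Icc 1 (m - 1), Polynomial.C (a j) * Polynomial.X ^ (m - j)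

theorem qp_eval (m : ℕ) (a : ℕ → ℂ) (z : ℂ) : (qp m a).eval z = z ^ m + Ppoly m a z := by
  simp [qp, Ppoly, Polynomial.eval_finsetSum]

theorem qp_PB (m : ℕ) (hm : 3 ≤ m) (a : ℕ → ℂ) : ∃ A : ℝ, PB m (qp m a) A := by
  set r : Polynomial ℂ := ∑ j ∈ Finset.Icc 1 (m - 1), Polynomial.C (a j) * Polynomial.X ^ (m - j) with hr
  have hrd : r.natDegree ≤ m - 1 := by
    refine Polynomial.natDegree_sum_le_of_forall_le _ _ fun j hj => ?_
    have := Finset.mem_Icc.1 hj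
    exact (Polynomial.natDegree_C_mul_X_pow_le _ _).trans (by omega)
  have hqr : qp m a = Polynomial.X ^ m + r := rfl
  have hd1 : (qp m a).natDegree ≤ m := by
    rw [hqr]
    exact (Polynomial.natDegree_add_le _ _).trans (by simp; omega)
  have hd2 : (qp m a).derivative.natDegree ≤ m - 1 :=
    (Polynomial.natDegree_derivative_le _).trans (by omega)
  have hd3 : (qp m a).derivative.derivative.natDegree ≤ m - 2 :=
    (Polynomial.natDegree_derivative_le _).trans (by omega)
  have hlo1 : (qp m a - (Polynomial.X + 1) ^ m).natDegree ≤ m - 1 := by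
    have h1 : (Polynomial.X ^ m - (Polynomial.X + 1) ^ m : Polynomial ℂ).natDegree ≤ m - 1 := by
      have hlt : (Polynomial.X ^ m - (Polynomial.X + 1) ^ m : Polynomial ℂ).degree < m := by
        have := Polynomial.degree_sub_lt_left (p := (Polynomial.X ^ m : Polynomial ℂ)) (q := (Polynomial.X + 1) ^ m)
          (by rw [Polynomial.degree_X_pow, ← Polynomial.C_1, Polynomial.degree_pow, Polynomial.degree_X_add_C]; simp)
          (pow_ne_zero _ Polynomial.X_ne_zero)
          (by rw [← Polynomial.C_1, (Polynomial.monic_X_pow m).leadingCoeff,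
            ((Polynomial.monic_X_add_C (1:ℂ)).pow m).leadingCoeff])
        rwa [Polynomial.degree_X_pow] at this
      by_cases h0 : (Polynomial.X ^ m - (Polynomial.X + 1) ^ m : Polynomial ℂ) = 0
      · rw [h0]; simp
      · have := (Polynomial.natDegree_lt_iff_degree_lt h0).2 hlt
        omega
    have h2 : qp m a - (Polynomial.X + 1) ^ m = (Polynomial.X ^ m - (Polynomial.X + 1) ^ m) + r := by
      rw [hqr]; ring
    rw [h2]
    exact (Polynomial.natDegree_add_le _ _).trans (max_le h1 hrd)
  obtain ⟨A1, h1⟩ := poly_bd r _ hrd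
  obtain ⟨A2, h2⟩ := poly_bd _ _ hlo1
  obtain ⟨A3, h3⟩ := poly_bd _ _ hd2
  obtain ⟨A4, h4⟩ := poly_bd _ _ hd3
  have hx : ∀ z : ℂ, ∀ n : ℕ, 0 ≤ (1 + ‖z‖) ^ n := fun z n => by positivity
  have w : ∀ (B : ℝ) (z : ℂ) (n : ℕ), B ≤ 1 + |A1| + |A2| + |A3| + |A4| →
      B * (1 + ‖z‖) ^ n ≤ (1 + |A1| + |A2| + |A3| + |A4|) * (1 + ‖z‖) ^ n :=
    fun B z n h => mul_le_mul_of_nonneg_right h (hx z n)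
  refine ⟨1 + |A1| + |A2| + |A3| + |A4|, hm, ?_, ?_, ?_, ?_, ?_, ?_⟩
  · have := abs_nonneg A1; have := abs_nonneg A2; have := abs_nonneg A3; have := abs_nonneg A4
    linarith
  · rw [qp_eval, Ppoly, zero_pow (by omega), zero_add]
    refine Finset.sum_eq_zero fun j hj => ?_
    have := Finset.mem_Icc.1 hj
    rw [zero_pow (by omega), mul_zero]
  all_goals intro z
  · have : (qp m a).eval z - z ^ m = r.eval z := by rw [hqr]; simp
    rw [this]; refine (h1 z).trans (w _ _ _ ?_)
    have := le_abs_self A1; have := abs_nonneg A2; have := abs_nonneg A3; have := abs_nonneg A4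
    linarith
  · have : (qp m a).eval z - (z + 1) ^ m = (qp m a - (Polynomial.X + 1) ^ m).eval z := by simp
    rw [this]; refine (h2 z).trans (w _ _ _ ?_)
    have := abs_nonneg A1; have := le_abs_self A2; have := abs_nonneg A3; have := abs_nonneg A4
    linarith
  · refine (h3 z).trans (w _ _ _ ?_)
    have := abs_nonneg A1; have := abs_nonneg A2; have := le_abs_self A3; have := abs_nonneg A4
    linarith
  · refine (h4 z).trans (w _ _ _ ?_)
    have := abs_nonneg A1; have := abs_nonneg A2; have := abs_nonneg A3; have := le_abs_self A4
    linarith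

/-! ### square roots -/

noncomputable def SS (p : Polynomial ℂ) (lam w : ℂ) : ℂ := (p.eval w + lam) ^ (1/4 : ℂ)
noncomputable def RR (p : Polynomial ℂ) (lam w : ℂ) : ℂ := (SS p lam w) ^ 2
noncomputable def gg (p : Polynomial ℂ) (lam w : ℂ) : ℂ :=
  (5/16) * (p.derivative.eval w) ^ 2 / (SS p lam w) ^ 10 - (1/4) * p.derivative.derivative.eval w / (SS p lam w) ^ 6

def Good (m : ℕ) (p : Polynomial ℂ) (c M : ℝ) (lam w : ℂ) : Prop :=
  c * ((1 + ‖w‖) ^ m + M) ≤ ‖p.eval w + lam‖ + (p.eval w + lam).re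

theorem slit_of_pos {μ : ℂ} (h : 0 < ‖μ‖ + μ.re) : μ ∈ slitPlane := by
  by_contra hn
  rw [Complex.mem_slitPlane_iff, not_or, not_lt, not_not] at hn
  have : ‖μ‖ = -μ.re := by
    have h1 : μ = (μ.re : ℂ) := by apply Complex.ext <;> simp [hn.2]
    rw [h1, Complex.norm_real, Real.norm_eq_abs, abs_of_nonpos hn.1]; simp
  linarith

theorem pos_of_slit {μ : ℂ} (h : μ ∈ slitPlane) : 0 < ‖μ‖ + μ.re := by
  rw [Complex.mem_slitPlane_iff] at h
  rcases h with h | h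
  · have := norm_nonneg μ; linarith
  · have := Complex.abs_re_lt_norm.2 h
    have := neg_abs_le μ.re
    linarith

theorem SS_pow4 (p : Polynomial ℂ) (lam w : ℂ) : SS p lam w ^ 4 = p.eval w + lam := by
  rw [SS, ← Complex.cpow_nat_mul]; norm_num

theorem RR_sq (p : Polynomial ℂ) (lam w : ℂ) : RR p lam w ^ 2 = p.eval w + lam := by
  rw [RR, ← pow_mul, SS_pow4]

theorem RR_eq (p : Polynomial ℂ) (lam w : ℂ) : RR p lam w = (p.eval w + lam) ^ (1/2 : ℂ) := by
  rw [RR, SS, ← Complex.cpow_nat_mul]; norm_num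

theorem RR_norm_sq (p : Polynomial ℂ) (lam w : ℂ) : ‖RR p lam w‖ ^ 2 = ‖p.eval w + lam‖ := by
  rw [← norm_pow, RR_sq]

theorem SS_norm_sq (p : Polynomial ℂ) (lam w : ℂ) : ‖SS p lam w‖ ^ 2 = ‖RR p lam w‖ := by
  rw [← norm_pow, RR]

theorem RR_re_sq (p : Polynomial ℂ) (lam w : ℂ) :
    2 * (RR p lam w).re ^ 2 = ‖p.eval w + lam‖ + (p.eval w + lam).re := by
  rw [← RR_norm_sq, ← RR_sq, Complex.sq_norm, Complex.normSq_apply]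
  simp [sq]; ring

theorem sqrt_re_nonneg (μ : ℂ) : 0 ≤ (μ ^ (1/2 : ℂ)).re := by
  by_cases h : μ = 0
  · subst h; simp
  rw [Complex.cpow_def_of_ne_zero h, Complex.exp_re]
  apply mul_nonneg (Real.exp_pos _).le
  apply Real.cos_nonneg_of_mem_Icc
  have h1 := Complex.neg_pi_lt_arg μ
  have h2 := Complex.arg_le_pi μ
  have : (Complex.log μ * (1 / 2)).im = μ.arg / 2 := by
    have : (Complex.log μ * (1/2)) = ((1/2 : ℝ) : ℂ) * Complex.log μ := by push_cast; ring
    rw [this, Complex.im_ofReal_mul, Complex.log_im]; ring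
  rw [this]; constructor <;> linarith

theorem RR_re_nonneg (p : Polynomial ℂ) (lam w : ℂ) : 0 ≤ (RR p lam w).re := by
  rw [RR_eq]; exact sqrt_re_nonneg _

section
variable {p : Polynomial ℂ} {lam w : ℂ}

theorem SS_ne (h : p.eval w + lam ∈ slitPlane) : SS p lam w ≠ 0 := by
  intro h0
  have := SS_pow4 p lam w
  rw [h0] at this
  exact Complex.slitPlane_ne_zero h (by rw [← this]; norm_num)

theorem RR_ne (h : p.eval w + lam ∈ slitPlane) : RR p lam w ≠ 0 := pow_ne_zero _ (SS_ne h)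

theorem SS_deriv (h : p.eval w + lam ∈ slitPlane) :
    HasDerivAt (SS p lam) (p.derivative.eval w / (4 * SS p lam w ^ 3)) w := by
  have h1 : HasDerivAt (fun w => p.eval w + lam) (p.derivative.eval w) w := (p.hasDerivAt w).add_const lam
  have h2 := h1.cpow_const (c := (1/4 : ℂ)) h
  refine h2.congr_deriv ?_
  rw [Complex.cpow_sub _ _ (Complex.slitPlane_ne_zero h), Complex.cpow_one]
  have h3 := SS_pow4 p lam w
  have h4 := SS_ne h
  change 1/4 * (SS p lam w / (p.eval w + lam)) * _ = _
  rw [← h3]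
  field_simp

theorem RR_deriv (h : p.eval w + lam ∈ slitPlane) :
    HasDerivAt (RR p lam) (p.derivative.eval w / (2 * RR p lam w)) w := by
  have := (SS_deriv h).pow 2
  refine this.congr_deriv ?_
  have h4 := SS_ne h
  simp only [RR]
  field_simp; norm_num; try ring

theorem SS_deriv_lam (h : p.eval w + lam ∈ slitPlane) :
    DifferentiableAt ℂ (fun lam => SS p lam w) lam := by
  have h1 : HasDerivAt (fun lam => p.eval w + lam) 1 lam := (hasDerivAt_id lam).const_add _
  exact (h1.cpow_const (c := (1/4 : ℂ)) h).differentiableAt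

theorem gg_diff (h : p.eval w + lam ∈ slitPlane) : DifferentiableAt ℂ (gg p lam) w := by
  have h1 := (SS_deriv h).differentiableAt
  have h4 := SS_ne h
  unfold gg
  refine DifferentiableAt.sub (DifferentiableAt.div ?_ (h1.pow _) (pow_ne_zero _ h4))
    (DifferentiableAt.div ?_ (h1.pow _) (pow_ne_zero _ h4))
  · exact ((p.derivative.differentiableAt).pow 2).const_mul _
  · exact (p.derivative.derivative.differentiableAt).const_mul _

theorem gg_diff_lam (h : p.eval w + lam ∈ slitPlane) : DifferentiableAt ℂ (fun lam => gg p lam w) lam := by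
  have h1 := SS_deriv_lam h
  have h4 := SS_ne h
  unfold gg
  exact DifferentiableAt.sub (DifferentiableAt.div (differentiableAt_const _) (h1.pow _) (pow_ne_zero _ h4))
    (DifferentiableAt.div (differentiableAt_const _) (h1.pow _) (pow_ne_zero _ h4))

theorem RR_diff_lam (h : p.eval w + lam ∈ slitPlane) : DifferentiableAt ℂ (fun lam => RR p lam w) lam :=
  (SS_deriv_lam h).pow 2

end

section good
variable {m : ℕ} {p : Polynomial ℂ} {A c M : ℝ} {lam w : ℂ}

theorem Good.Ypos (hM : 0 ≤ M) : 0 < (1 + ‖w‖) ^ m + M := by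
  have : 0 < (1 + ‖w‖) ^ m := by positivity
  linarith

theorem Good.slit (hc : 0 < c) (hM : 0 ≤ M) (h : Good m p c M lam w) : p.eval w + lam ∈ slitPlane :=
  slit_of_pos (lt_of_lt_of_le (mul_pos hc (Good.Ypos hM)) h)

theorem Good.re_sq (h : Good m p c M lam w) : c / 2 * ((1 + ‖w‖) ^ m + M) ≤ (RR p lam w).re ^ 2 := by
  have := RR_re_sq p lam w
  unfold Good at h
  linarith

theorem Good.norm_ge (h : Good m p c M lam w) : c / 2 * ((1 + ‖w‖) ^ m + M) ≤ ‖p.eval w + lam‖ := by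
  have := Complex.re_le_norm (p.eval w + lam)
  unfold Good at h
  linarith

theorem Good.gg_le (hP : PB m p A) (hc : 0 < c) (hc1 : c ≤ 1) (hM : 0 < M) (h : Good m p c M lam w) :
    ‖gg p lam w‖ ≤ (3 * A ^ 2 / c ^ 2) / Real.sqrt (c * M / 2) / (1 + ‖w‖) ^ 2 := by
  have hsl := h.slit hc hM.le
  set X := 1 + ‖w‖ with hX
  have hX1 : 1 ≤ X := by have := norm_nonneg w; linarith
  have hX0 : 0 < X := by linarith
  set ρ := ‖RR p lam w‖ with hρ
  have hρ0 : 0 < ρ := norm_pos_iff.2 (RR_ne hsl)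
  have hρ2 : c / 2 * (X ^ m + M) ≤ ρ ^ 2 := by rw [hρ, RR_norm_sq]; exact h.norm_ge
  have hS10 : ‖SS p lam w ^ 10‖ = ρ ^ 5 := by rw [norm_pow, hρ, ← SS_norm_sq]; ring
  have hS6 : ‖SS p lam w ^ 6‖ = ρ ^ 3 := by rw [norm_pow, hρ, ← SS_norm_sq]; ring
  have hm := hP.hm
  have hA := hP.A1
  have hXm : X ^ m ≤ 2 / c * ρ ^ 2 := by
    rw [div_mul_eq_mul_div, le_div_iff₀ hc]
    nlinarith
  have e1 : X ^ (m - 1) * X = X ^ m := by rw [← pow_succ]; congr 1; omega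
  have e2 : X ^ (m - 2) * X ^ 2 = X ^ m := by rw [← pow_add]; congr 1; omega
  have b1 : ‖(5/16) * (p.derivative.eval w) ^ 2 / (SS p lam w) ^ 10‖ ≤ (5/4) * A ^ 2 / c ^ 2 / (ρ * X ^ 2) := by
    rw [norm_div, hS10, norm_mul, norm_pow]
    have h1 := hP.d1 w
    rw [← hX] at h1
    have h516 : ‖(5/16 : ℂ)‖ = 5/16 := by norm_num
    rw [h516, div_le_div_iff₀ (by positivity) (by positivity)]
    have h2 : ‖p.derivative.eval w‖ * X ≤ A * (2 / c * ρ ^ 2) := by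
      calc _ ≤ A * X ^ (m-1) * X := by gcongr
        _ = A * X ^ m := by rw [mul_assoc, e1]
        _ ≤ _ := by gcongr
    have h3 : (‖p.derivative.eval w‖ * X) ^ 2 ≤ (A * (2 / c * ρ ^ 2)) ^ 2 := by gcongr
    calc 5 / 16 * ‖p.derivative.eval w‖ ^ 2 * (ρ * X ^ 2) = 5/16 * ρ * (‖p.derivative.eval w‖ * X) ^ 2 := by ring
      _ ≤ 5/16 * ρ * (A * (2 / c * ρ ^ 2)) ^ 2 := by gcongr
      _ = _ := by field_simp; ring
  have b2 : ‖(1/4) * p.derivative.derivative.eval w / (SS p lam w) ^ 6‖ ≤ (1/2) * A / c / (ρ * X ^ 2) := by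
    rw [norm_div, hS6, norm_mul]
    have h1 := hP.d2 w
    rw [← hX] at h1
    have h14 : ‖(1/4 : ℂ)‖ = 1/4 := by norm_num
    rw [h14, div_le_div_iff₀ (by positivity) (by positivity)]
    have h2 : ‖p.derivative.derivative.eval w‖ * X ^ 2 ≤ A * (2 / c * ρ ^ 2) := by
      calc _ ≤ A * X ^ (m-2) * X ^ 2 := by gcongr
        _ = A * X ^ m := by rw [mul_assoc, e2]
        _ ≤ _ := by gcongr
    calc 1/4 * ‖p.derivative.derivative.eval w‖ * (ρ * X ^ 2) = 1/4 * ρ * (‖p.derivative.derivative.eval w‖ * X ^ 2) := by ring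
      _ ≤ 1/4 * ρ * (A * (2 / c * ρ ^ 2)) := by gcongr
      _ = _ := by field_simp; ring
  have hsq : Real.sqrt (c * M / 2) ≤ ρ := by
    apply Real.sqrt_le_iff.2
    refine ⟨hρ0.le, ?_⟩
    have : 0 < X ^ m := by positivity
    nlinarith
  have hsq0 : 0 < Real.sqrt (c * M / 2) := Real.sqrt_pos.2 (by positivity)
  have hAc : (1/2) * A / c ≤ (1/2) * A ^ 2 / c ^ 2 := by
    rw [div_le_div_iff₀ hc (by positivity)]
    have : A * c ^ 2 ≤ A ^ 2 * c := by nlinarith [mul_pos (by linarith : 0 < A) hc, mul_le_mul hc1 hA (by norm_num) (by norm_num)]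
    linarith
  calc ‖gg p lam w‖ ≤ _ := norm_sub_le _ _
    _ ≤ (5/4) * A ^ 2 / c ^ 2 / (ρ * X ^ 2) + (1/2) * A / c / (ρ * X ^ 2) := add_le_add b1 b2
    _ ≤ (5/4) * A ^ 2 / c ^ 2 / (ρ * X ^ 2) + (1/2) * A ^ 2 / c ^ 2 / (ρ * X ^ 2) := 
      add_le_add le_rfl (div_le_div_of_nonneg_right hAc (by positivity))
    _ = (7/4 * A ^ 2 / c ^ 2) / (ρ * X ^ 2) := by ring
    _ ≤ (3 * A ^ 2 / c ^ 2) / (Real.sqrt (c * M / 2) * X ^ 2) := by gcongr; norm_num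
    _ = _ := by rw [div_div (3 * A ^ 2 / c ^ 2)]

end good

theorem RR_sub_le (p : Polynomial ℂ) {l1 l0 w : ℂ} (h0 : 0 < (RR p l0 w).re) :
    ‖RR p l1 w - RR p l0 w‖ ≤ ‖l1 - l0‖ / (RR p l0 w).re := by
  rw [le_div_iff₀ h0]
  have h1 : (RR p l1 w - RR p l0 w) * (RR p l1 w + RR p l0 w) = l1 - l0 := by
    have e1 := RR_sq p l1 w
    have e2 := RR_sq p l0 w
    linear_combination e1 - e2
  have h2 : (RR p l0 w).re ≤ ‖RR p l1 w + RR p l0 w‖ := by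
    refine le_trans ?_ (Complex.re_le_norm _)
    rw [Complex.add_re]; linarith [RR_re_nonneg p l1 w]
  calc _ ≤ ‖RR p l1 w - RR p l0 w‖ * ‖RR p l1 w + RR p l0 w‖ := by gcongr
    _ = _ := by rw [← norm_mul, h1]

/-! ### cone geometry -/

theorem cone_add {μ : ℂ} {c s : ℝ} (hc1 : c ≤ 1) (hs : 0 ≤ s) (h : c * ‖μ‖ ≤ ‖μ‖ + μ.re) (hc : 0 ≤ c) :
    c / 4 * (‖μ‖ + s) ≤ ‖μ + s‖ + (μ + s).re := by
  have hre : (μ + (s:ℂ)).re = μ.re + s := by simp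
  have hn := norm_nonneg μ
  by_cases h1 : s ≤ 3 * ‖μ‖
  · have h2 : ‖μ‖ - s ≤ ‖μ + s‖ := by
      have := norm_sub_norm_le μ (-(s:ℂ))
      rw [norm_neg, Complex.norm_real, Real.norm_of_nonneg hs, sub_neg_eq_add] at this
      exact this
    rw [hre]
    nlinarith
  · have h2 := Complex.re_le_norm (μ + s)
    have h3 := Complex.abs_re_le_norm μ
    have h4 := neg_abs_le μ.re
    rw [hre] at h2 ⊢
    push Not at h1
    nlinarith

theorem nn_sub {μ ν : ℂ} : ‖μ‖ + μ.re - 2 * ‖ν - μ‖ ≤ ‖ν‖ + ν.re := by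
  have h1 : ‖μ‖ - ‖ν - μ‖ ≤ ‖ν‖ := by
    have := norm_sub_norm_le μ (μ - ν)
    rw [sub_sub_cancel, norm_sub_rev] at this
    linarith
  have h2 := Complex.abs_re_le_norm (ν - μ)
  have h3 := neg_abs_le (ν - μ).re
  rw [Complex.sub_re] at *
  linarith

theorem good_master {m : ℕ} {p : Polynomial ℂ} {A c : ℝ} (hP : PB m p A) (hc : 0 < c) (hc1 : c ≤ 1) :
    ∃ K0 : ℝ, 1 ≤ K0 ∧ ∀ (lam w : ℂ) (M : ℝ), 0 ≤ M →
      c * (‖w + 1‖ ^ m + M) ≤ ‖(w + 1) ^ m + lam‖ + ((w + 1) ^ m + lam).re →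
      (K0 ≤ M ∨ K0 ≤ ‖w‖) → Good m p (c / 2 ^ (m + 1)) M lam w := by
  have hm := hP.hm
  have hA := hP.A1
  set ε := c / 2 ^ (m + 1) with hε
  have hε0 : 0 < ε := by positivity
  have hε1 : ε ≤ c / 2 := by
    rw [hε, pow_succ, ← div_div]
    have : (1:ℝ) ≤ 2 ^ m := one_le_pow₀ (by norm_num)
    have h2 := div_le_self hc.le this
    linarith
  have hε2 : 2 * ε = c / 2 ^ m := by rw [hε, pow_succ]; field_simp
  set D := 2 * A + c * 2 ^ m with hD
  have hD0 : 0 < D := by positivity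
  set X0 := D / ε with hX0
  have hX00 : 0 < X0 := by positivity
  refine ⟨1 + X0 + D * X0 ^ (m - 1) / (c / 2), ?_, ?_⟩
  · have : 0 ≤ D * X0 ^ (m - 1) / (c / 2) := by positivity
    linarith
  intro lam w M hM hN hor
  unfold Good
  set X := 1 + ‖w‖ with hX
  have hX1 : 1 ≤ X := by have := norm_nonneg w; linarith
  have e1 : X ^ (m - 1) * X = X ^ m := by rw [← pow_succ]; congr 1; omega
  have hXp : 1 ≤ X ^ (m - 1) := one_le_pow₀ hX1
  have h1 : X ^ m / 2 ^ m - 2 ^ m ≤ ‖w + 1‖ ^ m := by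
    by_cases hx : X ≤ 4
    · have : X ^ m / 2 ^ m ≤ 2 ^ m := by
        rw [div_le_iff₀ (by positivity), ← mul_pow]
        apply pow_le_pow_left₀ (by linarith); linarith
      have : 0 ≤ ‖w + 1‖ ^ m := by positivity
      linarith
    · push Not at hx
      have h2 : X / 2 ≤ ‖w + 1‖ := by
        have := norm_sub_le (w + 1) 1
        rw [add_sub_cancel_right, norm_one] at this
        linarith
      have : (X / 2) ^ m ≤ ‖w + 1‖ ^ m := pow_le_pow_left₀ (by linarith) h2 m
      rw [div_pow] at this
      have : (0:ℝ) < 2 ^ m := by positivity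
      linarith
  have h2 := nn_sub (μ := (w + 1) ^ m + lam) (ν := p.eval w + lam)
  have h3 : ‖p.eval w + lam - ((w + 1) ^ m + lam)‖ ≤ A * X ^ (m - 1) := by
    have := hP.lo1 w
    rwa [add_sub_add_right_eq_sub]
  have h4 : D * X ^ (m - 1) ≤ ε * X ^ m + c / 2 * M := by
    have hcM : 0 ≤ c / 2 * M := by positivity
    by_cases hx : X0 ≤ X
    · have : D ≤ ε * X := by rw [hX0, div_le_iff₀ hε0] at hx; linarith
      have := mul_le_mul_of_nonneg_right this (by positivity : 0 ≤ X ^ (m - 1))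
      have e3 : ε * X * X ^ (m - 1) = ε * X ^ m := by rw [← e1]; ring
      linarith
    · push Not at hx
      rcases hor with ho | ho
      · have h5 : D * X0 ^ (m - 1) / (c / 2) ≤ M := by linarith
        rw [div_le_iff₀ (by positivity)] at h5
        have : D * X ^ (m - 1) ≤ D * X0 ^ (m - 1) := by gcongr
        have : 0 ≤ ε * X ^ m := by positivity
        linarith
      · have : 0 ≤ D * X0 ^ (m - 1) / (c / 2) := by positivity
        linarith
  have h6 : c * (X ^ m / 2 ^ m - 2 ^ m) ≤ c * ‖w + 1‖ ^ m := by gcongr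
  have h7 : c * (X ^ m / 2 ^ m) = 2 * ε * X ^ m := by rw [hε2]; ring
  have h8 : ε * M ≤ c / 2 * M := by gcongr
  have h9 : c * 2 ^ m ≤ c * 2 ^ m * X ^ (m - 1) := le_mul_of_one_le_right (by positivity) hXp
  rw [hD] at h4
  nlinarith

/-- half-opening of the wedge -/
noncomputable def th (m : ℕ) : ℝ := Real.pi / (m + 1)
noncomputable def cw (m : ℕ) : ℝ := 1 - Real.cos (th m)

theorem th_pos (m : ℕ) : 0 < th m := by unfold th; positivity
theorem th_le (m : ℕ) (hm : 3 ≤ m) : th m ≤ Real.pi / 4 := by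
  unfold th
  have : (3:ℝ) ≤ m := by exact_mod_cast hm
  have := Real.pi_pos
  gcongr; linarith

theorem cw_pos (m : ℕ) (hm : 3 ≤ m) : 0 < cw m := by
  unfold cw
  have h1 := th_pos m
  have h2 := th_le m hm
  have h3 := Real.pi_pos
  have := Real.cos_lt_cos_of_nonneg_of_le_pi (le_refl 0) (by linarith : th m ≤ Real.pi) h1
  rw [Real.cos_zero] at this; linarith

theorem cw_le (m : ℕ) (hm : 3 ≤ m) : cw m ≤ 1 := by
  unfold cw
  have h1 := th_pos m
  have h2 := th_le m hm
  have h3 := Real.pi_pos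
  have := Real.cos_nonneg_of_mem_Icc (x := th m) ⟨by linarith, by linarith⟩
  linarith

theorem wedge_arg {m : ℕ} (hm : 3 ≤ m) {v : ℂ} (h : |v.im| < Real.tan (th m) * v.re) : |v.arg| < th m := by
  have h1 := th_pos m
  have h2 := th_le m hm
  have h3 := Real.pi_pos
  have ht : 0 < Real.tan (th m) := Real.tan_pos_of_pos_of_lt_pi_div_two h1 (by linarith)
  have hre : 0 < v.re := by
    by_contra hn
    push Not at hn
    have := abs_nonneg v.im
    nlinarith
  have hlt := Complex.abs_arg_lt_pi_div_two_iff.2 (Or.inl hre)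
  have hta : Real.tan v.arg = v.im / v.re := Complex.tan_arg v
  rw [abs_lt] at hlt h ⊢
  constructor
  · by_contra hn
    push Not at hn
    have : Real.tan v.arg ≤ Real.tan (-(th m)) := by
      rcases eq_or_lt_of_le hn with e | e
      · rw [e]
      · exact (Real.tan_lt_tan_of_lt_of_lt_pi_div_two hlt.1 (by linarith) e).le
    rw [hta, Real.tan_neg, div_le_iff₀ hre] at this
    linarith
  · by_contra hn
    push Not at hn
    have : Real.tan (th m) ≤ Real.tan v.arg := by
      rcases eq_or_lt_of_le hn with e | e
      · rw [e]
      · exact (Real.tan_lt_tan_of_lt_of_lt_pi_div_two (by linarith) hlt.2 e).le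
    rw [hta, le_div_iff₀ hre] at this
    linarith

theorem wedge_pow {m : ℕ} (hm : 3 ≤ m) {v : ℂ} (h : |v.arg| ≤ th m) :
    cw m * ‖v ^ m‖ ≤ ‖v ^ m‖ + (v ^ m).re := by
  have h1 : v ^ m = ((‖v‖ ^ m : ℝ) : ℂ) * Complex.exp (((m * v.arg : ℝ) : ℂ) * Complex.I) := by
    conv_lhs => rw [← Complex.norm_mul_exp_arg_mul_I v]
    rw [mul_pow, ← Complex.exp_nat_mul]; push_cast; ring_nf
  have h2 : (v ^ m).re = ‖v‖ ^ m * Real.cos (m * v.arg) := by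
    rw [h1, Complex.re_ofReal_mul, Complex.exp_ofReal_mul_I_re]
  have h3 : Real.cos (Real.pi - th m) ≤ Real.cos (m * v.arg) := by
    rw [← Real.cos_abs (m * v.arg)]
    apply Real.cos_le_cos_of_nonneg_of_le_pi (abs_nonneg _) (by linarith [th_pos m])
    rw [abs_mul, Nat.abs_cast]
    have : (m:ℝ) * th m = Real.pi - th m := by unfold th; field_simp; ring
    rw [← this]; gcongr
  rw [Real.cos_pi_sub] at h3
  rw [h2, norm_pow]
  unfold cw
  have : 0 ≤ ‖v‖ ^ m := by positivity
  nlinarith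

end Sib


namespace Sib

/-! ### primitives on star-shaped sets -/

theorem star_prim {U : Set ℂ} (hU : IsOpen U) (hs : ∀ w ∈ U, ∀ s ∈ Icc (0:ℝ) 1, (s:ℂ) * w ∈ U)
    {f : ℂ → ℂ} (hf : DifferentiableOn ℂ f U) :
    ∀ w ∈ U, HasDerivAt (fun w => ∫ s in Ioc (0:ℝ) 1, w * f ((s:ℂ) * w)) (f w) w := by
  intro w0 hw0
  obtain ⟨r, hr, hrU⟩ := Metric.nhds_basis_closedBall.mem_iff.1 (hU.mem_nhds hw0)
  have hK : IsCompact ((fun q : ℝ × ℂ => (q.1:ℂ) * q.2) '' (Icc (0:ℝ) 1 ×ˢ Metric.closedBall w0 r)) := by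
    apply IsCompact.image (isCompact_Icc.prod (isCompact_closedBall _ _))
    fun_prop
  have hKU : ((fun q : ℝ × ℂ => (q.1:ℂ) * q.2) '' (Icc (0:ℝ) 1 ×ˢ Metric.closedBall w0 r)) ⊆ U := by
    rintro _ ⟨⟨s, u⟩, ⟨hs1, hu1⟩, rfl⟩
    exact hs u (hrU hu1) s hs1
  obtain ⟨C, hC⟩ := hK.exists_bound_of_continuousOn (hf.continuousOn.mono hKU)
  have hsub : Metric.ball w0 r ⊆ U := Metric.ball_subset_closedBall.trans hrU
  have hd : ∀ s ∈ Ioc (0:ℝ) 1, ∀ u ∈ U, HasDerivAt (fun u => u * f ((s:ℂ) * u))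
      (f (s * u) + u * (deriv f (s * u) * s)) u := by
    intro s hs1 u hu
    have h1 : HasDerivAt f (deriv f (s * u)) (s * u) :=
      (hf.differentiableAt (hU.mem_nhds (hs u hu s ⟨hs1.1.le, hs1.2⟩))).hasDerivAt
    have h2 : HasDerivAt (fun u : ℂ => (s:ℂ) * u) s u := by
      simpa using (hasDerivAt_id u).const_mul (s:ℂ)
    have h3 : HasDerivAt (fun u : ℂ => f ((s:ℂ) * u)) (deriv f (s * u) * s) u :=
      HasDerivAt.comp u h1 h2
    refine ((hasDerivAt_id u).mul h3).congr_deriv ?_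
    simp
  have hcs : ∀ u ∈ U, ContinuousOn (fun s : ℝ => f ((s:ℂ) * u)) (Icc 0 1) := by
    intro u hu
    refine hf.continuousOn.comp (by fun_prop) fun s hs1 => hs u hu s hs1
  have key := paramInt (μ := volume.restrict (Ioc (0:ℝ) 1)) Metric.isOpen_ball
    (U := Metric.ball w0 r) (G := fun u s => u * f ((s:ℂ) * u)) (b := fun _ => (‖w0‖ + r) * C)
    (fun u hu => ((continuousOn_const.mul (hcs u (hsub hu))).mono Ioc_subset_Icc_self).aestronglyMeasurable
      measurableSet_Ioc)
    ((ae_restrict_iff' measurableSet_Ioc).2 (ae_of_all _ fun s hs1 u hu =>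
      (hd s hs1 u (hsub hu)).differentiableAt.differentiableWithinAt))
    ((ae_restrict_iff' measurableSet_Ioc).2 (ae_of_all _ fun s hs1 u hu => by
      rw [norm_mul]
      have h1 : ‖u‖ ≤ ‖w0‖ + r := by
        have := norm_sub_norm_le u w0
        have h2 := mem_ball_iff_norm.1 hu
        linarith
      have h2 := hC ((s:ℂ) * u) ⟨(s, u), ⟨⟨hs1.1.le, hs1.2⟩, Metric.ball_subset_closedBall hu⟩, rfl⟩
      have := norm_nonneg w0
      exact mul_le_mul h1 h2 (norm_nonneg _) (by linarith)))
    (integrable_const _) w0 (Metric.mem_ball_self hr)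
  refine key.congr_deriv ?_
  have hhI : ∫ s in Ioc (0:ℝ) 1, deriv (fun u => u * f ((s:ℂ) * u)) w0
      = ∫ s in (0:ℝ)..1, (f (s * w0) + w0 * (deriv f (s * w0) * s)) := by
    rw [intervalIntegral.integral_of_le zero_le_one]
    exact setIntegral_congr_fun measurableSet_Ioc fun s hs1 => (hd s hs1 w0 hw0).deriv
  rw [hhI]
  have hcd : ContinuousOn (fun s : ℝ => deriv f ((s:ℂ) * w0)) (Icc 0 1) := by
    refine (hf.deriv hU).continuousOn.comp (by fun_prop) fun s hs1 => hs w0 hw0 s hs1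
  have := intervalIntegral.integral_eq_sub_of_hasDerivAt (a := 0) (b := 1)
    (f := fun s : ℝ => (s:ℂ) * f ((s:ℂ) * w0)) (f' := fun s : ℝ => f (s * w0) + w0 * (deriv f (s * w0) * s))
    (fun s hs1 => by
      rw [uIcc_of_le zero_le_one] at hs1
      have h1 : HasDerivAt f (deriv f (s * w0)) (s * w0) :=
        (hf.differentiableAt (hU.mem_nhds (hs w0 hw0 s hs1))).hasDerivAt
      have h2 : HasDerivAt (fun s : ℝ => (s:ℂ) * w0) w0 s := by
        simpa using (Complex.ofRealCLM.hasDerivAt (x := s)).mul_const w0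
      have h3 : HasDerivAt (fun s : ℝ => f ((s:ℂ) * w0)) (deriv f (s * w0) * w0) s :=
        HasDerivAt.comp s h1 h2
      have h4 := (Complex.ofRealCLM.hasDerivAt (x := s)).mul h3
      refine h4.congr_deriv ?_
      simp; ring)
    (by
      apply ContinuousOn.intervalIntegrable
      rw [uIcc_of_le zero_le_one]
      exact (hcs w0 hw0).add (continuousOn_const.mul (hcd.mul (by fun_prop))))
  rw [this]; simp

/-! ### majorant -/

noncomputable def jj (t : ℝ) : ℝ := (1 + t) ^ (-(5/4) : ℝ)

theorem jj_int : IntegrableOn jj (Ioi 0) ∧ ∫ t in Ioi 0, jj t = 4 := by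
  have h := integrableOn_Ioi_rpow_of_lt (a := -(5/4)) (by norm_num) (c := 1) one_pos
  have h2 := integral_Ioi_rpow_of_lt (a := -(5/4)) (by norm_num) (c := 1) one_pos
  have e := (measurePreserving_add_left (volume : Measure ℝ) 1)
  have emb := (MeasurableEquiv.addLeft (1:ℝ)).measurableEmbedding
  have hpre : (fun x : ℝ => 1 + x) ⁻¹' (Ioi 1) = Ioi 0 := by ext x; simp
  constructor
  · have := (e.integrableOn_comp_preimage emb (f := fun x : ℝ => x ^ (-(5/4) : ℝ)) (s := Ioi 1)).2 h
    rw [hpre] at this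
    exact this
  · have := e.setIntegral_preimage_emb emb (fun x : ℝ => x ^ (-(5/4) : ℝ)) (Ioi 1)
    rw [hpre] at this
    rw [show (∫ t in Ioi 0, jj t) = ∫ t in Ioi 0, (1 + t) ^ (-(5/4) : ℝ) from rfl, this, h2]
    norm_num

theorem jj_pos {t : ℝ} (ht : 0 ≤ t) : 0 < jj t := by unfold jj; positivity

theorem jj_anti {t τ : ℝ} (ht : 0 ≤ t) (hτ : 0 ≤ τ) : jj (τ + t) ≤ jj t := by
  unfold jj
  exact Real.rpow_le_rpow_of_nonpos (by positivity) (by linarith) (by norm_num)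

/-- decay weight -/
noncomputable def dd (x : ℝ) : ℝ := (1 + x) ^ (-(1/4) : ℝ)

theorem dd_pos {x : ℝ} (hx : 0 ≤ x) : 0 < dd x := by unfold dd; positivity
theorem dd_le_one {x : ℝ} (hx : 0 ≤ x) : dd x ≤ 1 := by
  unfold dd; exact Real.rpow_le_one_of_one_le_of_nonpos (by linarith) (by norm_num)
theorem dd_tendsto : Tendsto dd atTop (nhds 0) := by
  unfold dd
  exact (tendsto_rpow_neg_atTop (by norm_num : (0:ℝ) < 1/4)).comp (tendsto_atTop_add_const_left _ _ tendsto_id)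

theorem maj {w : ℂ} (hw : 0 ≤ w.re) {t : ℝ} (ht : 0 ≤ t) :
    (1 + ‖w + t‖) ^ (-(3/2) : ℝ) ≤ dd w.re * jj t := by
  have h1 : w.re + t ≤ ‖w + t‖ := by
    have := Complex.re_le_norm (w + t); simpa using this
  unfold dd jj
  have e : (1 + ‖w + t‖) ^ (-(3/2) : ℝ) = (1 + ‖w + t‖) ^ (-(1/4) : ℝ) * (1 + ‖w + t‖) ^ (-(5/4) : ℝ) := by
    rw [← Real.rpow_add (by positivity)]; norm_num
  rw [e]
  apply mul_le_mul
  · exact Real.rpow_le_rpow_of_nonpos (by positivity) (by linarith) (by norm_num)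
  · exact Real.rpow_le_rpow_of_nonpos (by positivity) (by linarith) (by norm_num)
  · positivity
  · positivity

theorem maj2 {w : ℂ} (hw : 0 ≤ w.re) {t : ℝ} (ht : 0 ≤ t) :
    1 / (1 + ‖w + t‖) ^ 2 ≤ dd w.re * jj t := by
  refine le_trans ?_ (maj hw ht)
  have h1 : 1 ≤ 1 + ‖w + t‖ := by have := norm_nonneg (w + t); linarith
  have : 1 / (1 + ‖w + t‖) ^ 2 = (1 + ‖w + t‖) ^ (-2 : ℝ) := by
    rw [Real.rpow_neg (by positivity), one_div]; norm_cast
  rw [this]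
  exact Real.rpow_le_rpow_of_exponent_le h1 (by norm_num)

/-! ### region -/

def Vr (m : ℕ) : Set ℂ := {w | |w.im| < Real.tan (th m) * (w.re + 1)}

theorem tan_pos (m : ℕ) (hm : 3 ≤ m) : 0 < Real.tan (th m) := by
  have := th_le m hm
  have := Real.pi_pos
  exact Real.tan_pos_of_pos_of_lt_pi_div_two (th_pos m) (by linarith)

theorem Vr_open (m : ℕ) : IsOpen (Vr m) := by
  apply isOpen_lt <;> fun_prop

theorem Vr_star {m : ℕ} (hm : 3 ≤ m) : ∀ w ∈ Vr m, ∀ s ∈ Icc (0:ℝ) 1, (s:ℂ) * w ∈ Vr m := by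
  intro w hw s hs
  have h := tan_pos m hm
  simp only [Vr, mem_ofPred_eq, Complex.re_ofReal_mul, Complex.im_ofReal_mul, abs_mul, abs_of_nonneg hs.1] at hw ⊢
  rcases eq_or_lt_of_le hs.1 with e | e
  · rw [← e]; simpa using h
  · have := mul_lt_mul_of_pos_left hw e
    nlinarith [hs.2]

theorem Vr_add {m : ℕ} (hm : 3 ≤ m) {w : ℂ} (hw : w ∈ Vr m) {t : ℝ} (ht : 0 ≤ t) : w + t ∈ Vr m := by
  have h := tan_pos m hm
  simp only [Vr, mem_ofPred_eq, Complex.add_im, Complex.add_re, Complex.ofReal_re, Complex.ofReal_im, add_zero] at hw ⊢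
  nlinarith

theorem Vr_real {m : ℕ} (hm : 3 ≤ m) {x : ℝ} (hx : 0 ≤ x) : (x:ℂ) ∈ Vr m := by
  have h := tan_pos m hm
  simp only [Vr, mem_ofPred_eq, Complex.ofReal_re, Complex.ofReal_im, abs_zero]
  positivity

structure Bas (m : ℕ) (p : Polynomial ℂ) (A c0 : ℝ) (l0 : ℂ) : Prop where
  pb : PB m p A
  c0p : 0 < c0
  c01 : c0 ≤ 1
  g0 : ∀ w ∈ Vr m, Good m p c0 1 l0 w

noncomputable def xi (p : Polynomial ℂ) (l0 w : ℂ) : ℂ := ∫ s in Ioc (0:ℝ) 1, w * RR p l0 ((s:ℂ) * w)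

theorem xi_zero (p : Polynomial ℂ) (l0 : ℂ) : xi p l0 0 = 0 := by simp [xi]

noncomputable def dR (p : Polynomial ℂ) (l0 lam w : ℂ) : ℂ := RR p lam w - RR p l0 w

noncomputable def Tl (p : Polynomial ℂ) (l0 lam w : ℂ) : ℂ := ∫ t in Ioi (0:ℝ), dR p l0 lam (w + t)

noncomputable def Xi (p : Polynomial ℂ) (l0 lam w : ℂ) : ℂ := xi p l0 w - Tl p l0 lam w

noncomputable def Hh (p : Polynomial ℂ) (l0 lam w : ℂ) : ℂ :=
  VH (fun t => Xi p l0 lam (w + t)) (fun t => gg p lam (w + t)) 0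
noncomputable def Bb (p : Polynomial ℂ) (l0 lam w : ℂ) : ℂ :=
  VB (fun t => Xi p l0 lam (w + t)) (fun t => gg p lam (w + t)) 0
noncomputable def yy (p : Polynomial ℂ) (l0 lam w : ℂ) : ℂ :=
  Complex.exp (-Xi p l0 lam w) * (Hh p l0 lam w / SS p lam w)
noncomputable def y1 (p : Polynomial ℂ) (l0 lam w : ℂ) : ℂ :=
  Complex.exp (-Xi p l0 lam w) * (-(p.derivative.eval w) / (4 * SS p lam w ^ 5) * Hh p l0 lam w
    - SS p lam w * Hh p l0 lam w + SS p lam w * Bb p l0 lam w)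

theorem Bas.xi_deriv {m p A c0 l0} (h : Bas m p A c0 l0) {w : ℂ} (hw : w ∈ Vr m) :
    HasDerivAt (xi p l0) (RR p l0 w) w :=
  star_prim (Vr_open m) (Vr_star h.pb.hm) (fun u hu =>
    (RR_deriv ((h.g0 u hu).slit h.c0p zero_le_one)).differentiableAt.differentiableWithinAt) w hw

/-- bound of `dR` -/
theorem Bas.dR_le {m p A c0 l0} (h : Bas m p A c0 l0) {w lam : ℂ} (hw : w ∈ Vr m) (hw0 : 0 ≤ w.re)
    {t : ℝ} (ht : 0 ≤ t) :
    ‖dR p l0 lam (w + t)‖ ≤ ‖lam - l0‖ / Real.sqrt (c0 / 2) * dd w.re * jj t := by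
  have hg := h.g0 _ (Vr_add h.pb.hm hw ht)
  have h1 := hg.re_sq
  set X := 1 + ‖w + t‖ with hX
  have hX1 : 1 ≤ X := by have := norm_nonneg (w + t); linarith
  have hc := h.c0p
  have hq : 0 < Real.sqrt (c0 / 2) := Real.sqrt_pos.2 (by positivity)
  have h2 : Real.sqrt (c0 / 2) * X ^ (3/2 : ℝ) ≤ (RR p l0 (w + t)).re := by
    apply abs_le_of_sq_le_sq' _ (RR_re_nonneg _ _ _) |>.2
    rw [mul_pow, Real.sq_sqrt (by positivity), ← Real.rpow_mul_natCast (by positivity)]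
    refine le_trans ?_ h1
    norm_num
    have : X ^ 3 ≤ X ^ m := pow_le_pow_right₀ hX1 h.pb.hm
    have e : X ^ (3:ℝ) = X ^ 3 := by norm_cast
    try rw [e]
    nlinarith
  have h3 : 0 < Real.sqrt (c0 / 2) * X ^ (3/2 : ℝ) := by positivity
  have h4 := RR_sub_le p (l1 := lam) (l0 := l0) (w := w + t) (by linarith)
  refine h4.trans ?_
  have h5 := maj hw0 ht
  rw [Real.rpow_neg (by positivity)] at h5
  calc ‖lam - l0‖ / (RR p l0 (w + t)).re ≤ ‖lam - l0‖ / (Real.sqrt (c0 / 2) * X ^ (3/2 : ℝ)) := by gcongr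
    _ = ‖lam - l0‖ / Real.sqrt (c0 / 2) * (X ^ (3/2 : ℝ))⁻¹ := by rw [← div_div, div_eq_mul_inv (_ / _)]
    _ ≤ ‖lam - l0‖ / Real.sqrt (c0 / 2) * (dd w.re * jj t) := by gcongr
    _ = _ := by ring

structure Ln (m : ℕ) (p : Polynomial ℂ) (c κ : ℝ) (lam w : ℂ) : Prop where
  w0 : 0 ≤ w.re
  wV : w ∈ Vr m
  cp : 0 < c
  good : ∀ t : ℝ, 0 ≤ t → Good m p c 1 lam (w + t)
  gb : ∀ t : ℝ, 0 ≤ t → ‖gg p lam (w + t)‖ ≤ κ * jj t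
  κ1 : κ ≤ 1/8

section
variable {m : ℕ} {p : Polynomial ℂ} {A c0 c κ : ℝ} {l0 lam w : ℂ}

theorem Ln.shift (hm : 3 ≤ m) (h : Ln m p c κ lam w) {τ : ℝ} (hτ : 0 ≤ τ) : Ln m p c κ lam (w + τ) := by
  refine ⟨?_, Vr_add hm h.wV hτ, h.cp, ?_, ?_, h.κ1⟩
  · have := h.w0; simp; linarith
  · intro t ht
    have := h.good (τ + t) (by linarith)
    push_cast at this; rwa [← add_assoc] at this
  · intro t ht
    have h1 := h.gb (τ + t) (by linarith)
    push_cast at h1; rw [← add_assoc] at h1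
    refine h1.trans ?_
    have hκ : 0 ≤ κ := by
      have h2 := (norm_nonneg _).trans (h.gb 0 le_rfl)
      have := jj_pos (le_refl 0)
      by_contra hn
      push Not at hn
      nlinarith
    exact mul_le_mul_of_nonneg_left (jj_anti ht hτ) hκ

theorem Ln.slit (h : Ln m p c κ lam w) {t : ℝ} (ht : 0 ≤ t) : p.eval (w + t) + lam ∈ slitPlane :=
  (h.good t ht).slit h.cp zero_le_one

theorem Ln.slit0 (h : Ln m p c κ lam w) : p.eval w + lam ∈ slitPlane := by
  have := h.slit le_rfl; simpa using this

theorem line_deriv {f : ℂ → ℂ} {f' w : ℂ} {t : ℝ} (h : HasDerivAt f f' (w + t)) :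
    HasDerivAt (fun t : ℝ => f (w + t)) f' t := by
  have h2 : HasDerivAt (fun s : ℝ => w + (s:ℂ)) 1 t := by
    simpa using (Complex.ofRealCLM.hasDerivAt (x := t)).const_add w
  exact (HasDerivAt.comp t h h2).congr_deriv (mul_one _)

theorem dR_contOn (hB : Bas m p A c0 l0) (h : Ln m p c κ lam w) :
    ContinuousOn (fun t : ℝ => dR p l0 lam (w + t)) (Ici 0) := by
  intro t ht
  have h1 := line_deriv (RR_deriv (h.slit ht))
  have h2 := line_deriv (RR_deriv ((hB.g0 _ (Vr_add hB.pb.hm h.wV ht)).slit hB.c0p zero_le_one))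
  exact (h1.continuousAt.sub h2.continuousAt).continuousWithinAt

theorem dR_intOn (hB : Bas m p A c0 l0) (h : Ln m p c κ lam w) :
    IntegrableOn (fun t : ℝ => dR p l0 lam (w + t)) (Ioi 0) := by
  refine Integrable.mono' (jj_int.1.const_mul (‖lam - l0‖ / Real.sqrt (c0 / 2) * dd w.re))
    (((dR_contOn hB h).mono Ioi_subset_Ici_self).aestronglyMeasurable measurableSet_Ioi) ?_
  exact (ae_restrict_iff' measurableSet_Ioi).2 (ae_of_all _ fun t ht => hB.dR_le h.wV h.w0 (le_of_lt ht))

theorem Tl_le (hB : Bas m p A c0 l0) (h : Ln m p c κ lam w) :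
    ‖Tl p l0 lam w‖ ≤ ‖lam - l0‖ / Real.sqrt (c0 / 2) * 4 * dd w.re := by
  have := norm_integral_le_of_norm_le (f := fun t : ℝ => dR p l0 lam (w + t)) (μ := volume.restrict (Ioi 0))
    (jj_int.1.const_mul (‖lam - l0‖ / Real.sqrt (c0 / 2) * dd w.re))
    ((ae_restrict_iff' measurableSet_Ioi).2 (ae_of_all _ fun t ht => hB.dR_le h.wV h.w0 (le_of_lt ht)))
  rw [integral_const_mul, jj_int.2] at this
  refine this.trans (le_of_eq (by ring))

theorem Xi_deriv (hB : Bas m p A c0 l0) (h : Ln m p c κ lam w) : ∀ t ∈ Ici (0:ℝ),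
    HasDerivWithinAt (fun t : ℝ => Xi p l0 lam (w + t)) (RR p lam (w + t)) (Ici 0) t := by
  intro t ht
  have h1 := (line_deriv (hB.xi_deriv (Vr_add hB.pb.hm h.wV ht))).hasDerivWithinAt (s := Ici 0)
  have h2 := tail_hasDeriv (dR_contOn hB h) (dR_intOn hB h) t ht
  have e : ∀ t : ℝ, Tl p l0 lam (w + t) = ∫ s in Ioi t, dR p l0 lam (w + s) := by
    intro t
    have := integral_Ioi_shift (fun s => dR p l0 lam (w + s)) 0 t
    rw [add_zero] at this
    rw [← this, Tl]
    congr 1; ext s; push_cast; rw [add_assoc]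
  have h3 := h1.sub h2
  have e2 : (fun t : ℝ => Xi p l0 lam (w + t)) = fun t : ℝ => xi p l0 (w + t) - ∫ s in Ioi t, dR p l0 lam (w + s) := by
    ext t; rw [Xi, e]
  rw [e2]
  refine h3.congr_deriv ?_
  simp [dR]

theorem Ln.vol (hB : Bas m p A c0 l0) (h : Ln m p c κ lam w) :
    Vol (fun t => Xi p l0 lam (w + t)) (fun t => gg p lam (w + t)) (fun t => κ * jj t) := by
  have hX := Xi_deriv hB h
  refine ⟨fun t ht => (hX t ht).continuousWithinAt, fun t ht =>
    (line_deriv (gg_diff (h.slit ht)).hasDerivAt).continuousAt.continuousWithinAt, ?_, h.gb,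
    jj_int.1.const_mul _, ?_⟩
  · have : MonotoneOn (fun t : ℝ => (Xi p l0 lam (w + t)).re) (Ici 0) := by
      have hd : ∀ t ∈ Ici (0:ℝ), HasDerivWithinAt (fun t : ℝ => (Xi p l0 lam (w + t)).re)
          (RR p lam (w + t)).re (Ici 0) t := fun t ht =>
        (Complex.reCLM.hasFDerivAt.comp_hasDerivWithinAt t (hX t ht))
      refine monotoneOn_of_hasDerivWithinAt_nonneg (f' := fun t => (RR p lam (w + t)).re)
        (convex_Ici 0) (fun t ht => (hd t ht).continuousWithinAt) ?_ fun t _ => RR_re_nonneg _ _ _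
      intro t ht
      exact (hd t (interior_subset ht)).mono interior_subset
    intro t s ht hts
    exact this ht (le_trans ht hts) hts
  · rw [integral_const_mul, jj_int.2]; linarith [h.κ1]

theorem Hh_eq (t : ℝ) : Hh p l0 lam (w + t) = VH (fun t => Xi p l0 lam (w + t)) (fun t => gg p lam (w + t)) t := by
  have := VH_shift (fun t => Xi p l0 lam (w + t)) (fun t => gg p lam (w + t)) t 0
  rw [add_zero] at this
  rw [← this, Hh]
  congr 1 <;> (ext s; push_cast; rw [add_assoc])

theorem Bb_eq (t : ℝ) : Bb p l0 lam (w + t) = VB (fun t => Xi p l0 lam (w + t)) (fun t => gg p lam (w + t)) t := by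
  have := VB_shift (fun t => Xi p l0 lam (w + t)) (fun t => gg p lam (w + t)) t 0
  rw [add_zero] at this
  rw [← this, Bb]
  congr 1 <;> (ext s; push_cast; rw [add_assoc])

theorem Ln.H_le (hB : Bas m p A c0 l0) (h : Ln m p c κ lam w) : ‖Hh p l0 lam w - 1‖ ≤ 8 * κ := by
  have := (h.vol hB).VH_sub_one le_rfl
  rw [integral_const_mul, jj_int.2] at this
  unfold Hh; linarith

theorem Ln.B_le (hB : Bas m p A c0 l0) (h : Ln m p c κ lam w) : ‖Bb p l0 lam w‖ ≤ 8 * κ := by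
  have := (h.vol hB).VB_le le_rfl
  rw [integral_const_mul, jj_int.2] at this
  unfold Bb; linarith

theorem yy_line (hB : Bas m p A c0 l0) (h : Ln m p c κ lam w) {t : ℝ} (ht : 0 ≤ t) :
    HasDerivWithinAt (fun t : ℝ => yy p l0 lam (w + t)) (y1 p l0 lam (w + t)) (Ici 0) t ∧
    HasDerivWithinAt (fun t : ℝ => y1 p l0 lam (w + t)) ((p.eval (w + t) + lam) * yy p l0 lam (w + t)) (Ici 0) t := by
  have hv := h.vol hB
  have hX := Xi_deriv hB h
  have hs := h.slit ht
  have hS := (line_deriv (SS_deriv hs)).hasDerivWithinAt (s := Ici 0)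
  have hS0 := SS_ne hs
  have hH : HasDerivWithinAt (fun t : ℝ => Hh p l0 lam (w + t)) (RR p lam (w + t) * Bb p l0 lam (w + t)) (Ici 0) t := by
    have := hv.VH_deriv hX ht
    simp only [Hh_eq, Bb_eq]; exact this
  have hBd : HasDerivWithinAt (fun t : ℝ => Bb p l0 lam (w + t))
      (2 * RR p lam (w + t) * Bb p l0 lam (w + t) - gg p lam (w + t) * Hh p l0 lam (w + t)) (Ici 0) t := by
    have := hv.VB_deriv hX ht
    simp only [Hh_eq, Bb_eq]; exact this
  have hE := ((hX t ht).neg).cexp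
  have hp := (line_deriv (p.derivative.hasDerivAt (w + t))).hasDerivWithinAt (s := Ici 0)
  have h4 := SS_pow4 p lam (w + t)
  constructor
  · refine (hE.mul (hH.div hS hS0)).congr_deriv ?_
    simp only [y1, RR, Pi.neg_apply, Pi.div_apply]
    field_simp
    ring
  · refine (hE.mul (((hp.neg.div ((hS.pow 5).const_mul 4) (mul_ne_zero (by norm_num) (pow_ne_zero _ hS0))).mul hH
      |>.sub (hS.mul hH)).add (hS.mul hBd))).congr_deriv ?_
    simp only [yy, RR, gg, Pi.neg_apply, Pi.div_apply, Pi.mul_apply, Pi.sub_apply, Pi.add_apply, Pi.pow_apply]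
    rw [← h4]
    field_simp
    push_cast
    ring

end

end Sib


namespace Sib

section
variable {m : ℕ} {p : Polynomial ℂ} {A c0 c κ Λ : ℝ} {l0 : ℂ}

theorem SS_comp {l w : ℂ → ℂ} {u : ℂ} (hl : DifferentiableAt ℂ l u) (hw : DifferentiableAt ℂ w u)
    (h : p.eval (w u) + l u ∈ slitPlane) : DifferentiableAt ℂ (fun u => SS p (l u) (w u)) u := by
  unfold SS
  have h1 : DifferentiableAt ℂ (fun u => p.eval (w u) + l u) u :=
    (DifferentiableAt.comp u (f := w) (g := fun z => p.eval z) p.differentiableAt hw).add hl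
  exact (h1.hasDerivAt.cpow_const (c := (1/4 : ℂ)) h).differentiableAt

theorem RR_comp {l w : ℂ → ℂ} {u : ℂ} (hl : DifferentiableAt ℂ l u) (hw : DifferentiableAt ℂ w u)
    (h : p.eval (w u) + l u ∈ slitPlane) : DifferentiableAt ℂ (fun u => RR p (l u) (w u)) u :=
  (SS_comp hl hw h).pow 2

theorem ev_comp (q : Polynomial ℂ) {w : ℂ → ℂ} {u : ℂ} (hw : DifferentiableAt ℂ w u) :
    DifferentiableAt ℂ (fun u => q.eval (w u)) u :=
  DifferentiableAt.comp u (f := w) (g := fun z => q.eval z) q.differentiableAt hw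

theorem gg_comp {l w : ℂ → ℂ} {u : ℂ} (hl : DifferentiableAt ℂ l u) (hw : DifferentiableAt ℂ w u)
    (h : p.eval (w u) + l u ∈ slitPlane) : DifferentiableAt ℂ (fun u => gg p (l u) (w u)) u := by
  have h1 := SS_comp hl hw h
  have h4 := SS_ne h
  unfold gg
  exact DifferentiableAt.sub (DifferentiableAt.div (((ev_comp _ hw).pow 2).const_mul _) (h1.pow _) (pow_ne_zero _ h4))
    (DifferentiableAt.div ((ev_comp _ hw).const_mul _) (h1.pow _) (pow_ne_zero _ h4))

theorem Xi_diff (hB : Bas m p A c0 l0) {U : Set ℂ} (hU : IsOpen U) {l w : ℂ → ℂ}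
    (hl : DifferentiableOn ℂ l U) (hw : DifferentiableOn ℂ w U) (hΛ : ∀ u ∈ U, ‖l u‖ ≤ Λ)
    (h : ∀ u ∈ U, Ln m p c κ (l u) (w u)) :
    DifferentiableOn ℂ (fun u => Xi p l0 (l u) (w u)) U := by
  have h1 : DifferentiableOn ℂ (fun u => xi p l0 (w u)) U := by
    intro u hu
    exact (DifferentiableAt.comp u (f := w) (hB.xi_deriv (h u hu).wV).differentiableAt
      (hw.differentiableAt (hU.mem_nhds hu))).differentiableWithinAt
  refine h1.sub ?_
  refine paramInt_diff hU (b := fun t => (Λ + ‖l0‖) / Real.sqrt (c0 / 2) * jj t) ?_ ?_ ?_ ?_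
  · intro u hu
    exact (dR_intOn hB (h u hu)).aestronglyMeasurable
  · refine (ae_restrict_iff' measurableSet_Ioi).2 (ae_of_all _ fun t ht u hu => ?_)
    have ht0 : (0:ℝ) ≤ t := le_of_lt ht
    have hl' := hl.differentiableAt (hU.mem_nhds hu)
    have hw' := (hw.differentiableAt (hU.mem_nhds hu)).add_const (t:ℂ)
    refine DifferentiableAt.differentiableWithinAt ?_
    exact (RR_comp hl' hw' ((h u hu).slit ht0)).sub (RR_comp (differentiableAt_const l0) hw'
      ((hB.g0 _ (Vr_add hB.pb.hm (h u hu).wV ht0)).slit hB.c0p zero_le_one))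
  · refine (ae_restrict_iff' measurableSet_Ioi).2 (ae_of_all _ fun t ht u hu => ?_)
    have ht0 : (0:ℝ) ≤ t := le_of_lt ht
    refine (hB.dR_le (h u hu).wV (h u hu).w0 ht0).trans ?_
    have h2 : ‖l u - l0‖ ≤ Λ + ‖l0‖ := (norm_sub_le _ _).trans (by linarith [hΛ u hu])
    have hj := jj_pos ht0
    have hd := dd_le_one (h u hu).w0
    have hd0 := dd_pos (h u hu).w0
    have : 0 ≤ Λ + ‖l0‖ := (norm_nonneg _).trans h2
    calc _ ≤ (Λ + ‖l0‖) / Real.sqrt (c0 / 2) * 1 * jj t := by gcongr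
      _ = _ := by ring
  · exact jj_int.1.const_mul _

theorem HB_diff (hB : Bas m p A c0 l0) {U : Set ℂ} (hU : IsOpen U) {l w : ℂ → ℂ}
    (hl : DifferentiableOn ℂ l U) (hw : DifferentiableOn ℂ w U) (hΛ : ∀ u ∈ U, ‖l u‖ ≤ Λ)
    (h : ∀ u ∈ U, Ln m p c κ (l u) (w u)) :
    DifferentiableOn ℂ (fun u => Hh p l0 (l u) (w u)) U ∧ DifferentiableOn ℂ (fun u => Bb p l0 (l u) (w u)) U := by
  have hE : ∀ t : ℝ, 0 ≤ t → DifferentiableOn ℂ (fun u => Xi p l0 (l u) (w u + t)) U := fun t ht =>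
    Xi_diff hB hU hl (hw.add_const (t:ℂ)) hΛ fun u hu => (h u hu).shift hB.pb.hm ht
  have hg : ∀ t : ℝ, 0 ≤ t → DifferentiableOn ℂ (fun u => gg p (l u) (w u + t)) U := by
    intro t ht u hu
    have hl' := hl.differentiableAt (hU.mem_nhds hu)
    have hw' := (hw.differentiableAt (hU.mem_nhds hu)).add_const (t:ℂ)
    exact (gg_comp hl' hw' ((h u hu).slit ht)).differentiableWithinAt
  have hv : ∀ u ∈ U, Vol (fun t => Xi p l0 (l u) (w u + t)) (fun t => gg p (l u) (w u + t)) (fun t => κ * jj t) :=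
    fun u hu => (h u hu).vol hB
  exact ⟨VH_diff (E := fun u (t:ℝ) => Xi p l0 (l u) (w u + t)) (g := fun u (t:ℝ) => gg p (l u) (w u + t)) hU hv hE hg 0 le_rfl,
    VB_diff (E := fun u (t:ℝ) => Xi p l0 (l u) (w u + t)) (g := fun u (t:ℝ) => gg p (l u) (w u + t)) hU hv hE hg 0 le_rfl⟩

theorem y_diff (hB : Bas m p A c0 l0) {U : Set ℂ} (hU : IsOpen U) {l w : ℂ → ℂ}
    (hl : DifferentiableOn ℂ l U) (hw : DifferentiableOn ℂ w U) (hΛ : ∀ u ∈ U, ‖l u‖ ≤ Λ)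
    (h : ∀ u ∈ U, Ln m p c κ (l u) (w u)) :
    DifferentiableOn ℂ (fun u => yy p l0 (l u) (w u)) U ∧ DifferentiableOn ℂ (fun u => y1 p l0 (l u) (w u)) U := by
  have hX := Xi_diff hB hU hl hw hΛ h
  obtain ⟨hH, hBb⟩ := HB_diff hB hU hl hw hΛ h
  have hS : DifferentiableOn ℂ (fun u => SS p (l u) (w u)) U := fun u hu =>
    (SS_comp (hl.differentiableAt (hU.mem_nhds hu)) (hw.differentiableAt (hU.mem_nhds hu)) (h u hu).slit0).differentiableWithinAt
  have hp : DifferentiableOn ℂ (fun u => p.derivative.eval (w u)) U := fun u hu =>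
    (ev_comp _ (hw.differentiableAt (hU.mem_nhds hu))).differentiableWithinAt
  have hS0 : ∀ u ∈ U, SS p (l u) (w u) ≠ 0 := fun u hu => SS_ne (h u hu).slit0
  constructor
  · exact (hX.neg.cexp).mul (hH.div hS hS0)
  · exact (hX.neg.cexp).mul (((hp.neg.div ((hS.pow 5).const_mul 4)
      fun u hu => mul_ne_zero (by norm_num) (pow_ne_zero _ (hS0 u hu))).mul hH |>.sub (hS.mul hH)).add (hS.mul hBb))

theorem deriv_of_line {f : ℂ → ℂ} {f' w : ℂ} (hf : DifferentiableAt ℂ f w)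
    (h : HasDerivWithinAt (fun t : ℝ => f (w + t)) f' (Ici 0) 0) : HasDerivAt f f' w := by
  have h1 : HasDerivAt f (deriv f w) (w + ((0:ℝ):ℂ)) := by simpa using hf.hasDerivAt
  have h2 := (line_deriv h1).hasDerivWithinAt (s := Ici 0)
  have := (uniqueDiffOn_Ici (0:ℝ) 0 self_mem_Ici).eq_deriv _ h2 h
  rw [← this]; exact hf.hasDerivAt

theorem y_ode (hB : Bas m p A c0 l0) {U : Set ℂ} (hU : IsOpen U) {lam : ℂ}
    (h : ∀ u ∈ U, Ln m p c κ lam u) : ∀ w ∈ U, HasDerivAt (yy p l0 lam) (y1 p l0 lam w) w ∧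
      HasDerivAt (y1 p l0 lam) ((p.eval w + lam) * yy p l0 lam w) w := by
  intro w hw
  obtain ⟨h1, h2⟩ := y_diff hB hU (l := fun _ => lam) (w := fun u => u) (Λ := ‖lam‖) (differentiableOn_const _)
    differentiableOn_id (fun _ _ => le_rfl) h
  obtain ⟨h3, h4⟩ := yy_line hB (h w hw) le_rfl
  exact ⟨deriv_of_line (h1.differentiableAt (hU.mem_nhds hw)) (by simpa using h3),
    deriv_of_line (h2.differentiableAt (hU.mem_nhds hw)) (by simpa using h4)⟩

end

/-! ### Good regions -/

section
variable {m : ℕ} {p : Polynomial ℂ} {A c c0 : ℝ} {l0 lam w : ℂ}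

theorem Good.mono {M M' : ℝ} (hc : 0 ≤ c) (hM : M' ≤ M) (h : Good m p c M lam w) : Good m p c M' lam w := by
  unfold Good at *
  refine le_trans ?_ h
  gcongr

/-- from `Good` along the line to `Ln` -/
theorem Ln.of_good (hP : PB m p A) (hw0 : 0 ≤ w.re) (hwV : w ∈ Vr m) (hc : 0 < c) (hc1 : c ≤ 1)
    {M : ℝ} (hM : 1 ≤ M) (hg : ∀ t : ℝ, 0 ≤ t → Good m p c M lam (w + t))
    (hs : (3 * A ^ 2 / c ^ 2) / Real.sqrt (c * M / 2) * dd w.re ≤ 1/8) :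
    Ln m p c ((3 * A ^ 2 / c ^ 2) / Real.sqrt (c * M / 2) * dd w.re) lam w := by
  refine ⟨hw0, hwV, hc, fun t ht => (hg t ht).mono hc.le hM, fun t ht => ?_, hs⟩
  refine ((hg t ht).gg_le hP hc hc1 (by linarith)).trans ?_
  rw [div_eq_mul_one_div _ ((1 + ‖w + t‖) ^ 2), mul_assoc _ (dd _)]
  have := maj2 hw0 ht
  gcongr

theorem Vr_wedge (hm : 3 ≤ m) (hw : w ∈ Vr m) : cw m * ‖(w + 1) ^ m‖ ≤ ‖(w + 1) ^ m‖ + ((w + 1) ^ m).re := by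
  apply wedge_pow hm
  apply (wedge_arg hm _).le
  have := hw
  simp only [Vr, mem_ofPred_eq] at this
  simpa using this

theorem exists_bas (hP : PB m p A) : ∃ c0 l, Bas m p A c0 ((l:ℝ):ℂ) ∧ 0 < l := by
  have hm := hP.hm
  have h1 := cw_pos m hm
  have h2 := cw_le m hm
  obtain ⟨K, hK1, hK⟩ := good_master hP (c := cw m / 4) (by positivity) (by linarith)
  refine ⟨cw m / 4 / 2 ^ (m + 1), K, ⟨hP, by positivity, ?_, ?_⟩, by linarith⟩
  · apply div_le_one_of_le₀ _ (by positivity)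
    have : (1:ℝ) ≤ 2 ^ (m+1) := one_le_pow₀ (by norm_num)
    linarith
  · intro w hw
    refine (hK K w K (by linarith) ?_ (Or.inl le_rfl)).mono (by positivity) hK1
    have := cone_add h2 (by linarith : 0 ≤ K) (Vr_wedge hm hw) h1.le
    rwa [norm_pow] at this

/-- region far to the right -/
def Om (m : ℕ) (T : ℝ) : Set ℂ := {w | |w.im| < Real.tan (th m) * (w.re - T)}

theorem Om_open (m : ℕ) (T : ℝ) : IsOpen (Om m T) := by
  apply isOpen_lt <;> fun_prop

theorem Om_re (hm : 3 ≤ m) {T : ℝ} (hw : w ∈ Om m T) : T < w.re := by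
  have h := tan_pos m hm
  simp only [Om, mem_ofPred_eq] at hw
  by_contra hn
  push Not at hn
  nlinarith [abs_nonneg w.im]

theorem Om_Vr (hm : 3 ≤ m) {T : ℝ} (hT : 0 ≤ T) (hw : w ∈ Om m T) : w ∈ Vr m := by
  have h := tan_pos m hm
  simp only [Om, Vr, mem_ofPred_eq] at hw ⊢
  nlinarith

theorem Om_add (hm : 3 ≤ m) {T : ℝ} (hw : w ∈ Om m T) {t : ℝ} (ht : 0 ≤ t) : w + t ∈ Om m T := by
  have h := tan_pos m hm
  simp only [Om, mem_ofPred_eq, Complex.add_im, Complex.add_re, Complex.ofReal_re, Complex.ofReal_im, add_zero] at hw ⊢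
  nlinarith

theorem Om_mono (hm : 3 ≤ m) {T T' : ℝ} (hT : T ≤ T') (hw : w ∈ Om m T') : w ∈ Om m T := by
  have h := tan_pos m hm
  simp only [Om, mem_ofPred_eq] at hw ⊢
  nlinarith

theorem Om_real (hm : 3 ≤ m) {T x : ℝ} (hx : T < x) : (x:ℂ) ∈ Om m T := by
  have h := tan_pos m hm
  simp only [Om, mem_ofPred_eq, Complex.ofReal_re, Complex.ofReal_im, abs_zero]
  apply mul_pos h; linarith

theorem Om_convex (hm : 3 ≤ m) (T : ℝ) : Convex ℝ (Om m T) := by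
  have h := tan_pos m hm
  have e : Om m T = {w : ℂ | w.im < Real.tan (th m) * (w.re - T)} ∩ {w : ℂ | -w.im < Real.tan (th m) * (w.re - T)} := by
    ext w; simp only [Om, mem_ofPred_eq, abs_lt, mem_inter_iff]; constructor
    · rintro ⟨h1, h2⟩; exact ⟨h2, by linarith⟩
    · rintro ⟨h1, h2⟩; exact ⟨by linarith, h1⟩
  rw [e]
  intro x hx y hy a b ha hb hab
  simp only [mem_inter_iff, mem_ofPred_eq, Complex.add_re, Complex.add_im, Complex.real_smul, Complex.re_ofReal_mul, Complex.im_ofReal_mul] at *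
  have : a = 1 - b := by linarith
  subst this
  obtain ⟨hx1, hx2⟩ := hx
  obtain ⟨hy1, hy2⟩ := hy
  rcases eq_or_lt_of_le hb with e | e
  · rw [← e]; constructor <;> nlinarith
  · constructor
    · nlinarith [mul_le_mul_of_nonneg_left hx1.le ha, mul_lt_mul_of_pos_left hy1 e]
    · nlinarith [mul_le_mul_of_nonneg_left hx2.le ha, mul_lt_mul_of_pos_left hy2 e]

/-- uniform constants for bounded lambda: on `Om m T`, with decaying smallness. -/
theorem far (hP : PB m p A) (Λ : ℝ) : ∃ T c C : ℝ, 0 ≤ T ∧ 0 < C ∧ 0 < c ∧ ∀ lam : ℂ, ‖lam‖ ≤ Λ → ∀ w ∈ Om m T,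
    Ln m p c (C * dd w.re) lam w := by
  have hm := hP.hm
  have h1 := cw_pos m hm
  have h2 := cw_le m hm
  obtain ⟨K, hK1, hK⟩ := good_master hP (c := cw m / 2) (by positivity) (by linarith)
  set c := cw m / 2 / 2 ^ (m + 1) with hcd
  have hc : 0 < c := by positivity
  have hc1 : c ≤ 1 := by
    apply div_le_one_of_le₀ _ (by positivity)
    have : (1:ℝ) ≤ 2 ^ (m+1) := one_le_pow₀ (by norm_num)
    linarith
  have hA := hP.A1
  set C := (3 * A ^ 2 / c ^ 2) / Real.sqrt (c * 1 / 2) with hC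
  have hC0 : 0 < C := by positivity
  have h3 : ∀ᶠ x in atTop, C * dd x ≤ 1/8 := by
    have := dd_tendsto.const_mul C
    rw [mul_zero] at this
    exact this.eventually_le_const (by norm_num)
  obtain ⟨T1, hT1⟩ := eventually_atTop.1 h3
  set T := max (max T1 K) (max 0 ((1 + 2 * |Λ|) * 2 / cw m)) with hT
  refine ⟨T, c, C, (le_max_left _ _).trans (le_max_right _ _), hC0, hc, fun lam hlam w hw => ?_⟩
  have hT0 : 0 ≤ T := (le_max_left _ _).trans (le_max_right _ _)
  have hre := Om_re hm hw
  have hΛ : (1 + 2 * |Λ|) * 2 / cw m ≤ T := (le_max_right _ _).trans (le_max_right _ _)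
  refine Ln.of_good hP (by linarith) (Om_Vr hm hT0 hw) hc hc1 le_rfl (fun t ht => ?_) ?_
  · have hv := Om_add hm hw ht
    set v := w + (t:ℂ)
    have hvr := Om_re hm hv
    have hvn := Complex.re_le_norm v
    apply hK lam v 1 zero_le_one
    · have h5 := Vr_wedge hm (Om_Vr hm hT0 hv)
      have h6 := nn_sub (μ := (v + 1) ^ m) (ν := (v + 1) ^ m + lam)
      rw [add_sub_cancel_left] at h6
      have h7 : (1 + 2 * |Λ|) * 2 / cw m ≤ ‖v + 1‖ ^ m := by
        have h8 : v.re + 1 ≤ ‖v + 1‖ := by have := Complex.re_le_norm (v + 1); simpa using this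
        have h9 : ‖v + 1‖ ≤ ‖v + 1‖ ^ m := le_self_pow₀ (by linarith) (by omega)
        linarith
      rw [div_le_iff₀ h1] at h7
      rw [norm_pow] at h5 h6
      have := le_abs_self Λ
      nlinarith
    · right
      have : K ≤ T := (le_max_right _ _).trans (le_max_left _ _)
      linarith
  · have : T1 ≤ T := (le_max_left _ _).trans (le_max_left _ _)
    exact hT1 _ (by linarith)

/-- the sector -/
def Sec (c Λ : ℝ) : Set ℂ := {l | Λ < ‖l‖ ∧ c * ‖l‖ < ‖l‖ + l.re}

theorem Sec_open (c Λ : ℝ) : IsOpen (Sec c Λ) := by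
  apply IsOpen.inter
  · exact isOpen_lt continuous_const continuous_norm
  · exact isOpen_lt (f := fun l : ℂ => c * ‖l‖) (g := fun l : ℂ => ‖l‖ + l.re) (by fun_prop) (by fun_prop)

/-- half line for lambda in a sector -/
theorem sec_ln (hP : PB m p A) (hc : 0 < c) (hc1 : c ≤ 1) : ∃ Λ C c' : ℝ, 1 ≤ Λ ∧ 0 < C ∧ 0 < c' ∧
    ∀ lam ∈ Sec c Λ, ∀ x : ℝ, 0 ≤ x → (∀ t : ℝ, 0 ≤ t → Good m p c' ‖lam‖ lam t) ∧
      Ln m p c' (C / Real.sqrt ‖lam‖ * dd x) lam x := by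
  have hm := hP.hm
  obtain ⟨K, hK1, hK⟩ := good_master hP (c := c / 4) (by positivity) (by linarith)
  set c' := c / 4 / 2 ^ (m + 1) with hcd
  have hc' : 0 < c' := by positivity
  have hc1' : c' ≤ 1 := by
    apply div_le_one_of_le₀ _ (by positivity)
    have : (1:ℝ) ≤ 2 ^ (m+1) := one_le_pow₀ (by norm_num)
    linarith
  have hA := hP.A1
  set C := (3 * A ^ 2 / c' ^ 2) / Real.sqrt (c' / 2) with hC
  have hC0 : 0 < C := by positivity
  refine ⟨max K ((8 * C) ^ 2), C, c', hK1.trans (le_max_left _ _), hC0, hc', ?_⟩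
  rintro lam ⟨hl1, hl2⟩ x hx
  have hlK : K ≤ ‖lam‖ := (le_max_left _ _).trans hl1.le
  have hg : ∀ t : ℝ, 0 ≤ t → Good m p c' ‖lam‖ lam t := by
    intro t ht
    apply hK lam t ‖lam‖ (norm_nonneg _) _ (Or.inl hlK)
    have h1 := cone_add hc1 (by positivity : 0 ≤ (t + 1) ^ m) hl2.le hc.le
    have h2 : ‖(t:ℂ) + 1‖ = t + 1 := by
      rw [← Complex.ofReal_one, ← Complex.ofReal_add, Complex.norm_real, Real.norm_of_nonneg (by linarith)]
    rw [h2, add_comm (((t:ℂ) + 1) ^ m), add_comm ((t + 1) ^ m)]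
    push_cast at h1
    exact h1
  refine ⟨hg, ?_⟩
  have e : C / Real.sqrt ‖lam‖ = (3 * A ^ 2 / c' ^ 2) / Real.sqrt (c' * ‖lam‖ / 2) := by
    rw [hC, div_div, ← Real.sqrt_mul (by positivity)]
    congr 2; ring
  rw [e]
  have hq : 8 * C ≤ Real.sqrt ‖lam‖ := by
    apply Real.le_sqrt_of_sq_le
    exact (le_max_right _ _).trans hl1.le
  have hq0 : 0 < Real.sqrt ‖lam‖ := by linarith
  refine Ln.of_good hP (by simpa using hx) (Vr_real hm hx) hc' hc1' (by linarith) (fun t ht => ?_) ?_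
  · have := hg (x + t) (by linarith)
    push_cast at this; exact this
  · rw [← e, Complex.ofReal_re]
    have h1 : C / Real.sqrt ‖lam‖ ≤ 1/8 := by
      rw [div_le_iff₀ hq0]; linarith
    have := dd_le_one hx
    have := dd_pos hx
    nlinarith

end

end Sib


namespace Sib

section
variable {m : ℕ} {p : Polynomial ℂ} {A c c0 κ : ℝ} {l0 lam w : ℂ}

theorem Ln.weaken {κ' : ℝ} (h : Ln m p c κ lam w) (h1 : κ ≤ κ') (h2 : κ' ≤ 1/8) : Ln m p c κ' lam w :=
  ⟨h.w0, h.wV, h.cp, h.good, fun t ht => (h.gb t ht).trans (mul_le_mul_of_nonneg_right h1 (jj_pos ht).le), h2⟩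

/-- Wronskian constancy on convex open sets -/
theorem wr_const {U : Set ℂ} (hU : IsOpen U) (hc : Convex ℝ U) {q Y Y1 Z Z1 : ℂ → ℂ}
    (hY : ∀ w ∈ U, HasDerivAt Y (Y1 w) w ∧ HasDerivAt Y1 (q w * Y w) w)
    (hZ : ∀ w ∈ U, HasDerivAt Z (Z1 w) w ∧ HasDerivAt Z1 (q w * Z w) w) {a b : ℂ} (ha : a ∈ U) (hb : b ∈ U) :
    Y a * Z1 a - Y1 a * Z a = Y b * Z1 b - Y1 b * Z b := by
  have hd : ∀ w ∈ U, HasDerivAt (fun w => Y w * Z1 w - Y1 w * Z w) 0 w := by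
    intro w hw
    refine (((hY w hw).1.mul (hZ w hw).2).sub ((hY w hw).2.mul (hZ w hw).1)).congr_deriv ?_
    ring
  exact hc.is_const_of_fderivWithin_eq_zero (𝕜 := ℂ) (f := fun w => Y w * Z1 w - Y1 w * Z w)
    (fun w hw => (hd w hw).differentiableAt.differentiableWithinAt) (fun w hw => by
      have := (hd w hw).hasFDerivAt.fderiv
      rw [fderivWithin_of_isOpen hU hw, this]; simp) ha hb

theorem wr_line {q Y Y1 Z Z1 : ℝ → ℂ}
    (hY : ∀ t : ℝ, 0 ≤ t → HasDerivWithinAt Y (Y1 t) (Ici 0) t ∧ HasDerivWithinAt Y1 (q t * Y t) (Ici 0) t)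
    (hZ : ∀ t : ℝ, 0 ≤ t → HasDerivWithinAt Z (Z1 t) (Ici 0) t ∧ HasDerivWithinAt Z1 (q t * Z t) (Ici 0) t)
    {x : ℝ} (hx : 0 ≤ x) : Y x * Z1 x - Y1 x * Z x = Y 0 * Z1 0 - Y1 0 * Z 0 := by
  have hd : ∀ w : ℝ, 0 ≤ w → HasDerivWithinAt (fun w => Y w * Z1 w - Y1 w * Z w) 0 (Ici 0) w := by
    intro w hw
    refine (((hY w hw).1.mul (hZ w hw).2).sub ((hY w hw).2.mul (hZ w hw).1)).congr_deriv ?_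
    ring
  exact constant_of_has_deriv_right_zero (f := fun w => Y w * Z1 w - Y1 w * Z w) (a := 0) (b := x)
    (fun t ht => (hd t ht.1).continuousWithinAt.mono Icc_subset_Ici_self)
    (fun t ht => (hd t ht.1).mono (Ici_subset_Ici.2 ht.1)) x ⟨hx, le_rfl⟩

theorem phi_pair (p : Polynomial ℂ) (a b lam : ℂ) (w : ℂ) : HasDerivAt (phi p a b lam) (phid p a b lam w) w ∧
    HasDerivAt (phid p a b lam) ((p.eval w + lam) * phi p a b lam w) w :=
  ⟨phi_hasDeriv p a b lam w, phid_hasDeriv p a b lam w⟩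

/-- Wronskian of two initial value solutions. -/
theorem phi_wr (p : Polynomial ℂ) (a b a' b' lam z : ℂ) :
    phi p a b lam z * phid p a' b' lam z - phid p a b lam z * phi p a' b' lam z = a * b' - b * a' := by
  rw [wr_const isOpen_univ convex_univ (q := fun w => p.eval w + lam) (fun w _ => phi_pair p a b lam w)
    (fun w _ => phi_pair p a' b' lam w) (mem_univ z) (mem_univ 0)]
  simp [phi_zero, phid_zero]

/-- a pair of values agreeing in Wronskian with the basis is the combination -/
theorem pair_eq {Y Y1 a b z : ℂ} (h1 : Y * phid p 0 1 lam z - Y1 * phi p 0 1 lam z = a)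
    (h2 : Y * phid p 1 0 lam z - Y1 * phi p 1 0 lam z = -b) :
    phi p a b lam z = Y ∧ phid p a b lam z = Y1 := by
  have e := phi_wr p 1 0 0 1 lam z
  have e1 := phi_wr p a b 0 1 lam z
  have e2 := phi_wr p a b 1 0 lam z
  have e' : phi p 1 0 lam z * phid p 0 1 lam z - phid p 1 0 lam z * phi p 0 1 lam z = 1 := by rw [e]; ring
  have f1 : (phi p a b lam z - Y) * phid p 0 1 lam z = (phid p a b lam z - Y1) * phi p 0 1 lam z := by
    linear_combination e1 - h1
  have f2 : (phi p a b lam z - Y) * phid p 1 0 lam z = (phid p a b lam z - Y1) * phi p 1 0 lam z := by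
    linear_combination e2 - h2
  constructor
  · linear_combination (Y - phi p a b lam z) * e' + phi p 1 0 lam z * f1 - phi p 0 1 lam z * f2
  · linear_combination (Y1 - phid p a b lam z) * e' + phid p 1 0 lam z * f1 - phid p 0 1 lam z * f2

theorem exists_sub (hB : Bas m p A c0 l0) (lam : ℂ) : ∃ q : ℂ × ℂ, ∃ T : ℝ, ∀ w ∈ Om m T,
    phi p q.1 q.2 lam w = yy p l0 lam w ∧ phid p q.1 q.2 lam w = y1 p l0 lam w := by
  obtain ⟨T, c, C, hT, hC, hc, h⟩ := far hB.pb ‖lam‖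
  have hm := hB.pb.hm
  have hL : ∀ u ∈ Om m T, Ln m p c (1/8) lam u := fun u hu =>
    (h lam le_rfl u hu).weaken (h lam le_rfl u hu).κ1 le_rfl
  have ho := y_ode hB (Om_open m T) hL
  have hx : ((T + 1 : ℝ) : ℂ) ∈ Om m T := Om_real hm (by linarith)
  set x : ℂ := ((T + 1 : ℝ) : ℂ)
  refine ⟨(yy p l0 lam x * phid p 0 1 lam x - y1 p l0 lam x * phi p 0 1 lam x,
    -(yy p l0 lam x * phid p 1 0 lam x - y1 p l0 lam x * phi p 1 0 lam x)), T, fun w hw => ?_⟩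
  apply pair_eq
  · exact wr_const (Om_open m T) (Om_convex hm T) ho (fun w _ => phi_pair p 0 1 lam w) hw hx
  · rw [neg_neg]
    exact wr_const (Om_open m T) (Om_convex hm T) ho (fun w _ => phi_pair p 1 0 lam w) hw hx

noncomputable def FF (hB : Bas m p A c0 l0) (lam : ℂ) : ℂ := (exists_sub hB lam).choose.1
noncomputable def FD (hB : Bas m p A c0 l0) (lam : ℂ) : ℂ := (exists_sub hB lam).choose.2

theorem FF_spec (hB : Bas m p A c0 l0) (lam : ℂ) : ∃ T : ℝ, ∀ w ∈ Om m T,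
    phi p (FF hB lam) (FD hB lam) lam w = yy p l0 lam w ∧ phid p (FF hB lam) (FD hB lam) lam w = y1 p l0 lam w :=
  (exists_sub hB lam).choose_spec

theorem FF_unique (hB : Bas m p A c0 l0) {T : ℝ} (hT : ∀ w ∈ Om m T, Ln m p c κ lam w) {x : ℂ} (hx : x ∈ Om m T) :
    FF hB lam = yy p l0 lam x * phid p 0 1 lam x - y1 p l0 lam x * phi p 0 1 lam x ∧
    FD hB lam = -(yy p l0 lam x * phid p 1 0 lam x - y1 p l0 lam x * phi p 1 0 lam x) := by
  have hm := hB.pb.hm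
  obtain ⟨T', h'⟩ := FF_spec hB lam
  have ho := y_ode hB (Om_open m T) hT
  set z : ℂ := ((max T T' + 1 : ℝ) : ℂ) with hz
  have hz1 : z ∈ Om m T := Om_real hm (by linarith [le_max_left T T'])
  have hz2 : z ∈ Om m T' := Om_real hm (by linarith [le_max_right T T'])
  rw [wr_const (Om_open m T) (Om_convex hm T) ho (fun w _ => phi_pair p 1 0 lam w) hx hz1,
    wr_const (Om_open m T) (Om_convex hm T) ho (fun w _ => phi_pair p 0 1 lam w) hx hz1]
  rw [← (h' z hz2).1, ← (h' z hz2).2, phi_wr, phi_wr]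
  constructor <;> ring

theorem FF_line (hB : Bas m p A c0 l0) (hL : Ln m p c κ lam 0) :
    FF hB lam = yy p l0 lam 0 ∧ FD hB lam = y1 p l0 lam 0 := by
  have hm := hB.pb.hm
  obtain ⟨T', h'⟩ := FF_spec hB lam
  have hx0 : 0 ≤ max T' 0 + 1 := by linarith [le_max_right T' 0]
  have hz2 : (((max T' 0 + 1 : ℝ)) : ℂ) ∈ Om m T' := Om_real hm (by linarith [le_max_left T' 0])
  have hY : ∀ t : ℝ, 0 ≤ t → HasDerivWithinAt (fun t : ℝ => yy p l0 lam t) (y1 p l0 lam t) (Ici 0) t ∧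
      HasDerivWithinAt (fun t : ℝ => y1 p l0 lam t) ((p.eval (t:ℂ) + lam) * yy p l0 lam t) (Ici 0) t := by
    intro t ht
    have := yy_line hB hL ht
    simpa only [zero_add] using this
  have hZ : ∀ a b : ℂ, ∀ t : ℝ, 0 ≤ t → HasDerivWithinAt (fun t : ℝ => phi p a b lam t) (phid p a b lam t) (Ici 0) t ∧
      HasDerivWithinAt (fun t : ℝ => phid p a b lam t) ((p.eval (t:ℂ) + lam) * phi p a b lam t) (Ici 0) t := by
    intro a b t ht
    have h1 := line_deriv (w := 0) (t := t) (by rw [zero_add]; exact phi_hasDeriv p a b lam t)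
    have h2 := line_deriv (w := 0) (t := t) (by rw [zero_add]; exact phid_hasDeriv p a b lam t)
    simp only [zero_add] at h1 h2
    exact ⟨h1.hasDerivWithinAt, h2.hasDerivWithinAt⟩
  have e1 := wr_line (q := fun t : ℝ => p.eval (t:ℂ) + lam) hY (hZ 0 1) hx0
  have e2 := wr_line (q := fun t : ℝ => p.eval (t:ℂ) + lam) hY (hZ 1 0) hx0
  rw [← (h' _ hz2).1, ← (h' _ hz2).2, phi_wr] at e1 e2
  simp only [Complex.ofReal_zero, phi_zero, phid_zero] at e1 e2
  constructor
  · linear_combination e1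
  · linear_combination -e2

theorem FF_entire (hB : Bas m p A c0 l0) : Differentiable ℂ (FF hB) ∧ Differentiable ℂ (FD hB) := by
  have hm := hB.pb.hm
  have key : ∀ Λ : ℝ, DifferentiableOn ℂ (FF hB) (Metric.ball 0 Λ) ∧ DifferentiableOn ℂ (FD hB) (Metric.ball 0 Λ) := by
    intro Λ
    obtain ⟨T, c, C, hT, hC, hc, h⟩ := far hB.pb Λ
    have hb : ∀ lam ∈ Metric.ball (0:ℂ) Λ, ‖lam‖ ≤ Λ := fun lam hl => (mem_ball_zero_iff.1 hl).le
    have hL : ∀ lam ∈ Metric.ball (0:ℂ) Λ, ∀ u ∈ Om m T, Ln m p c (1/8) lam u := fun lam hl u hu =>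
      (h lam (hb lam hl) u hu).weaken (h lam (hb lam hl) u hu).κ1 le_rfl
    have hx : ((T + 1 : ℝ) : ℂ) ∈ Om m T := Om_real hm (by linarith)
    set x : ℂ := ((T + 1 : ℝ) : ℂ)
    obtain ⟨d1, d2⟩ := y_diff hB (U := Metric.ball 0 Λ) Metric.isOpen_ball (l := fun u => u) (w := fun _ => x)
      (c := c) (κ := 1/8) (Λ := Λ) differentiableOn_id (differentiableOn_const _) hb (fun u hu => hL u hu x hx)
    have dp : ∀ a b, DifferentiableOn ℂ (fun lam => phi p a b lam x) (Metric.ball 0 Λ) := fun a b =>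
      (phi_diff_lam p a b x).differentiableOn
    have dpd : ∀ a b, DifferentiableOn ℂ (fun lam => phid p a b lam x) (Metric.ball 0 Λ) := fun a b =>
      (phid_diff_lam p a b x).differentiableOn
    constructor
    · exact ((d1.mul (dpd 0 1)).sub (d2.mul (dp 0 1))).congr fun u hu => (FF_unique hB (hL u hu) hx).1
    · exact ((d1.mul (dpd 1 0)).sub (d2.mul (dp 1 0))).neg.congr fun u hu => (FF_unique hB (hL u hu) hx).2
  constructor <;> intro u
  · exact (key (‖u‖ + 1)).1.differentiableAt (Metric.isOpen_ball.mem_nhds (by simp))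
  · exact (key (‖u‖ + 1)).2.differentiableAt (Metric.isOpen_ball.mem_nhds (by simp))

end

end Sib


namespace Sib

section
variable {m : ℕ} {p : Polynomial ℂ} {A c c0 κ : ℝ} {l0 lam w : ℂ}

/-- `p'/S^6` decays. -/
theorem ps_le (hP : PB m p A) (hc : 0 < c) (hg : Good m p c 1 lam w) :
    ‖p.derivative.eval w / SS p lam w ^ 6‖ ≤ A / (Real.sqrt (c / 2)) ^ 3 / (1 + ‖w‖) := by
  have hsl := hg.slit hc zero_le_one
  set X := 1 + ‖w‖ with hX
  have hX1 : 1 ≤ X := by have := norm_nonneg w; linarith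
  have hX0 : 0 < X := by linarith
  set ρ := ‖RR p lam w‖ with hρ
  have hρ0 : 0 < ρ := norm_pos_iff.2 (RR_ne hsl)
  have hρ2 : c / 2 * (X ^ m + 1) ≤ ρ ^ 2 := by rw [hρ, RR_norm_sq]; exact hg.norm_ge
  have hS6 : ‖SS p lam w ^ 6‖ = ρ ^ 3 := by rw [norm_pow, hρ, ← SS_norm_sq]; ring
  have hm := hP.hm
  have hq : 0 < Real.sqrt (c / 2) := Real.sqrt_pos.2 (by positivity)
  have hXm1 : 1 ≤ X ^ m := one_le_pow₀ hX1
  have h1 : Real.sqrt (c / 2) ≤ ρ := by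
    apply Real.sqrt_le_iff.2
    refine ⟨hρ0.le, ?_⟩
    nlinarith
  have e1 : X ^ (m - 1) * X = X ^ m := by rw [← pow_succ]; congr 1; omega
  rw [norm_div, hS6, div_div, div_le_div_iff₀ (by positivity) (by positivity)]
  have h2 := hP.d1 w
  have h3 : Real.sqrt (c / 2) ^ 2 * X ^ m ≤ ρ ^ 2 := by
    rw [Real.sq_sqrt (by positivity)]; nlinarith
  have hA := hP.A1
  calc ‖p.derivative.eval w‖ * (Real.sqrt (c / 2) ^ 3 * X)
      ≤ (A * X ^ (m - 1)) * (Real.sqrt (c / 2) ^ 3 * X) := by gcongr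
    _ = A * (Real.sqrt (c / 2) * (Real.sqrt (c / 2) ^ 2 * X ^ m)) := by rw [← e1]; ring
    _ ≤ A * (ρ * ρ ^ 2) := by gcongr
    _ = _ := by ring

theorem path_asym (hB : Bas m p A c0 l0) (lam : ℂ) {φ : ℝ → ℂ} (hφ : ∀ T, ∀ᶠ r in atTop, φ r ∈ Om m T) :
    Tendsto (fun r => phi p (FF hB lam) (FD hB lam) lam (φ r) * SS p lam (φ r) * Complex.exp (xi p l0 (φ r)))
      atTop (nhds 1) ∧
    Tendsto (fun r => phid p (FF hB lam) (FD hB lam) lam (φ r) / SS p lam (φ r) * Complex.exp (xi p l0 (φ r)))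
      atTop (nhds (-1)) := by
  have hm := hB.pb.hm
  obtain ⟨T, c, C, hT, hC, hc, h⟩ := far hB.pb ‖lam‖
  obtain ⟨T', h'⟩ := FF_spec hB lam
  have hre : Tendsto (fun r => (φ r).re) atTop atTop :=
    tendsto_atTop.2 fun b => (hφ b).mono fun r hr => (Om_re hm hr).le
  have hdd : Tendsto (fun r => dd (φ r).re) atTop (nhds 0) := dd_tendsto.comp hre
  have hH : Tendsto (fun r => Hh p l0 lam (φ r)) atTop (nhds 1) := by
    rw [tendsto_iff_norm_sub_tendsto_zero]
    refine squeeze_zero' (Eventually.of_forall fun _ => norm_nonneg _) ?_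
      (by simpa using hdd.const_mul (8 * C))
    filter_upwards [hφ T] with r hr
    refine ((h lam le_rfl _ hr).H_le hB).trans (le_of_eq (by ring))
  have hBb : Tendsto (fun r => Bb p l0 lam (φ r)) atTop (nhds 0) := by
    rw [tendsto_zero_iff_norm_tendsto_zero]
    refine squeeze_zero' (Eventually.of_forall fun _ => norm_nonneg _) ?_
      (by simpa using hdd.const_mul (8 * C))
    filter_upwards [hφ T] with r hr
    refine ((h lam le_rfl _ hr).B_le hB).trans (le_of_eq (by ring))
  have hTl : Tendsto (fun r => Tl p l0 lam (φ r)) atTop (nhds 0) := by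
    rw [tendsto_zero_iff_norm_tendsto_zero]
    refine squeeze_zero' (Eventually.of_forall fun _ => norm_nonneg _) ?_
      (by have := hdd.const_mul (‖lam - l0‖ / Real.sqrt (c0 / 2) * 4); rwa [mul_zero] at this)
    filter_upwards [hφ T] with r hr
    exact Tl_le hB (h lam le_rfl _ hr)
  have hps : Tendsto (fun r => p.derivative.eval (φ r) / SS p lam (φ r) ^ 6) atTop (nhds 0) := by
    rw [tendsto_zero_iff_norm_tendsto_zero]
    have hn : Tendsto (fun r => 1 + ‖φ r‖) atTop atTop :=
      tendsto_atTop_add_const_left _ _ (tendsto_atTop_mono (fun r => Complex.re_le_norm (φ r)) hre)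
    refine squeeze_zero' (Eventually.of_forall fun _ => norm_nonneg _) ?_
      (hn.const_div_atTop (A / (Real.sqrt (c / 2)) ^ 3))
    filter_upwards [hφ T] with r hr
    have := (h lam le_rfl _ hr).good 0 le_rfl
    simp only [Complex.ofReal_zero, add_zero] at this
    exact ps_le hB.pb hc this
  have hexp : Tendsto (fun r => Complex.exp (Tl p l0 lam (φ r))) atTop (nhds 1) := by
    have := (Complex.continuous_exp.tendsto 0).comp hTl
    rwa [Complex.exp_zero] at this
  constructor
  · have := hexp.mul hH
    rw [one_mul] at this
    refine this.congr' ?_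
    filter_upwards [hφ T, hφ T'] with r hr hr'
    have hS := SS_ne (h lam le_rfl _ hr).slit0
    rw [(h' _ hr').1, yy, Xi, neg_sub, Complex.exp_sub]
    have := Complex.exp_ne_zero (xi p l0 (φ r))
    field_simp
  · have := hexp.mul (((hps.const_mul (-1/4)).mul hH).sub hH |>.add hBb)
    have e : (1:ℂ) * (-1/4 * 0 * 1 - 1 + 0) = -1 := by norm_num
    rw [e] at this
    refine this.congr' ?_
    filter_upwards [hφ T, hφ T'] with r hr hr'
    have hS := SS_ne (h lam le_rfl _ hr).slit0
    rw [(h' _ hr').2, y1, Xi, neg_sub, Complex.exp_sub]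
    have := Complex.exp_ne_zero (xi p l0 (φ r))
    field_simp

theorem real_path (hm : 3 ≤ m) : ∀ T, ∀ᶠ r : ℝ in atTop, (r:ℂ) ∈ Om m T := fun T =>
  (eventually_gt_atTop T).mono fun _ hr => Om_real hm hr

/-- growth of `Re xi` on the real axis -/
theorem xi_re_ge (hB : Bas m p A c0 l0) {x : ℝ} (hx : 0 ≤ x) : Real.sqrt c0 * x ≤ (xi p l0 x).re := by
  have hm := hB.pb.hm
  have hd : ∀ t : ℝ, 0 ≤ t → HasDerivAt (fun t : ℝ => (xi p l0 t).re - Real.sqrt c0 * t) ((RR p l0 t).re - Real.sqrt c0) t := by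
    intro t ht
    have h1 := line_deriv (w := 0) (t := t) (by rw [zero_add]; exact hB.xi_deriv (Vr_real hm ht))
    simp only [zero_add] at h1
    have h2 : HasDerivAt (fun t : ℝ => (xi p l0 t).re) (RR p l0 t).re t :=
      Complex.reCLM.hasFDerivAt.comp_hasDerivAt t h1
    exact (h2.sub ((hasDerivAt_id t).const_mul (Real.sqrt c0))).congr_deriv (by simp)
  have hmono : MonotoneOn (fun t : ℝ => (xi p l0 t).re - Real.sqrt c0 * t) (Ici 0) := by
    refine monotoneOn_of_hasDerivWithinAt_nonneg (f' := fun t => (RR p l0 t).re - Real.sqrt c0) (convex_Ici 0)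
      (fun t ht => (hd t ht).continuousAt.continuousWithinAt)
      (fun t ht => (hd t (interior_subset ht)).hasDerivWithinAt) fun t ht => ?_
    have ht0 : (0:ℝ) ≤ t := interior_subset ht
    have h1 := (hB.g0 _ (Vr_real hm ht0)).re_sq
    have h2 : (1:ℝ) ≤ (1 + ‖(t:ℂ)‖) ^ m := one_le_pow₀ (by linarith [norm_nonneg (t:ℂ)])
    have h3 := hB.c0p
    rw [sub_nonneg]
    apply Real.sqrt_le_iff.2 ⟨RR_re_nonneg _ _ _, ?_⟩
    nlinarith
  have := hmono (mem_Ici.2 le_rfl) (mem_Ici.2 hx) hx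
  simp only [Complex.ofReal_zero, xi_zero] at this
  simp at this
  linarith

/-- polynomial bound -/
theorem Q_bd (hP : PB m p A) (lam : ℂ) : ∃ C : ℝ, 0 < C ∧ ∀ z : ℂ, ‖p.eval z + lam‖ ≤ C * (1 + ‖z‖) ^ m := by
  refine ⟨1 + A + ‖lam‖, by have := hP.A1; positivity, fun z => ?_⟩
  have h1 := hP.lo z
  have hX1 : 1 ≤ 1 + ‖z‖ := by have := norm_nonneg z; linarith
  have h2 : (1 + ‖z‖) ^ (m - 1) ≤ (1 + ‖z‖) ^ m := pow_le_pow_right₀ hX1 (by omega)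
  have h3 : (1:ℝ) ≤ (1 + ‖z‖) ^ m := one_le_pow₀ hX1
  have h4 : ‖z ^ m‖ ≤ (1 + ‖z‖) ^ m := by
    rw [norm_pow]; exact pow_le_pow_left₀ (norm_nonneg _) (by linarith) _
  have hA := hP.A1
  calc ‖p.eval z + lam‖ = ‖z ^ m + (p.eval z - z ^ m) + lam‖ := by congr 1; ring
    _ ≤ ‖z ^ m‖ + ‖p.eval z - z ^ m‖ + ‖lam‖ := norm_add₃_le
    _ ≤ (1 + ‖z‖) ^ m + A * (1 + ‖z‖) ^ m + ‖lam‖ * (1 + ‖z‖) ^ m := by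
        gcongr
        · exact h1.trans (by gcongr)
        · exact le_mul_of_one_le_right (norm_nonneg _) h3
    _ = _ := by ring

/-- polynomial times subdominant solution tends to zero -/
theorem sub_decay (hB : Bas m p A c0 l0) (lam : ℂ) (n : ℕ) :
    Tendsto (fun x : ℝ => (2 + x) ^ n * ‖phi p (FF hB lam) (FD hB lam) lam x‖) atTop (nhds 0) ∧
    Tendsto (fun x : ℝ => (2 + x) ^ n * ‖phid p (FF hB lam) (FD hB lam) lam x‖) atTop (nhds 0) := by
  have hm := hB.pb.hm
  obtain ⟨h1, h2⟩ := path_asym hB lam (real_path hm)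
  obtain ⟨T, c, C, hT, hC, hc, h⟩ := far hB.pb ‖lam‖
  obtain ⟨D, hD, hQ⟩ := Q_bd hB.pb lam
  have hk : 0 < Real.sqrt c0 := Real.sqrt_pos.2 hB.c0p
  have hpe : ∀ N : ℕ, Tendsto (fun x : ℝ => (2 + x) ^ N * Real.exp (-(Real.sqrt c0 * x))) atTop (nhds 0) := by
    intro N
    have e1 := (Real.tendsto_pow_mul_exp_neg_atTop_nhds_zero N).comp
      ((tendsto_atTop_add_const_left atTop (2:ℝ) tendsto_id).const_mul_atTop hk)
    have e2 := e1.const_mul ((Real.sqrt c0 ^ N)⁻¹ * Real.exp (2 * Real.sqrt c0))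
    rw [mul_zero] at e2
    refine e2.congr fun x => ?_
    simp only [Function.comp_apply, id]
    rw [mul_pow, show -(Real.sqrt c0 * (2 + x)) = -(2 * Real.sqrt c0) + -(Real.sqrt c0 * x) by ring, Real.exp_add,
      Real.exp_neg (2 * _)]
    field_simp
  have hxi : ∀ x : ℝ, 0 ≤ x → ‖Complex.exp (-xi p l0 x)‖ ≤ Real.exp (-(Real.sqrt c0 * x)) := by
    intro x hx
    rw [Complex.norm_exp, Complex.neg_re]
    exact Real.exp_le_exp.2 (neg_le_neg (xi_re_ge hB hx))
  have hbS : ∀ᶠ x : ℝ in atTop, SS p lam x ≠ 0 ∧ ‖(SS p lam x)⁻¹‖ ≤ 1 + 2 / c ∧ ‖SS p lam x‖ ≤ (1 + D) * (2 + x) ^ m := by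
    filter_upwards [real_path hm T, eventually_ge_atTop 0] with x hx hx0
    have hL := h lam le_rfl _ hx
    have hg := hL.good 0 le_rfl
    simp only [Complex.ofReal_zero, add_zero] at hg
    have hS := SS_ne hL.slit0
    have hS0 := norm_pos_iff.2 hS
    have e4 : ‖SS p lam x‖ ^ 4 = ‖p.eval (x:ℂ) + lam‖ := by rw [← norm_pow, SS_pow4]
    have hnx : ‖(x:ℂ)‖ = x := by rw [Complex.norm_real, Real.norm_of_nonneg hx0]
    refine ⟨hS, ?_, ?_⟩
    · have h3 := hg.norm_ge
      have h4 : (1:ℝ) ≤ (1 + ‖(x:ℂ)‖) ^ m := one_le_pow₀ (by linarith [norm_nonneg (x:ℂ)])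
      have h5 : c ≤ ‖SS p lam x‖ ^ 4 := by rw [e4]; nlinarith
      rw [norm_inv]
      by_cases hs1 : 1 ≤ ‖SS p lam x‖
      · have := inv_le_one_of_one_le₀ hs1
        have : 0 < 2 / c := by positivity
        linarith
      · push Not at hs1
        have h6 : ‖SS p lam x‖ ^ 4 ≤ ‖SS p lam x‖ := pow_le_of_le_one hS0.le hs1.le (by norm_num)
        have h7 : c ≤ ‖SS p lam x‖ := h5.trans h6
        have h8 := inv_anti₀ hc h7
        rw [div_eq_mul_inv]
        have : 0 < c⁻¹ := by positivity
        linarith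
    · have h3 := hQ x
      rw [hnx] at h3
      have h9 : (1 + x) ^ m ≤ (2 + x) ^ m := pow_le_pow_left₀ (by linarith) (by linarith) _
      have h10 : (1:ℝ) ≤ (2 + x) ^ m := one_le_pow₀ (by linarith)
      by_cases hs1 : ‖SS p lam x‖ ≤ 1
      · nlinarith
      · push Not at hs1
        have h6 : ‖SS p lam x‖ ≤ ‖SS p lam x‖ ^ 4 := le_self_pow₀ hs1.le (by norm_num)
        rw [e4] at h6
        nlinarith
  have hb1 := (h1.norm.eventually_le_const (by norm_num : ‖(1:ℂ)‖ < 2))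
  have hb2 := (h2.norm.eventually_le_const (by norm_num : ‖(-1:ℂ)‖ < 2))
  constructor
  · refine squeeze_zero' ?_ ?_ (by simpa using (hpe n).const_mul (2 * (1 + 2 / c)))
    · filter_upwards [eventually_ge_atTop 0] with x hx; positivity
    filter_upwards [hbS, hb1, eventually_ge_atTop 0] with x hx hx1 hx0
    set f := phi p (FF hB lam) (FD hB lam) lam x
    have e : f = (f * SS p lam x * Complex.exp (xi p l0 x)) * (SS p lam x)⁻¹ * Complex.exp (-xi p l0 x) := by
      rw [Complex.exp_neg]
      have := Complex.exp_ne_zero (xi p l0 x)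
      have := hx.1
      field_simp
    rw [e, norm_mul, norm_mul]
    have := hxi x hx0
    calc _ ≤ (2 + x) ^ n * (2 * (1 + 2 / c) * Real.exp (-(Real.sqrt c0 * x))) := by
          gcongr
          exact hx.2.1
      _ = _ := by ring
  · refine squeeze_zero' ?_ ?_ (by simpa using (hpe (n + m)).const_mul (2 * (1 + D)))
    · filter_upwards [eventually_ge_atTop 0] with x hx; positivity
    filter_upwards [hbS, hb2, eventually_ge_atTop 0] with x hx hx1 hx0
    set f := phid p (FF hB lam) (FD hB lam) lam x
    have e : f = (f / SS p lam x * Complex.exp (xi p l0 x)) * (SS p lam x) * Complex.exp (-xi p l0 x) := by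
      rw [Complex.exp_neg]
      have := Complex.exp_ne_zero (xi p l0 x)
      have := hx.1
      field_simp
    rw [e, norm_mul, norm_mul]
    have := hxi x hx0
    calc _ ≤ (2 + x) ^ n * (2 * ((1 + D) * (2 + x) ^ m) * Real.exp (-(Real.sqrt c0 * x))) := by
          gcongr
          exact hx.2.2
      _ = _ := by rw [pow_add]; ring

theorem sub_ne (hB : Bas m p A c0 l0) (lam : ℂ) : ¬ (FF hB lam = 0 ∧ FD hB lam = 0) := by
  rintro ⟨h1, h2⟩
  have hm := hB.pb.hm
  obtain ⟨h3, -⟩ := path_asym hB lam (real_path hm)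
  have : ∀ z, phi p (FF hB lam) (FD hB lam) lam z = 0 := by
    intro z
    rw [h1, h2]
    exact (pair_eq (Y := 0) (Y1 := 0) (by ring) (by ring)).1
  simp only [this, zero_mul] at h3
  exact zero_ne_one (tendsto_nhds_unique tendsto_const_nhds h3)

/-- decaying solutions are multiples of the subdominant one -/
theorem decay_prop (hB : Bas m p A c0 l0) {lam a b : ℂ}
    (h : Tendsto (fun x : ℝ => phi p a b lam x) atTop (nhds 0)) : a * FD hB lam - b * FF hB lam = 0 := by
  have hm := hB.pb.hm
  obtain ⟨D, hD, hQ⟩ := Q_bd hB.pb lam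
  have hb := (h.norm.eventually_le_const (by norm_num : ‖(0:ℂ)‖ < 1))
  obtain ⟨X, hX⟩ := eventually_atTop.1 hb
  have hd1 : ∀ t : ℝ, HasDerivAt (fun t : ℝ => phi p a b lam t) (phid p a b lam t) t := fun t => by
    have h1 := line_deriv (w := 0) (t := t) (by rw [zero_add]; exact phi_hasDeriv p a b lam t)
    simpa only [zero_add] using h1
  have hd2 : ∀ t : ℝ, HasDerivAt (fun t : ℝ => phid p a b lam t) ((p.eval (t:ℂ) + lam) * phi p a b lam t) t := fun t => by
    have h1 := line_deriv (w := 0) (t := t) (by rw [zero_add]; exact phid_hasDeriv p a b lam t)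
    simpa only [zero_add] using h1
  have hder : ∀ᶠ x : ℝ in atTop, ‖phid p a b lam x‖ ≤ (2 + D) * (2 + x) ^ m := by
    filter_upwards [eventually_ge_atTop X, eventually_ge_atTop 0] with x hx hx0
    have hbd : ∀ s ∈ Icc x (x + 1), ‖(p.eval (s:ℂ) + lam) * phi p a b lam s‖ ≤ D * (2 + x) ^ m := by
      intro s hs
      rw [norm_mul]
      have h1 := hQ s
      rw [Complex.norm_real, Real.norm_of_nonneg (by linarith [hs.1] : 0 ≤ s)] at h1
      have h2 := hX s (by linarith [hs.1])
      have h3 : (1 + s) ^ m ≤ (2 + x) ^ m := pow_le_pow_left₀ (by linarith [hs.1]) (by linarith [hs.2]) _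
      calc _ ≤ (D * (1 + s) ^ m) * 1 := by gcongr; exact (norm_nonneg _).trans h1
        _ ≤ _ := by rw [mul_one]; gcongr
    have h1 : ∀ s ∈ Icc x (x + 1), ‖phid p a b lam s - phid p a b lam x‖ ≤ D * (2 + x) ^ m := by
      intro s hs
      have := norm_image_sub_le_of_norm_deriv_le_segment' (f := fun t : ℝ => phid p a b lam t)
        (fun t ht => (hd2 t).hasDerivWithinAt) (fun t ht => hbd t (Ico_subset_Icc_self ht)) s hs
      refine this.trans ?_
      have h5 : 0 ≤ D * (2 + x) ^ m := by positivity
      nlinarith [hs.2]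
    have h2 := norm_image_sub_le_of_norm_deriv_le_segment' (a := x) (b := x + 1)
      (f := fun t : ℝ => phi p a b lam t - (t - x) * phid p a b lam x)
      (f' := fun t : ℝ => phid p a b lam t - phid p a b lam x) (C := D * (2 + x) ^ m)
      (fun t ht => by
        refine HasDerivAt.hasDerivWithinAt ?_
        have e : HasDerivAt (fun t : ℝ => ((t:ℂ) - x) * phid p a b lam x) (phid p a b lam x) t := by
          have := (((Complex.ofRealCLM.hasDerivAt (x := t))).sub_const (x:ℂ)).mul_const (phid p a b lam x)
          simpa using this
        exact (hd1 t).sub e) (fun t ht => h1 t (Ico_subset_Icc_self ht)) (x + 1) ⟨by linarith, le_rfl⟩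
    simp only [add_sub_cancel_left, mul_one] at h2
    have e : phid p a b lam x = phi p a b lam ((x + 1 : ℝ) : ℂ) - phi p a b lam x -
      (phi p a b lam ((x + 1 : ℝ) : ℂ) - (((x + 1 : ℝ):ℂ) - x) * phid p a b lam x - (phi p a b lam x - ((x:ℂ) - x) * phid p a b lam x)) := by
      push_cast; ring
    rw [e]
    have h3 := hX x hx
    have h4 := hX (x + 1) (by linarith)
    have h10 : (1:ℝ) ≤ (2 + x) ^ m := one_le_pow₀ (by linarith)
    refine (norm_sub_le _ _).trans ((add_le_add (norm_sub_le _ _) h2).trans ?_)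
    nlinarith
  obtain ⟨s1, s2⟩ := sub_decay hB lam m
  obtain ⟨-, s0⟩ := sub_decay hB lam 0
  simp only [pow_zero, one_mul] at s0
  have hW : ∀ x : ℝ, a * FD hB lam - b * FF hB lam = phi p a b lam x * phid p (FF hB lam) (FD hB lam) lam x
      - phid p a b lam x * phi p (FF hB lam) (FD hB lam) lam x := fun x => (phi_wr p _ _ _ _ lam x).symm
  have hlim : Tendsto (fun x : ℝ => phi p a b lam x * phid p (FF hB lam) (FD hB lam) lam x
      - phid p a b lam x * phi p (FF hB lam) (FD hB lam) lam x) atTop (nhds 0) := by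
    have t1 := h.mul (tendsto_zero_iff_norm_tendsto_zero.2 s0)
    have t2 : Tendsto (fun x : ℝ => phid p a b lam x * phi p (FF hB lam) (FD hB lam) lam x) atTop (nhds 0) := by
      rw [tendsto_zero_iff_norm_tendsto_zero]
      refine squeeze_zero' (Eventually.of_forall fun _ => norm_nonneg _) ?_ (by simpa using s1.const_mul (2 + D))
      filter_upwards [hder] with x hx
      rw [norm_mul, ← mul_assoc]
      gcongr
    simpa using t1.sub t2
  exact tendsto_nhds_unique (tendsto_const_nhds.congr hW) hlim

end

end Sib


namespace Sib

section
variable {m : ℕ} {p p' : Polynomial ℂ} {A A' c0 c0' : ℝ} {l0 l0' : ℂ}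

theorem real_mul_cpow {r : ℝ} (hr : 0 < r) {q : ℂ} (hq : q ≠ 0) (s : ℂ) :
    ((r:ℂ) * q) ^ s = (r:ℂ) ^ s * q ^ s := by
  have hr' : (r:ℂ) ≠ 0 := by exact_mod_cast hr.ne'
  rw [Complex.cpow_def_of_ne_zero (mul_ne_zero hr' hq), Complex.cpow_def_of_ne_zero hr',
    Complex.cpow_def_of_ne_zero hq, Complex.log_ofReal_mul hr hq, ← Complex.exp_add, Complex.ofReal_log hr.le]
  congr 1; ring

/-- leading behaviour of the potential along a ray -/
theorem ray_q (hP : PB m p A) (lam u : ℂ) (hu : ‖u‖ = 1) :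
    Tendsto (fun r : ℝ => (p.eval ((r:ℂ) * u) + lam) / (r:ℂ) ^ m) atTop (nhds (u ^ m)) := by
  have hm := hP.hm
  rw [tendsto_iff_norm_sub_tendsto_zero]
  have hl : Tendsto (fun r : ℝ => (A * 2 ^ (m - 1) + ‖lam‖) / r) atTop (nhds 0) :=
    tendsto_id.const_div_atTop _
  refine squeeze_zero' (Eventually.of_forall fun _ => norm_nonneg _) ?_ hl
  filter_upwards [eventually_ge_atTop 1] with r hr
  have hr0 : 0 < r := by linarith
  have hrc : (r:ℂ) ≠ 0 := by exact_mod_cast hr0.ne'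
  have e : (p.eval ((r:ℂ) * u) + lam) / (r:ℂ) ^ m - u ^ m = (p.eval ((r:ℂ) * u) - ((r:ℂ) * u) ^ m + lam) / (r:ℂ) ^ m := by
    field_simp; ring
  rw [e, norm_div, norm_pow, Complex.norm_real, Real.norm_of_nonneg hr0.le, div_le_div_iff₀ (by positivity) hr0]
  have h1 := hP.lo ((r:ℂ) * u)
  rw [norm_mul, hu, mul_one, Complex.norm_real, Real.norm_of_nonneg hr0.le] at h1
  have h2 : (1 + r) ^ (m - 1) ≤ (2 * r) ^ (m - 1) := pow_le_pow_left₀ (by linarith) (by linarith) _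
  have hA := hP.A1
  have h3 : (1:ℝ) ≤ r ^ (m - 1) := one_le_pow₀ hr
  have e1 : r ^ (m - 1) * r = r ^ m := by rw [← pow_succ]; congr 1; omega
  have h4 : ‖p.eval ((r:ℂ) * u) - ((r:ℂ) * u) ^ m + lam‖ ≤ (A * 2 ^ (m - 1) + ‖lam‖) * r ^ (m - 1) := by
    refine (norm_add_le _ _).trans ?_
    calc _ ≤ A * (2 * r) ^ (m - 1) + ‖lam‖ * r ^ (m - 1) := by
          gcongr
          · exact h1.trans (by gcongr)
          · exact le_mul_of_one_le_right (norm_nonneg _) h3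
      _ = _ := by rw [mul_pow]; ring
  calc _ ≤ (A * 2 ^ (m - 1) + ‖lam‖) * r ^ (m - 1) * r := by gcongr
    _ = _ := by rw [mul_assoc, e1]

theorem SS_ratio (hP : PB m p A) (hP' : PB m p' A') (lam lam' : ℂ) {u u' : ℂ} (hu : ‖u‖ = 1) (hu' : ‖u'‖ = 1)
    (hs : u ^ m ∈ slitPlane) (hs' : u' ^ m ∈ slitPlane) :
    Tendsto (fun r : ℝ => SS p lam (r * u) / SS p' lam' (r * u')) atTop
      (nhds ((u ^ m) ^ (1/4 : ℂ) / (u' ^ m) ^ (1/4 : ℂ))) := by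
  have h1 := ray_q hP lam u hu
  have h2 := ray_q hP' lam' u' hu'
  have h3 := h1.cpow (tendsto_const_nhds (x := (1/4 : ℂ))) hs
  have h4 := h2.cpow (tendsto_const_nhds (x := (1/4 : ℂ))) hs'
  have hu0 : u' ≠ 0 := by rw [← norm_pos_iff, hu']; norm_num
  have hu1 : u ≠ 0 := by rw [← norm_pos_iff, hu]; norm_num
  have hne : (u' ^ m) ^ (1/4 : ℂ) ≠ 0 := by
    rw [Complex.cpow_ne_zero_iff]; left; exact pow_ne_zero _ hu0
  refine (h3.div h4 hne).congr' ?_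
  filter_upwards [eventually_gt_atTop 0, h1.eventually_ne (pow_ne_zero m hu1), h2.eventually_ne (pow_ne_zero m hu0)]
    with r hr hq hq'
  have hrm : (0:ℝ) < r ^ m := by positivity
  have hrc : ((r:ℂ) ^ m) ≠ 0 := by exact_mod_cast hrm.ne'
  have e : ∀ (q : ℂ), q / (r:ℂ)^m ≠ 0 → q ^ (1/4 : ℂ) = (((r ^ m : ℝ)) : ℂ) ^ (1/4 : ℂ) * (q / (r:ℂ)^m) ^ (1/4 : ℂ) := by
    intro q hq
    rw [← real_mul_cpow hrm hq]
    congr 1; push_cast; field_simp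
  have hz : (((r ^ m : ℝ)) : ℂ) ^ (1/4 : ℂ) ≠ 0 := by
    rw [Complex.cpow_ne_zero_iff]; left; exact_mod_cast hrm.ne'
  simp only [Pi.div_apply]
  rw [SS, SS, e _ hq, e _ hq', mul_div_mul_left _ _ hz]

noncomputable def om (m : ℕ) : ℂ := Complex.exp ((2 * Real.pi / ((m:ℝ) + 2) : ℝ) * I)
noncomputable def ee (m : ℕ) : ℂ := Complex.exp ((Real.pi / ((m:ℝ) + 2) : ℝ) * I)

theorem ee_sq (m : ℕ) : ee m ^ 2 = om m := by
  rw [ee, om, ← Complex.exp_nat_mul]; congr 1; push_cast; ring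

theorem ee_ne (m : ℕ) : ee m ≠ 0 := Complex.exp_ne_zero _
theorem om_ne (m : ℕ) : om m ≠ 0 := Complex.exp_ne_zero _

theorem om_pow (m : ℕ) : om m ^ (m + 2) = 1 := by
  rw [om, ← Complex.exp_nat_mul, ← Complex.exp_two_pi_mul_I]; congr 1; push_cast
  have : (m:ℂ) + 2 ≠ 0 := by exact_mod_cast (by omega : m + 2 ≠ 0)
  field_simp

theorem ee_norm (m : ℕ) : ‖ee m‖ = 1 := Complex.norm_exp_ofReal_mul_I _

theorem ray_Om (hm : 3 ≤ m) {θ : ℝ} (hθ : |θ| < th m) (T : ℝ) : ∀ᶠ r : ℝ in atTop, (r:ℂ) * Complex.exp (θ * I) ∈ Om m T := by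
  have h1 := th_le m hm
  have hpi := Real.pi_pos
  have hc : 0 < Real.cos θ := Real.cos_pos_of_mem_Ioo ⟨by linarith [(abs_lt.1 hθ).1], by linarith [(abs_lt.1 hθ).2]⟩
  have ht : |Real.tan θ| < Real.tan (th m) := by
    rw [abs_lt, ← Real.tan_neg]
    constructor
    · exact Real.tan_lt_tan_of_lt_of_lt_pi_div_two (by linarith) (by linarith [(abs_lt.1 hθ).2]) (abs_lt.1 hθ).1
    · exact Real.tan_lt_tan_of_lt_of_lt_pi_div_two (by linarith [(abs_lt.1 hθ).1]) (by linarith) (abs_lt.1 hθ).2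
  have hpos : 0 < Real.tan (th m) * Real.cos θ - |Real.sin θ| := by
    have e : |Real.sin θ| = |Real.tan θ| * Real.cos θ := by
      rw [← Real.tan_mul_cos hc.ne', abs_mul, abs_of_pos hc]
    rw [e]; nlinarith
  have hl : Tendsto (fun r : ℝ => r * (Real.tan (th m) * Real.cos θ - |Real.sin θ|)) atTop atTop :=
    tendsto_id.atTop_mul_const hpos
  filter_upwards [hl.eventually_gt_atTop (Real.tan (th m) * T), eventually_ge_atTop 0] with r hr hr0
  simp only [Om, mem_ofPred_eq]
  have e1 : ((r:ℂ) * Complex.exp (θ * I)).re = r * Real.cos θ := by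
    rw [Complex.re_ofReal_mul, Complex.exp_ofReal_mul_I_re]
  have e2 : ((r:ℂ) * Complex.exp (θ * I)).im = r * Real.sin θ := by
    rw [Complex.im_ofReal_mul, Complex.exp_ofReal_mul_I_im]
  rw [e1, e2, abs_mul, abs_of_nonneg hr0]
  nlinarith

theorem cpow_arg {θ : ℝ} (h : |θ| < Real.pi) : Complex.exp (θ * I) ∈ slitPlane ∧
    Complex.exp (θ * I) ^ (1/4 : ℂ) = Complex.exp ((θ/4 : ℝ) * I) := by
  have hl : Complex.log (Complex.exp (θ * I)) = θ * I := by
    apply Complex.log_exp <;> simp <;> linarith [(abs_lt.1 h).1, (abs_lt.1 h).2]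
  constructor
  · rw [Complex.mem_slitPlane_iff_arg]
    refine ⟨?_, Complex.exp_ne_zero _⟩
    rw [← Complex.log_im, hl]
    simp; linarith [(abs_lt.1 h).2]
  · rw [Complex.cpow_def_of_ne_zero (Complex.exp_ne_zero _), hl]
    congr 1; push_cast; ring

theorem SS_ratio_lim (hP : PB m p A) (hP' : PB m p' A') :
    ∃ σ : ℂ, σ ≠ 0 ∧ σ ^ 2 = -(om m)⁻¹ ∧ ∀ lam lam' : ℂ,
    Tendsto (fun r : ℝ => SS p lam (r * ee m) / SS p' lam' (r * (ee m)⁻¹)) atTop (nhds σ) := by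
  have hpi := Real.pi_pos
  have hm0 : (0:ℝ) < (m:ℝ) + 2 := by positivity
  set θ : ℝ := m * Real.pi / (m + 2) with hθ
  have h0 : 0 ≤ θ := by positivity
  have h1 : θ < Real.pi := by rw [hθ, div_lt_iff₀ hm0]; nlinarith
  have e1 : ee m ^ m = Complex.exp (θ * I) := by
    rw [ee, ← Complex.exp_nat_mul]; congr 1; rw [hθ]; push_cast; ring
  have e2 : (ee m)⁻¹ ^ m = Complex.exp ((-θ : ℝ) * I) := by
    rw [inv_pow, e1, ← Complex.exp_neg]; congr 1; push_cast; ring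
  obtain ⟨s1, s2⟩ := cpow_arg (θ := θ) (by rw [abs_of_nonneg h0]; exact h1)
  obtain ⟨s3, s4⟩ := cpow_arg (θ := -θ) (by rw [abs_neg, abs_of_nonneg h0]; exact h1)
  have hn : ‖(ee m)⁻¹‖ = 1 := by rw [norm_inv, ee_norm, inv_one]
  have := fun lam lam' => SS_ratio hP hP' lam lam' (ee_norm m) hn (by rw [e1]; exact s1) (by rw [e2]; exact s3)
  refine ⟨_, ?_, ?_, this⟩
  · rw [e1, e2, s2, s4]
    exact div_ne_zero (Complex.exp_ne_zero _) (Complex.exp_ne_zero _)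
  · rw [e1, e2, s2, s4, ← Complex.exp_sub, ← Complex.exp_nat_mul, om, ← Complex.exp_neg, ← neg_one_mul (Complex.exp _), ← Complex.exp_pi_mul_I,
      ← Complex.exp_add]
    congr 1
    rw [hθ]; push_cast
    have : (m:ℂ) + 2 ≠ 0 := by exact_mod_cast (by omega : m + 2 ≠ 0)
    field_simp
    ring

/-- rotated coefficients -/
noncomputable def rot (a : ℕ → ℂ) (w : ℂ) : ℕ → ℂ := fun j => a j * w⁻¹ ^ j

theorem rot_rot (a : ℕ → ℂ) (w v : ℂ) : rot (rot a w) v = rot a (w * v) := by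
  funext j; simp [rot, mul_pow]; ring

theorem rot_one (a : ℕ → ℂ) : rot a 1 = a := by funext j; simp [rot]

theorem rot_eval (a : ℕ → ℂ) {w : ℂ} (hw : w ^ (m + 2) = 1) (z : ℂ) :
    (qp m (rot a w)).eval z = w ^ 2 * (qp m a).eval (w * z) := by
  have hw0 : w ≠ 0 := by rintro rfl; simp at hw
  rw [qp_eval, qp_eval, mul_add, mul_pow, ← mul_assoc, ← pow_add, add_comm 2 m, hw, one_mul, Ppoly, Ppoly, Finset.mul_sum]
  congr 1
  refine Finset.sum_congr rfl fun j hj => ?_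
  have hj := Finset.mem_Icc.1 hj
  have e : w⁻¹ ^ j = w ^ 2 * w ^ (m - j) := by
    rw [inv_pow, eq_comm, ← pow_add, ← mul_eq_one_iff_eq_inv₀ (pow_ne_zero _ hw0), ← pow_add, ← hw]
    congr 1; omega
  rw [rot, e, mul_pow]; ring

/-- uniqueness for the initial value problem -/
theorem ivp_unique {q : ℂ → ℂ} {lam : ℂ} {v v1 : ℂ → ℂ} (hq : ∀ z, q z = p.eval z + lam)
    (h : ∀ z, HasDerivAt v (v1 z) z ∧ HasDerivAt v1 (q z * v z) z) (z : ℂ) :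
    phi p (v 0) (v1 0) lam z = v z ∧ phid p (v 0) (v1 0) lam z = v1 z := by
  have h' : ∀ w ∈ (univ : Set ℂ), HasDerivAt v (v1 w) w ∧ HasDerivAt v1 ((p.eval w + lam) * v w) w := fun w _ => by
    rw [← hq]; exact h w
  apply pair_eq
  · rw [wr_const isOpen_univ convex_univ (q := fun w => p.eval w + lam) h' (fun w _ => phi_pair p 0 1 lam w)
      (mem_univ z) (mem_univ 0)]
    simp [phi_zero, phid_zero]
  · rw [wr_const isOpen_univ convex_univ (q := fun w => p.eval w + lam) h' (fun w _ => phi_pair p 1 0 lam w)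
      (mem_univ z) (mem_univ 0)]
    simp [phi_zero, phid_zero]

theorem phi_rot (a : ℕ → ℂ) {w : ℂ} (hw : w ^ (m + 2) = 1) (α β lam z : ℂ) :
    phi (qp m (rot a w)) α (w * β) (w ^ 2 * lam) z = phi (qp m a) α β lam (w * z) ∧
    phid (qp m (rot a w)) α (w * β) (w ^ 2 * lam) z = w * phid (qp m a) α β lam (w * z) := by
  have := ivp_unique (p := qp m (rot a w)) (q := fun z => (qp m (rot a w)).eval z + w ^ 2 * lam) (lam := w ^ 2 * lam)
    (v := fun z => phi (qp m a) α β lam (w * z)) (v1 := fun z => w * phid (qp m a) α β lam (w * z)) (fun _ => rfl)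
    (fun z => by
      have hl : HasDerivAt (fun z : ℂ => w * z) w z := by simpa using (hasDerivAt_id z).const_mul w
      constructor
      · exact ((phi_hasDeriv (qp m a) α β lam (w * z)).comp z hl).congr_deriv (by ring)
      · refine (((phid_hasDeriv (qp m a) α β lam (w * z)).comp z hl).const_mul w).congr_deriv ?_
        rw [rot_eval a hw]; ring) z
  simpa only [mul_zero, phi_zero, phid_zero] using this

theorem phi_smul (p : Polynomial ℂ) (t α β lam z : ℂ) : phi p (t * α) (t * β) lam z = t * phi p α β lam z ∧
   phid p (t * α) (t * β) lam z = t * phid p α β lam z := by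
  have := ivp_unique (p := p) (q := fun z => p.eval z + lam) (lam := lam)
    (v := fun z => t * phi p α β lam z) (v1 := fun z => t * phid p α β lam z) (fun _ => rfl)
    (fun z => ⟨(phi_hasDeriv p α β lam z).const_mul t, ((phid_hasDeriv p α β lam z).const_mul t).congr_deriv (by ring)⟩) z
  simpa only [phi_zero, phid_zero] using this

theorem bas_ex (m : ℕ) (hm : 3 ≤ m) (a : ℕ → ℂ) : ∃ q : ℝ × ℝ × ℝ, Bas m (qp m a) q.1 q.2.1 (q.2.2 : ℂ) ∧ 0 < q.2.2 := by
  obtain ⟨A, hA⟩ := qp_PB m hm a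
  obtain ⟨c0, l, h1, h2⟩ := exists_bas hA
  exact ⟨(A, c0, l), h1, h2⟩

noncomputable def bl (m : ℕ) (hm : 3 ≤ m) (a : ℕ → ℂ) : ℝ := (bas_ex m hm a).choose.2.2

theorem bas (m : ℕ) (hm : 3 ≤ m) (a : ℕ → ℂ) : Bas m (qp m a) (bas_ex m hm a).choose.1 (bas_ex m hm a).choose.2.1 (bl m hm a : ℂ) :=
  (bas_ex m hm a).choose_spec.1

theorem bl_pos (m : ℕ) (hm : 3 ≤ m) (a : ℕ → ℂ) : 0 < bl m hm a := (bas_ex m hm a).choose_spec.2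

noncomputable def F0 (m : ℕ) (hm : 3 ≤ m) (a : ℕ → ℂ) (lam : ℂ) : ℂ := FF (bas m hm a) lam
noncomputable def F1 (m : ℕ) (hm : 3 ≤ m) (a : ℕ → ℂ) (lam : ℂ) : ℂ := FD (bas m hm a) lam

noncomputable def W01 (m : ℕ) (hm : 3 ≤ m) (a : ℕ → ℂ) (lam : ℂ) : ℂ :=
  F0 m hm a lam * ((om m)⁻¹ * F1 m hm (rot a (om m)) (om m ^ 2 * lam))
    - F1 m hm a lam * F0 m hm (rot a (om m)) (om m ^ 2 * lam)

theorem W01_asym (hm : 3 ≤ m) (a : ℕ → ℂ) : ∃ E : ℝ → ℂ, ∃ τ : ℂ, τ ≠ 0 ∧ (∀ r, E r ≠ 0) ∧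
    ∀ lam, Tendsto (fun r => W01 m hm a lam * E r) atTop (nhds τ) := by
  set hB := bas m hm a
  set b := rot a (om m) with hb
  set hB' := bas m hm b
  obtain ⟨σ, hσ, hσ2, hσ3⟩ := SS_ratio_lim hB.pb hB'.pb
  have hpi := Real.pi_pos
  have hm0 : (0:ℝ) < (m:ℝ) + 2 := by positivity
  have hth : Real.pi / ((m:ℝ) + 2) < th m := by
    unfold th; apply div_lt_div_of_pos_left hpi (by positivity) (by linarith)
  have hp : ∀ T, ∀ᶠ r : ℝ in atTop, (r:ℂ) * ee m ∈ Om m T := ray_Om hm (by rw [abs_of_pos (by positivity)]; exact hth)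
  have hp' : ∀ T, ∀ᶠ r : ℝ in atTop, (r:ℂ) * (ee m)⁻¹ ∈ Om m T := fun T => by
    have := ray_Om hm (θ := -(Real.pi / ((m:ℝ) + 2))) (by rw [abs_neg, abs_of_pos (by positivity)]; exact hth) T
    filter_upwards [this] with r hr
    rw [ee, ← Complex.exp_neg]
    convert hr using 3
    push_cast; ring
  refine ⟨fun r => Complex.exp (xi (qp m a) (bl m hm a) (r * ee m)) * Complex.exp (xi (qp m b) (bl m hm b) (r * (ee m)⁻¹)),
    2 * σ, by simpa using hσ, fun r => mul_ne_zero (Complex.exp_ne_zero _) (Complex.exp_ne_zero _), fun lam => ?_⟩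
  obtain ⟨a1, a2⟩ := path_asym hB lam hp
  obtain ⟨b1, b2⟩ := path_asym hB' (om m ^ 2 * lam) hp'
  have hs := hσ3 lam (om m ^ 2 * lam)
  have hom := om_ne m
  have key := (((a1.mul b2).const_mul (om m)⁻¹).mul (hs.inv₀ hσ)).sub ((a2.mul b1).mul hs)
  have e : (om m)⁻¹ * (1 * -1) * σ⁻¹ - -1 * 1 * σ = 2 * σ := by
    have : (om m)⁻¹ = -σ^2 := by rw [hσ2]; ring
    rw [this]; field_simp; ring
  rw [e] at key
  refine key.congr' ?_
  filter_upwards [hs.eventually_ne hσ] with r hr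
  have hS : SS (qp m a) lam (r * ee m) ≠ 0 := fun h => hr (by rw [h, zero_div])
  have hS' : SS (qp m b) (om m ^ 2 * lam) (r * (ee m)⁻¹) ≠ 0 := fun h => hr (by rw [h, div_zero])
  have hz : om m * (r * (ee m)⁻¹) = r * ee m := by
    rw [← ee_sq]; have := ee_ne m; field_simp
  have hW : W01 m hm a lam = phi (qp m a) (F0 m hm a lam) (F1 m hm a lam) lam (r * ee m) *
      ((om m)⁻¹ * phid (qp m b) (F0 m hm b (om m ^ 2 * lam)) (F1 m hm b (om m ^ 2 * lam)) (om m ^ 2 * lam) (r * (ee m)⁻¹)) -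
      phid (qp m a) (F0 m hm a lam) (F1 m hm a lam) lam (r * ee m) *
      phi (qp m b) (F0 m hm b (om m ^ 2 * lam)) (F1 m hm b (om m ^ 2 * lam)) (om m ^ 2 * lam) (r * (ee m)⁻¹) := by
    have h1 := phi_rot a (om_pow m) (F0 m hm b (om m ^ 2 * lam)) ((om m)⁻¹ * F1 m hm b (om m ^ 2 * lam)) lam (r * (ee m)⁻¹)
    rw [mul_inv_cancel_left₀ hom, hz] at h1
    rw [← hb] at h1
    rw [h1.1, h1.2, inv_mul_cancel_left₀ hom, phi_wr, W01]
  rw [hW]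
  unfold F0 F1
  clear hW hz
  generalize (r:ℂ) * (ee m)⁻¹ = z' at *
  generalize (r:ℂ) * (ee m) = z at *
  field_simp
end

end Sib


namespace Sib

section
variable {m : ℕ}

theorem W01_const (hm : 3 ≤ m) (a : ℕ → ℂ) : ∃ K : ℂ, K ≠ 0 ∧ ∀ lam, W01 m hm a lam = K := by
  obtain ⟨E, τ, hτ, hE, h⟩ := W01_asym hm a
  have hne : ∀ lam, W01 m hm a lam ≠ 0 := by
    intro lam h0
    have := h lam
    simp only [h0, zero_mul] at this
    exact hτ (tendsto_nhds_unique this tendsto_const_nhds)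
  refine ⟨W01 m hm a 0, hne 0, fun lam => ?_⟩
  have h1 := (h lam).div (h 0) hτ
  rw [div_self hτ] at h1
  have h2 : ∀ r, W01 m hm a lam / W01 m hm a 0 = (fun r => W01 m hm a lam * E r) r / (fun r => W01 m hm a 0 * E r) r :=
    fun r => by
      have := hE r
      have := hne 0
      simp only []
      field_simp
  have h3 : W01 m hm a lam / W01 m hm a 0 = 1 :=
    tendsto_nhds_unique (tendsto_const_nhds.congr h2) h1
  exact (div_eq_one_iff_eq (hne 0)).1 h3

noncomputable def G0 (m : ℕ) (hm : 3 ≤ m) (a : ℕ → ℂ) (w lam : ℂ) : ℂ := F0 m hm (rot a w) (w ^ 2 * lam)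
noncomputable def G1 (m : ℕ) (hm : 3 ≤ m) (a : ℕ → ℂ) (w lam : ℂ) : ℂ := w⁻¹ * F1 m hm (rot a w) (w ^ 2 * lam)
noncomputable def Wr (m : ℕ) (hm : 3 ≤ m) (a : ℕ → ℂ) (w v lam : ℂ) : ℂ :=
  G0 m hm a w lam * G1 m hm a v lam - G1 m hm a w lam * G0 m hm a v lam

theorem Wr_adj (hm : 3 ≤ m) (a : ℕ → ℂ) {w : ℂ} (hw : w ≠ 0) :
    ∃ K : ℂ, K ≠ 0 ∧ ∀ lam, Wr m hm a w (w * om m) lam = K := by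
  obtain ⟨K, hK, h⟩ := W01_const hm (rot a w)
  refine ⟨w⁻¹ * K, mul_ne_zero (inv_ne_zero hw) hK, fun lam => ?_⟩
  rw [← h (w ^ 2 * lam), W01, Wr, G0, G1, G0, G1, rot_rot, mul_pow, mul_inv,
    show w ^ 2 * om m ^ 2 * lam = om m ^ 2 * (w ^ 2 * lam) by ring]
  ring

theorem G_entire (hm : 3 ≤ m) (a : ℕ → ℂ) (w : ℂ) : Differentiable ℂ (G0 m hm a w) ∧ Differentiable ℂ (G1 m hm a w) := by
  obtain ⟨h1, h2⟩ := FF_entire (bas m hm (rot a w))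
  have hl : Differentiable ℂ (fun lam : ℂ => w ^ 2 * lam) := by fun_prop
  exact ⟨h1.comp hl, (h2.comp hl).const_mul _⟩

theorem Wr_entire (hm : 3 ≤ m) (a : ℕ → ℂ) (w v : ℂ) : Differentiable ℂ (Wr m hm a w v) :=
  ((G_entire hm a w).1.mul (G_entire hm a v).2).sub ((G_entire hm a w).2.mul (G_entire hm a v).1)

theorem G_ne (hm : 3 ≤ m) (a : ℕ → ℂ) {w : ℂ} (hw : w ≠ 0) (lam : ℂ) : ¬ (G0 m hm a w lam = 0 ∧ G1 m hm a w lam = 0) := by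
  rintro ⟨h1, h2⟩
  refine sub_ne (bas m hm (rot a w)) (w ^ 2 * lam) ⟨h1, ?_⟩
  rw [G1, mul_eq_zero] at h2
  exact h2.resolve_left (inv_ne_zero hw)

/-- the solution with data `G0, G1` decays on the ray `w` -/
theorem G_decay (hm : 3 ≤ m) (a : ℕ → ℂ) {w : ℂ} (hw : w ^ (m + 2) = 1) (lam : ℂ) :
    Tendsto (fun r : ℝ => phi (qp m a) (G0 m hm a w lam) (G1 m hm a w lam) lam (w * r)) atTop (nhds 0) := by
  have hw0 : w ≠ 0 := by rintro rfl; simp at hw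
  obtain ⟨h, -⟩ := sub_decay (bas m hm (rot a w)) (w ^ 2 * lam) 0
  simp only [pow_zero, one_mul] at h
  refine (tendsto_zero_iff_norm_tendsto_zero.2 h).congr fun r => ?_
  rw [← (phi_rot a hw _ _ lam r).1, G1, mul_inv_cancel_left₀ hw0, G0]
  rfl

theorem G_prop (hm : 3 ≤ m) (a : ℕ → ℂ) {w : ℂ} (hw : w ^ (m + 2) = 1) {lam α β : ℂ}
    (h : Tendsto (fun r : ℝ => phi (qp m a) α β lam (w * r)) atTop (nhds 0)) :
    α * G1 m hm a w lam - β * G0 m hm a w lam = 0 := by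
  have hw0 : w ≠ 0 := by rintro rfl; simp at hw
  have := decay_prop (bas m hm (rot a w)) (lam := w ^ 2 * lam) (a := α) (b := w * β)
    (h.congr fun r => ((phi_rot a hw α β lam r).1).symm)
  rw [G0, G1, F0, F1]
  have e : ∀ x y : ℂ, α * x - w * β * y = 0 → α * (w⁻¹ * x) - β * y = 0 := by
    intro x y hxy
    have : α * (w⁻¹ * x) - β * y = w⁻¹ * (α * x - w * β * y) := by field_simp
    rw [this, hxy, mul_zero]
  exact e _ _ this

theorem ray_eq (m : ℕ) (r : ℝ) : ((r:ℂ) * Complex.exp (((-(Real.pi / 2) + 2 * Real.pi / ((m : ℝ) + 2) : ℝ) : ℂ) * I)) = -I * (om m * r) ∧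
    ((r:ℂ) * Complex.exp (((-(Real.pi / 2) - 2 * Real.pi / ((m : ℝ) + 2) : ℝ) : ℂ) * I)) = -I * ((om m)⁻¹ * r) := by
  have hI : Complex.exp (-(Real.pi / 2 * I)) = -I := by
    rw [Complex.exp_neg, Complex.exp_pi_div_two_mul_I, Complex.inv_I]
  constructor
  · rw [om, ← hI]
    push_cast
    rw [add_mul, Complex.exp_add, neg_mul]; ring
  · rw [om, ← hI, ← Complex.exp_neg]
    push_cast
    rw [sub_mul, sub_eq_add_neg, Complex.exp_add, neg_mul]; ring

/-- spectral determinant criterion -/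
theorem eig_iff (hm : 3 ≤ m) (a : ℕ → ℂ) (lam : ℂ) :
    IsEigenvalue m a lam ↔ Wr m hm a (om m)⁻¹ (om m) lam = 0 := by
  have hw : om m ^ (m + 2) = 1 := om_pow m
  have hw' : (om m)⁻¹ ^ (m + 2) = 1 := by rw [inv_pow, hw, inv_one]
  have hI : ∀ z : ℂ, I * (-I * z) = z := fun z => by rw [← mul_assoc]; simp
  constructor
  · rintro ⟨u, hu, hnc, hode, d1, d2⟩
    have hu2 : Differentiable ℂ (deriv u) := fun z => (hu.analyticAt z).deriv.differentiableAt
    have hl : ∀ z : ℂ, HasDerivAt (fun z : ℂ => -I * z) (-I) z := fun z => by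
      simpa using (hasDerivAt_id z).const_mul (-I)
    have hv : ∀ z, HasDerivAt (fun z => u (-I * z)) (-I * deriv u (-I * z)) z ∧
        HasDerivAt (fun z => -I * deriv u (-I * z)) (((qp m a).eval z + lam) * u (-I * z)) z := by
      intro z
      constructor
      · exact ((hu (-I * z)).hasDerivAt.comp z (hl z)).congr_deriv (by ring)
      · refine (((hu2 (-I * z)).hasDerivAt.comp z (hl z)).const_mul (-I)).congr_deriv ?_
        have := hode (-I * z)
        rw [hI] at this
        rw [qp_eval]
        linear_combination this + (deriv (deriv u) (-I * z)) * Complex.I_sq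
    have huq := fun z => (ivp_unique (p := qp m a) (lam := lam) (fun z => rfl) hv z).1
    have e1 := G_prop hm a hw (d1.congr fun r => by rw [(ray_eq m r).1, huq])
    have e2 := G_prop hm a hw' (d2.congr fun r => by rw [(ray_eq m r).2, huq])
    simp only [mul_zero] at e1 e2 huq
    set α := u 0
    set β := -I * deriv u 0
    by_contra hW
    have hα : α = 0 := by
      have : α * Wr m hm a (om m)⁻¹ (om m) lam = 0 := by
        rw [Wr]; linear_combination (G0 m hm a (om m)⁻¹ lam) * e1 - (G0 m hm a (om m) lam) * e2
      exact (mul_eq_zero.1 this).resolve_right hW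
    have hβ : β = 0 := by
      have : β * Wr m hm a (om m)⁻¹ (om m) lam = 0 := by
        rw [Wr]; linear_combination (G1 m hm a (om m)⁻¹ lam) * e1 - (G1 m hm a (om m) lam) * e2
      exact (mul_eq_zero.1 this).resolve_right hW
    apply hnc
    refine ⟨0, fun z => ?_⟩
    have h1 := huq (I * z)
    rw [hα, hβ] at h1
    have h2 : -I * (I * z) = z := by rw [← mul_assoc]; simp
    rw [h2] at h1
    have h3 := (phi_smul (qp m a) 0 0 0 lam (I * z)).1
    simp only [zero_mul] at h3
    rw [← h1, h3]
  · intro hW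
    have hom := om_ne m
    set α := G0 m hm a (om m) lam with hα
    set β := G1 m hm a (om m) lam with hβ
    set α' := G0 m hm a (om m)⁻¹ lam with hα'
    set β' := G1 m hm a (om m)⁻¹ lam with hβ'
    have hWe : α' * β - β' * α = 0 := hW
    have hn := G_ne hm a hom lam
    have hn' := G_ne hm a (inv_ne_zero hom) lam
    obtain ⟨t, ht1, ht2⟩ : ∃ t, α = t * α' ∧ β = t * β' := by
      by_cases h : α' = 0
      · have hb : β' ≠ 0 := fun hb => hn' ⟨h, hb⟩
        refine ⟨β / β', ?_, by field_simp⟩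
        rw [h, zero_mul, zero_sub, neg_eq_zero, mul_eq_zero] at hWe
        rw [hWe.resolve_left hb, h, mul_zero]
      · refine ⟨α / α', by field_simp, ?_⟩
        field_simp
        linear_combination hWe
    have hd1 := G_decay hm a hw lam
    have hd2 := (G_decay hm a hw' lam).const_mul t
    rw [← hα, ← hβ] at hd1
    rw [← hα', ← hβ', mul_zero] at hd2
    have hd2' : Tendsto (fun r : ℝ => phi (qp m a) α β lam ((om m)⁻¹ * r)) atTop (nhds 0) := by
      refine hd2.congr fun r => ?_
      rw [ht1, ht2, (phi_smul (qp m a) t α' β' lam _).1]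
    have hl : ∀ z : ℂ, HasDerivAt (fun z : ℂ => I * z) I z := fun z => by
      simpa using (hasDerivAt_id z).const_mul I
    have h1 : ∀ z, HasDerivAt (fun z => phi (qp m a) α β lam (I * z)) (I * phid (qp m a) α β lam (I * z)) z := fun z =>
      ((phi_hasDeriv (qp m a) α β lam (I * z)).comp z (hl z)).congr_deriv (by ring)
    have h2 : ∀ z, HasDerivAt (fun z => I * phid (qp m a) α β lam (I * z))
        (-(((qp m a).eval (I * z) + lam) * phi (qp m a) α β lam (I * z))) z := fun z =>
      (((phid_hasDeriv (qp m a) α β lam (I * z)).comp z (hl z)).const_mul I).congr_deriv (by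
        linear_combination (((qp m a).eval (I * z) + lam) * phi (qp m a) α β lam (I * z)) * Complex.I_sq)
    have hd : deriv (fun z => phi (qp m a) α β lam (I * z)) = fun z => I * phid (qp m a) α β lam (I * z) :=
      funext fun z => (h1 z).deriv
    refine ⟨fun z => phi (qp m a) α β lam (I * z), fun z => (h1 z).differentiableAt, ?_, ?_, ?_, ?_⟩
    · rintro ⟨c, hc⟩
      have hcz : ∀ z, phi (qp m a) α β lam z = c := fun z => by
        have := hc (-I * z); simp only [hI] at this; exact this
      simp only [hcz] at hd1
      have hc0 : c = 0 := tendsto_nhds_unique tendsto_const_nhds hd1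
      apply hn
      constructor
      · rw [← hα, ← phi_zero (qp m a) α β lam, hcz, hc0]
      · have := h1 0
        simp only [hcz, hc0] at this
        have h3 := this.unique (hasDerivAt_const 0 0)
        rw [mul_zero, phid_zero, mul_eq_zero] at h3
        exact h3.resolve_left I_ne_zero
    · intro z
      rw [hd, (h2 z).deriv, qp_eval]; ring
    · refine hd1.congr fun r => ?_
      simp only [(ray_eq m r).1, hI]
    · refine hd2'.congr fun r => ?_
      simp only [(ray_eq m r).2, hI]
end

end Sib


namespace Sib

section
variable {m : ℕ}

noncomputable def p0 (m : ℕ) : Polynomial ℂ := qp m (fun _ => 0)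

theorem p0_eval (m : ℕ) (z : ℂ) : (p0 m).eval z = z ^ m := by simp [p0, qp_eval, Ppoly]

theorem inv_le_jj (hm : 3 ≤ m) {δ ρ x : ℝ} (hδ : 0 < δ) (hρ : 0 ≤ ρ) (hx : 0 ≤ x) (h : δ * (1 + x) ^ m ≤ ρ ^ 2) :
    0 < ρ ∧ 1 / ρ ≤ 1 / Real.sqrt δ * jj x := by
  have hX : 1 ≤ 1 + x := by linarith
  have hρ0 : 0 < ρ := by
    rcases hρ.lt_or_eq with h1 | h1
    · exact h1
    · rw [← h1] at h
      have : 0 < δ * (1 + x) ^ m := by positivity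
      norm_num at h; linarith
  refine ⟨hρ0, ?_⟩
  have h1 : ((1 + x) ^ (5/4 : ℝ)) ^ 2 ≤ (1 + x) ^ m := by
    rw [← Real.rpow_natCast, ← Real.rpow_mul (by linarith), ← Real.rpow_natCast]
    apply Real.rpow_le_rpow_of_exponent_le hX
    have : (3:ℝ) ≤ m := by exact_mod_cast hm
    norm_num; linarith
  have h2 : Real.sqrt δ * (1 + x) ^ (5/4 : ℝ) ≤ ρ := by
    apply le_of_sq_le_sq _ hρ
    rw [mul_pow, Real.sq_sqrt hδ.le]
    exact (mul_le_mul_of_nonneg_left h1 hδ.le).trans h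
  have hs := Real.sqrt_pos.2 hδ
  rw [jj, Real.rpow_neg (by linarith), ← one_div, div_mul_div_comm, one_mul]
  exact one_div_le_one_div_of_le (by positivity) h2

theorem sec0 {c μ x : ℝ} (hc : 0 < c) (hc1 : c ≤ 1) (hμ : 0 < μ) (hμ1 : μ ≤ 1) (hx : 0 ≤ x) {lam : ℂ} (hl : lam ∈ Sec c μ) :
    (c * μ / (8 * 2 ^ m)) * (1 + x) ^ m ≤ (RR (p0 m) lam x).re ^ 2 := by
  have h1 := RR_re_sq (p0 m) lam x
  have h2 := cone_add (s := x ^ m) hc1 (by positivity) hl.2.le hc.le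
  rw [p0_eval, add_comm ((x:ℂ)^m)] at h1
  rw [Complex.ofReal_pow] at h2
  have h3 : (1 + x) ^ m ≤ 2 ^ m * (1 + x ^ m) := by
    rcases le_total x 1 with h | h
    · calc (1 + x) ^ m ≤ 2 ^ m := pow_le_pow_left₀ (by linarith) (by linarith) _
        _ ≤ _ := le_mul_of_one_le_right (by positivity) (by linarith [pow_nonneg hx m])
    · calc (1 + x) ^ m ≤ (2 * x) ^ m := pow_le_pow_left₀ (by linarith) (by linarith) _
        _ = 2 ^ m * x ^ m := mul_pow _ _ _
        _ ≤ _ := by gcongr; linarith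
  have h4 : μ * (1 + x ^ m) ≤ ‖lam‖ + x ^ m := by
    have := hl.1; have := pow_nonneg hx m; nlinarith
  have h5 : (c * μ / (8 * 2 ^ m)) * (1 + x) ^ m ≤ c / 8 * (μ * (1 + x ^ m)) := by
    rw [div_mul_eq_mul_div, div_le_iff₀ (by positivity)]
    calc c * μ * (1 + x) ^ m ≤ c * μ * (2 ^ m * (1 + x ^ m)) := by gcongr
      _ = _ := by ring
  have h6 : c / 8 * (μ * (1 + x ^ m)) ≤ c / 8 * (‖lam‖ + x ^ m) := by gcongr
  linarith

theorem RR_lam_deriv {p : Polynomial ℂ} {lam w : ℂ} (h : p.eval w + lam ∈ slitPlane) :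
    HasDerivAt (fun l => RR p l w) (1 / (2 * RR p lam w)) lam := by
  have h1 : HasDerivAt (fun l : ℂ => p.eval w + l) 1 lam := (hasDerivAt_id lam).const_add _
  have h2 := h1.cpow_const (c := (1/2 : ℂ)) h
  have e : (fun l => RR p l w) = fun l => (p.eval w + l) ^ (1/2 : ℂ) := funext fun l => RR_eq p l w
  rw [e]
  refine h2.congr_deriv ?_
  have h3 := RR_ne h
  have h4 := RR_sq p lam w
  have h5 := slitPlane_ne_zero h
  rw [Complex.cpow_sub _ _ h5, Complex.cpow_one, ← RR_eq, ← h4]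
  field_simp

theorem exists_Sec {lam : ℂ} (h : lam ∈ slitPlane) : ∃ c μ : ℝ, 0 < c ∧ c ≤ 1 ∧ 0 < μ ∧ μ ≤ 1 ∧ lam ∈ Sec c μ := by
  have h1 := pos_of_slit h
  have h2 : 0 < ‖lam‖ := norm_pos_iff.2 (slitPlane_ne_zero h)
  have h3 : lam.re ≤ ‖lam‖ := Complex.re_le_norm lam
  refine ⟨(‖lam‖ + lam.re) / (2 * ‖lam‖) / 2, min 1 (‖lam‖ / 2), by positivity, ?_, by positivity, min_le_left _ _, ?_, ?_⟩
  · rw [div_div, div_le_one (by positivity)]; linarith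
  · exact (min_le_right _ _).trans_lt (by linarith)
  · have : (‖lam‖ + lam.re) / (2 * ‖lam‖) / 2 * ‖lam‖ = (‖lam‖ + lam.re) / 4 := by field_simp; ring
    rw [this]; linarith

/-- the model integral -/
noncomputable def NN (m : ℕ) (lam : ℂ) : ℂ := ∫ x in Ioi (0:ℝ), dR (p0 m) 0 lam x

theorem RR_meas (p : Polynomial ℂ) (lam : ℂ) : Measurable fun x : ℝ => RR p lam x := by
  simp only [RR_eq]
  have : Measurable fun x : ℝ => p.eval (x:ℂ) + lam := by
    have : Continuous fun x : ℝ => p.eval (x:ℂ) + lam := by fun_prop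
    exact this.measurable
  exact this.pow_const _

theorem RR_zero_nn (m : ℕ) {x : ℝ} (hx : 0 ≤ x) : RR (p0 m) 0 x = (Real.sqrt (x ^ m) : ℝ) := by
  rw [RR_eq, p0_eval, add_zero, Real.sqrt_eq_rpow, Complex.ofReal_cpow (by positivity)]
  norm_num

theorem sec0_slit {c μ x : ℝ} (hc : 0 < c) (hc1 : c ≤ 1) (hμ : 0 < μ) (hμ1 : μ ≤ 1) (hx : 0 ≤ x) {lam : ℂ} (hl : lam ∈ Sec c μ) :
    (p0 m).eval (x:ℂ) + lam ∈ slitPlane := by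
  have h1 := sec0 (m := m) hc hc1 hμ hμ1 hx hl
  have h2 := RR_re_sq (p0 m) lam x
  apply slit_of_pos
  have : 0 < c * μ / (8 * 2 ^ m) * (1 + x) ^ m := by positivity
  linarith

theorem sec0_inv (hm : 3 ≤ m) {c μ x : ℝ} (hc : 0 < c) (hc1 : c ≤ 1) (hμ : 0 < μ) (hμ1 : μ ≤ 1) (hx : 0 ≤ x) {lam : ℂ} (hl : lam ∈ Sec c μ) :
    0 < (RR (p0 m) lam x).re ∧ 1 / (RR (p0 m) lam x).re ≤ 1 / Real.sqrt (c * μ / (8 * 2 ^ m)) * jj x :=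
  inv_le_jj hm (by positivity) (RR_re_nonneg _ _ _) hx (sec0 (m := m) hc hc1 hμ hμ1 hx hl)

theorem NN_int (hm : 3 ≤ m) {lam : ℂ} (h : lam ∈ slitPlane) : IntegrableOn (fun x : ℝ => dR (p0 m) 0 lam x) (Ioi 0) := by
  obtain ⟨c, μ, hc, hc1, hμ, hμ1, hl⟩ := exists_Sec h
  refine Integrable.mono' (g := fun x => ‖lam‖ * (1 / Real.sqrt (c * μ / (8 * 2 ^ m)) * jj x))
    ((jj_int.1.const_mul _).const_mul _) ((RR_meas _ _).sub (RR_meas _ _)).aestronglyMeasurable ?_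
  filter_upwards [ae_restrict_mem measurableSet_Ioi] with x hx
  have hx0 : (0:ℝ) ≤ x := le_of_lt hx
  obtain ⟨h1, h2⟩ := sec0_inv hm hc hc1 hμ hμ1 hx0 hl
  have h3 := RR_sub_le (p0 m) (l1 := 0) h1
  rw [dR, norm_sub_rev]
  refine h3.trans ?_
  rw [zero_sub, norm_neg, div_eq_mul_one_div]
  gcongr

theorem NN_deriv (hm : 3 ≤ m) {lam : ℂ} (h : lam ∈ slitPlane) :
    HasDerivAt (NN m) (∫ x in Ioi (0:ℝ), 1 / (2 * RR (p0 m) lam x)) lam := by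
  obtain ⟨c, μ, hc, hc1, hμ, hμ1, hl⟩ := exists_Sec h
  refine (hasDerivAt_integral_of_dominated_loc_of_deriv_le (s := Sec c μ)
    (F := fun l (x:ℝ) => dR (p0 m) 0 l x) (F' := fun l (x:ℝ) => 1 / (2 * RR (p0 m) l x))
    (bound := fun x => 1 / Real.sqrt (c * μ / (8 * 2 ^ m)) * jj x) ((Sec_open c μ).mem_nhds hl)
    (Eventually.of_forall fun l => ((RR_meas _ _).sub (RR_meas _ _)).aestronglyMeasurable) (NN_int hm h)
    ?_ ?_ (jj_int.1.const_mul _) ?_).2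
  · exact (((RR_meas _ _).const_mul 2).const_div 1).aestronglyMeasurable
  · filter_upwards [ae_restrict_mem measurableSet_Ioi] with x hx l hl
    have hx0 : (0:ℝ) ≤ x := le_of_lt hx
    obtain ⟨h1, h2⟩ := sec0_inv hm hc hc1 hμ hμ1 hx0 hl
    refine le_trans ?_ h2
    rw [norm_div, norm_mul, norm_one, Complex.norm_ofNat]
    apply one_div_le_one_div_of_le h1
    have := Complex.re_le_norm (RR (p0 m) l x)
    linarith
  · filter_upwards [ae_restrict_mem measurableSet_Ioi] with x hx l hl
    exact (RR_lam_deriv (sec0_slit hc hc1 hμ hμ1 (le_of_lt hx) hl)).sub_const _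

noncomputable def al (m : ℕ) : ℝ := ((m:ℝ) + 2) / (2 * m)

theorem sqrt_mul_real {t : ℝ} (ht : 0 < t) (z : ℂ) : ((t:ℂ) * z) ^ (1/2 : ℂ) = (Real.sqrt t : ℝ) * z ^ (1/2 : ℂ) := by
  by_cases hz : z = 0
  · simp [hz]
  · rw [real_mul_cpow ht hz, Real.sqrt_eq_rpow, Complex.ofReal_cpow ht.le]; norm_num

theorem NN_scale (hm : 3 ≤ m) (lam : ℂ) {t : ℝ} (ht : 0 < t) : NN m ((t ^ m : ℝ) * lam) = (Real.sqrt (t ^ m) * t : ℝ) * NN m lam := by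
  have e : ∀ x : ℝ, dR (p0 m) 0 ((t ^ m : ℝ) * lam) (t * x : ℝ) = (Real.sqrt (t ^ m) : ℝ) * dR (p0 m) 0 lam x := by
    intro x
    have htm : 0 < t ^ m := by positivity
    rw [dR, dR, RR_eq, RR_eq, RR_eq, RR_eq, mul_sub, ← sqrt_mul_real htm, ← sqrt_mul_real htm, p0_eval, p0_eval]
    push_cast
    congr 2 <;> ring
  have h := integral_comp_mul_left_Ioi (fun x : ℝ => dR (p0 m) 0 ((t ^ m : ℝ) * lam) x) 0 ht
  simp only [e, mul_zero] at h
  rw [integral_const_mul] at h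
  rw [NN, NN, Complex.ofReal_mul]
  rw [mul_comm ((Real.sqrt (t ^ m) : ℝ) : ℂ), mul_assoc, h, Complex.real_smul, ← mul_assoc, Complex.ofReal_inv]
  have : (t:ℂ) ≠ 0 := by exact_mod_cast ht.ne'
  field_simp

theorem NN_hom (hm : 3 ≤ m) (lam : ℂ) {s : ℝ} (hs : 0 < s) : NN m (s * lam) = (s ^ al m : ℝ) * NN m lam := by
  have hm0 : (m:ℝ) ≠ 0 := by positivity
  set t := s ^ (1 / (m:ℝ)) with ht
  have ht0 : 0 < t := by positivity
  have htm : t ^ m = s := by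
    rw [ht, ← Real.rpow_natCast, ← Real.rpow_mul hs.le, one_div, inv_mul_cancel₀ hm0, Real.rpow_one]
  have := NN_scale hm lam ht0
  rw [htm] at this
  rw [this, Real.sqrt_eq_rpow, ht, ← Real.rpow_add hs, al]
  congr 3
  field_simp

theorem NN_euler (hm : 3 ≤ m) {lam : ℂ} (h : lam ∈ slitPlane) : lam * deriv (NN m) lam = al m * NN m lam := by
  have h1 : HasDerivAt (fun s : ℝ => NN m (s * lam)) (lam * deriv (NN m) lam) 1 := by
    have hd := (NN_deriv hm h).differentiableAt.hasDerivAt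
    have hl : HasDerivAt (fun s : ℝ => (s:ℂ) * lam) lam 1 := by
      simpa using (Complex.ofRealCLM.hasDerivAt (x := (1:ℝ))).mul_const lam
    have : HasDerivAt (NN m) (deriv (NN m) lam) (((1:ℝ):ℂ) * lam) := by simpa using hd
    have h5 := this.scomp (1:ℝ) hl
    rw [smul_eq_mul] at h5
    exact h5
  have h2 : HasDerivAt (fun s : ℝ => ((s ^ al m : ℝ) : ℂ) * NN m lam) (al m * NN m lam) 1 := by
    have := (Real.hasDerivAt_rpow_const (x := 1) (p := al m) (Or.inl one_ne_zero)).ofReal_comp.mul_const (NN m lam)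
    refine this.congr_deriv ?_
    simp
  have h3 : (fun s : ℝ => NN m (s * lam)) =ᶠ[nhds 1] fun s : ℝ => ((s ^ al m : ℝ) : ℂ) * NN m lam := by
    filter_upwards [lt_mem_nhds (zero_lt_one (α := ℝ))] with s hs
    exact NN_hom hm lam hs
  exact h1.unique (h2.congr_of_eventuallyEq h3)

theorem NN_eq (hm : 3 ≤ m) {lam : ℂ} (h : lam ∈ slitPlane) : NN m lam = NN m 1 * lam ^ (al m : ℂ) := by
  have hd : ∀ l ∈ slitPlane, HasDerivAt (fun l => NN m l * l ^ (-(al m : ℂ))) 0 l := by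
    intro l hl
    have h1 := (NN_deriv hm hl).differentiableAt.hasDerivAt
    have h2 := (hasDerivAt_id l).cpow_const (c := -(al m : ℂ)) hl
    refine (h1.mul h2).congr_deriv ?_
    have h3 := NN_euler hm hl
    have h0 := slitPlane_ne_zero hl
    simp only [id]
    rw [Complex.cpow_sub _ _ h0, Complex.cpow_one]
    field_simp
    linear_combination (l ^ (-(al m:ℂ))) * h3
  have hpc : IsPreconnected slitPlane := starConvex_one_slitPlane.isPathConnected one_mem_slitPlane |>.isConnected.isPreconnected
  have := isOpen_slitPlane.is_const_of_deriv_eq_zero hpc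
    (fun l hl => (hd l hl).differentiableAt.differentiableWithinAt) (fun l hl => (hd l hl).deriv) h one_mem_slitPlane
  simp only [Complex.one_cpow, mul_one] at this
  rw [← this, mul_assoc, ← Complex.cpow_add _ _ (slitPlane_ne_zero h)]
  simp

end

end Sib


namespace Sib

section
variable {m : ℕ}

theorem one_add_pow_le (m : ℕ) {x : ℝ} (hx : 0 ≤ x) : (1 + x) ^ m ≤ 2 ^ m * (1 + x ^ m) := by
  rcases le_total x 1 with h | h
  · calc (1 + x) ^ m ≤ 2 ^ m := pow_le_pow_left₀ (by linarith) (by linarith) _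
      _ ≤ _ := le_mul_of_one_le_right (by positivity) (by linarith [pow_nonneg hx m])
  · calc (1 + x) ^ m ≤ (2 * x) ^ m := pow_le_pow_left₀ (by linarith) (by linarith) _
      _ = 2 ^ m * x ^ m := mul_pow _ _ _
      _ ≤ _ := by gcongr; linarith

noncomputable def JJ (m : ℕ) : ℝ := ∫ x in Ioi (0:ℝ), (1 / (1 + x ^ m)) ^ (1/2 : ℝ)

theorem JJ_int (hm : 3 ≤ m) : IntegrableOn (fun x : ℝ => (1 / (1 + x ^ m)) ^ (1/2 : ℝ)) (Ioi 0) := by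
  refine Integrable.mono' (g := fun x => 1 / Real.sqrt (1 / 2 ^ m) * jj x) (jj_int.1.const_mul _) ?_ ?_
  · have : Measurable fun x : ℝ => (1 / (1 + x ^ m)) ^ (1/2 : ℝ) := by fun_prop
    exact this.aestronglyMeasurable
  · filter_upwards [ae_restrict_mem measurableSet_Ioi] with x hx
    have hx0 : (0:ℝ) ≤ x := le_of_lt hx
    have h1 : (0:ℝ) < 1 + x ^ m := by positivity
    have h2 := inv_le_jj hm (δ := 1 / 2 ^ m) (ρ := Real.sqrt (1 + x ^ m)) (by positivity) (Real.sqrt_nonneg _) hx0 (by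
      rw [Real.sq_sqrt h1.le, div_mul_eq_mul_div, one_mul, div_le_iff₀ (by positivity), mul_comm]
      exact one_add_pow_le m hx0)
    rw [Real.norm_of_nonneg (by positivity), ← Real.sqrt_eq_rpow, Real.sqrt_div zero_le_one, Real.sqrt_one]
    exact h2.2

theorem JJ_eq (hm : 3 ≤ m) : JJ m * Real.Gamma (1/2) = Real.Gamma (1/2 - 1/m) * Real.Gamma (1/m + 1) := by
  have hm3 : (3:ℝ) ≤ m := by exact_mod_cast hm
  have hm0 : (0:ℝ) < m := by linarith
  let f : ℝ → ℝ → ℝ := fun x t => t ^ ((1/2 : ℝ) - 1) * Real.exp (-((1 + x ^ m) * t))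
  have hG : 0 < Real.Gamma (1/2) := Real.Gamma_pos_of_pos (by norm_num)
  have hin : ∀ x : ℝ, 0 < x → ∫ t in Ioi 0, f x t = (1 / (1 + x ^ m)) ^ (1/2 : ℝ) * Real.Gamma (1/2) := by
    intro x hx
    exact Real.integral_rpow_mul_exp_neg_mul_Ioi (by norm_num) (by positivity)
  have hnn : ∀ x, ∀ t ∈ Ioi (0:ℝ), 0 ≤ f x t := by
    intro x t ht
    have : (0:ℝ) ≤ t := le_of_lt ht
    positivity
  have hI : Integrable (Function.uncurry f) ((volume.restrict (Ioi (0:ℝ))).prod (volume.restrict (Ioi (0:ℝ)))) := by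
    have hmeas : Measurable (Function.uncurry f) := by
      simp only [f, Function.uncurry_def]; fun_prop
    rw [integrable_prod_iff hmeas.aestronglyMeasurable]
    constructor
    · filter_upwards [ae_restrict_mem measurableSet_Ioi] with x hx
      by_contra h
      have h1 := integral_undef h
      have h2 := hin x hx
      simp only [Function.uncurry] at h1
      rw [h1] at h2
      have : (0:ℝ) < x := hx
      have : 0 < (1 / (1 + x ^ m)) ^ (1/2 : ℝ) * Real.Gamma (1/2) := by positivity
      linarith
    · refine ((JJ_int hm).mul_const (Real.Gamma (1/2))).congr ?_
      filter_upwards [ae_restrict_mem measurableSet_Ioi] with x hx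
      rw [← hin x hx]
      refine setIntegral_congr_fun measurableSet_Ioi fun t ht => ?_
      simp only [Function.uncurry]
      rw [Real.norm_of_nonneg (hnn x t ht)]
  have hs := integral_integral_swap hI
  have h1 : ∫ x in Ioi (0:ℝ), ∫ t in Ioi (0:ℝ), f x t = JJ m * Real.Gamma (1/2) := by
    rw [JJ, ← integral_mul_const]
    exact setIntegral_congr_fun measurableSet_Ioi fun x hx => hin x hx
  have h2 : ∫ t in Ioi (0:ℝ), ∫ x in Ioi (0:ℝ), f x t = Real.Gamma (1/2 - 1/m) * Real.Gamma (1/m + 1) := by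
    rw [Real.Gamma_eq_integral (s := 1/2 - 1/m) (by
      rw [sub_pos]; exact one_div_lt_one_div_of_lt (by norm_num) (by linarith)), ← integral_mul_const]
    refine setIntegral_congr_fun measurableSet_Ioi fun t ht => ?_
    have ht0 : (0:ℝ) < t := ht
    have e : ∀ x : ℝ, f x t = t ^ ((1/2 : ℝ) - 1) * Real.exp (-t) * Real.exp (-t * x ^ (m:ℝ)) := by
      intro x
      simp only [f]
      rw [mul_assoc, ← Real.exp_add, Real.rpow_natCast]
      ring_nf
    simp only [e]
    rw [integral_const_mul, integral_exp_neg_mul_rpow hm0 ht0, ← mul_assoc]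
    congr 1
    rw [show ((1:ℝ)/2 - 1/m - 1) = (1/2 - 1) + (-1/m) by ring, Real.rpow_add ht0]
    ring
  rw [← h1, ← h2]; exact hs

/-- the constant -/
noncomputable def KK (m : ℕ) : ℝ := JJ m / (2 * al m)

theorem al_eq (hm : 3 ≤ m) : al m = 1/2 + 1/m := by
  have : (m:ℝ) ≠ 0 := by positivity
  rw [al]; field_simp

theorem al_pos (hm : 3 ≤ m) : 0 < al m := by
  rw [al_eq hm]; positivity

theorem KK_eq (hm : 3 ≤ m) : KK m = Real.sqrt π * Real.Gamma (1 + 1/m) / (2 * Real.cos (π/m) * Real.Gamma (3/2 + 1/m)) := by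
  have h := JJ_eq hm
  have hm3 : (3:ℝ) ≤ m := by exact_mod_cast hm
  have hm0 : (0:ℝ) < m := by linarith
  have h1 := Real.Gamma_mul_Gamma_one_sub (1/2 + 1/(m:ℝ))
  have h2 := Real.Gamma_add_one (s := 1/2 + 1/(m:ℝ)) (by positivity)
  rw [show (1/2 + 1/(m:ℝ) + 1) = 3/2 + 1/m by ring] at h2
  rw [show 1 - (1/2 + 1/(m:ℝ)) = 1/2 - 1/m by ring, show π * (1/2 + 1/(m:ℝ)) = π/m + π/2 by ring, Real.sin_add_pi_div_two] at h1
  have hc : 0 < Real.cos (π/m) := by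
    apply Real.cos_pos_of_mem_Ioo
    have := Real.pi_pos
    constructor
    · have : 0 < π / m := by positivity
      linarith
    · exact div_lt_div_of_pos_left Real.pi_pos (by norm_num) (by linarith)
  have g1 : 0 < Real.Gamma (1/2 + 1/(m:ℝ)) := Real.Gamma_pos_of_pos (by positivity)
  have hs : 0 < Real.sqrt π := by positivity
  have hss : Real.sqrt π * Real.sqrt π = π := Real.mul_self_sqrt Real.pi_pos.le
  rw [Real.Gamma_one_half_eq] at h
  rw [h2, KK, al_eq hm]
  have hal : (0:ℝ) < 1/2 + 1/m := by positivity
  rw [add_comm (1:ℝ) (1/m)]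
  have h4 : Real.Gamma (1/2 - 1/(m:ℝ)) = π / (Real.cos (π/m) * Real.Gamma (1/2 + 1/m)) := by
    rw [eq_div_iff (by positivity)]
    rw [eq_div_iff hc.ne'] at h1
    linear_combination h1
  rw [h4] at h
  have h5 : JJ m = Real.sqrt π / (Real.cos (π/m) * Real.Gamma (1/2 + 1/m)) * Real.Gamma (1/m + 1) := by
    have : JJ m * Real.sqrt π = (Real.sqrt π / (Real.cos (π/m) * Real.Gamma (1/2 + 1/m)) * Real.Gamma (1/m + 1)) * Real.sqrt π := by
      rw [h]; linear_combination (-(Real.Gamma (1/m + 1) / (Real.cos (π/m) * Real.Gamma (1/2 + 1/m)))) * hss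
    exact mul_right_cancel₀ hs.ne' this
  rw [h5]
  generalize Real.Gamma (1/2 + 1/(m:ℝ)) = G at *
  generalize Real.Gamma (1/(m:ℝ) + 1) = G' at *
  generalize Real.cos (π/m) = C at *
  generalize (1/2 + 1/(m:ℝ)) = A at *
  field_simp

theorem trig_pos (hm : 3 ≤ m) : 0 < Real.cos (π/m) ∧ 0 < Real.sin (π/m) ∧ 0 < Real.sin (2*π/m) := by
  have hm3 : (3:ℝ) ≤ m := by exact_mod_cast hm
  have hm0 : (0:ℝ) < m := by linarith
  have h1 : 0 < π / m := by positivity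
  have h2 : π / m < π / 2 := div_lt_div_of_pos_left Real.pi_pos (by norm_num) (by linarith)
  have := Real.pi_pos
  have hc : 0 < Real.cos (π/m) := Real.cos_pos_of_mem_Ioo ⟨by linarith, h2⟩
  have hs : 0 < Real.sin (π/m) := Real.sin_pos_of_pos_of_lt_pi h1 (by linarith)
  refine ⟨hc, hs, ?_⟩
  rw [mul_div_assoc, Real.sin_two_mul]; positivity

theorem KK_pos (hm : 3 ≤ m) : 0 < KK m := by
  rw [KK_eq hm]
  have g1 : 0 < Real.Gamma (1 + 1/(m:ℝ)) := Real.Gamma_pos_of_pos (by positivity)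
  have g2 : 0 < Real.Gamma (3/2 + 1/(m:ℝ)) := Real.Gamma_pos_of_pos (by positivity)
  have := (trig_pos hm).1
  positivity

theorem KK_final (hm : 3 ≤ m) : π / (KK m * Real.sin (2*π/m)) =
    Real.Gamma (3/2 + 1/m) * Real.sqrt π / (Real.sin (π/m) * Real.Gamma (1 + 1/m)) := by
  rw [KK_eq hm]
  have g1 : 0 < Real.Gamma (1 + 1/(m:ℝ)) := Real.Gamma_pos_of_pos (by positivity)
  have g2 : 0 < Real.Gamma (3/2 + 1/(m:ℝ)) := Real.Gamma_pos_of_pos (by positivity)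
  obtain ⟨hc, hs, -⟩ := trig_pos hm
  rw [mul_div_assoc 2, Real.sin_two_mul]
  have hp : 0 < Real.sqrt π := by positivity
  have hss : Real.sqrt π * Real.sqrt π = π := Real.mul_self_sqrt Real.pi_pos.le
  rw [div_eq_div_iff (by positivity) (by positivity)]
  have : ∀ G G' C S q p : ℝ, G' ≠ 0 → C ≠ 0 → q * q = p → p * (S * G) = G' * q * (q * G / (2 * C * G') * (2 * S * C)) := by
    intro G G' C S q p h1 h2 h3
    rw [← h3]; field_simp
  exact this _ _ _ _ _ _ g2.ne' hc.ne' hss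

theorem NN_one (hm : 3 ≤ m) : NN m 1 = KK m := by
  have h := NN_euler hm one_mem_slitPlane
  rw [(NN_deriv hm one_mem_slitPlane).deriv, one_mul] at h
  have e : ∫ x in Ioi (0:ℝ), 1 / (2 * RR (p0 m) 1 x) = ((1/2 * JJ m : ℝ) : ℂ) := by
    rw [JJ, ← integral_const_mul, ← integral_complex_ofReal]
    refine setIntegral_congr_fun measurableSet_Ioi fun x hx => ?_
    have hx0 : (0:ℝ) < x := hx
    have h1 : (0:ℝ) < 1 + x ^ m := by positivity
    have : RR (p0 m) 1 x = (Real.sqrt (1 + x ^ m) : ℝ) := by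
      rw [RR_eq, p0_eval, Real.sqrt_eq_rpow, Complex.ofReal_cpow h1.le]
      push_cast; rw [add_comm]
    simp only [this]
    rw [← Real.sqrt_eq_rpow, Real.sqrt_div zero_le_one, Real.sqrt_one]
    have h2 : 0 < Real.sqrt (1 + x ^ m) := Real.sqrt_pos.2 h1
    simp only [Complex.ofReal_mul, Complex.ofReal_div, Complex.ofReal_one, Complex.ofReal_ofNat, RCLike.ofReal_mul, RCLike.ofReal_div]
    norm_num
    ring
  rw [e] at h
  have ha := al_pos hm
  rw [KK]
  have ha' : (al m : ℂ) ≠ 0 := by exact_mod_cast ha.ne'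
  apply mul_left_cancel₀ ha'
  rw [← h]
  push_cast
  field_simp

end

end Sib


namespace Sib

section
variable {m : ℕ} {p : Polynomial ℂ} {A c0 : ℝ} {l0 : ℂ}

theorem cmp_abs {R S R0 S0 P l : ℂ} {Q δ E : ℝ} (hQ : 0 < Q) (hδ : 0 < δ) (h1 : R ^ 2 - S ^ 2 = P) (h2 : R0 ^ 2 - S0 ^ 2 = P + l)
    (h3 : δ * Q ≤ (R + S).re) (h4 : δ * Q ≤ (R0 + S0).re) (h5 : ‖R - R0‖ ≤ E / Q) (h6 : ‖S - S0‖ ≤ E / Q) :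
    ‖(R - R0) - (S - S0)‖ ≤ ‖P‖ * (2 / (δ * Q)) + ‖l‖ / (δ * Q) ∧
    ‖(R - R0) - (S - S0)‖ ≤ ‖P‖ * (2 * E / (δ ^ 2 * Q ^ 3)) + ‖l‖ / (δ * Q) := by
  have hp : 0 < δ * Q := by positivity
  have n3 : δ * Q ≤ ‖R + S‖ := h3.trans (Complex.re_le_norm _)
  have n4 : δ * Q ≤ ‖R0 + S0‖ := h4.trans (Complex.re_le_norm _)
  have z3 : R + S ≠ 0 := norm_pos_iff.1 (hp.trans_le n3)
  have z4 : R0 + S0 ≠ 0 := norm_pos_iff.1 (hp.trans_le n4)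
  have e : (R - R0) - (S - S0) = P * (1 / (R + S) - 1 / (R0 + S0)) - l / (R0 + S0) := by
    have e1 : R - S = P / (R + S) := by rw [eq_div_iff z3, ← h1]; ring
    have e2 : R0 - S0 = (P + l) / (R0 + S0) := by rw [eq_div_iff z4, ← h2]; ring
    calc _ = (R - S) - (R0 - S0) := by ring
      _ = _ := by rw [e1, e2]; ring
  have hl : ‖l / (R0 + S0)‖ ≤ ‖l‖ / (δ * Q) := by
    rw [norm_div]; exact div_le_div_of_nonneg_left (norm_nonneg _) hp n4
  have key : ∀ B : ℝ, ‖1 / (R + S) - 1 / (R0 + S0)‖ ≤ B → ‖(R - R0) - (S - S0)‖ ≤ ‖P‖ * B + ‖l‖ / (δ * Q) := by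
    intro B hB
    rw [e]
    refine (norm_sub_le _ _).trans ?_
    rw [norm_mul]
    gcongr
  constructor
  · apply key
    refine (norm_sub_le _ _).trans ?_
    rw [norm_div, norm_div, norm_one]
    have a1 := one_div_le_one_div_of_le hp n3
    have a2 := one_div_le_one_div_of_le hp n4
    have : 2 / (δ * Q) = 1 / (δ * Q) + 1 / (δ * Q) := by ring
    linarith
  · apply key
    rw [div_sub_div _ _ z3 z4, norm_div, norm_mul]
    have e3 : 1 * (R0 + S0) - (R + S) * 1 = -(R - R0) - (S - S0) := by ring
    have e4 : 2 * E / (δ ^ 2 * Q ^ 3) = (E / Q + E / Q) / (δ * Q * (δ * Q)) := by field_simp; ring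
    rw [e3, e4]
    have b : ‖-(R - R0) - (S - S0)‖ ≤ E / Q + E / Q := by
      refine (norm_sub_le _ _).trans ?_
      rw [norm_neg]; linarith
    exact div_le_div₀ ((norm_nonneg _).trans b) b (by positivity) (mul_le_mul n3 n4 hp.le (norm_nonneg _))

noncomputable def tt (m : ℕ) : ℝ := 1/2 + 1/(2*m)

theorem young1 (hm : 3 ≤ m) {X L : ℝ} (hX : 1 ≤ X) (h : X ^ m ≤ L) :
    Real.sqrt (X ^ m) / X ≤ L ^ tt m * X ^ (-(5/4) : ℝ) := by
  have hX0 : 0 < X := by linarith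
  have hm0 : (0:ℝ) < m := by positivity
  have h1 : X ^ ((m:ℝ) * tt m) ≤ L ^ tt m := by
    rw [Real.rpow_mul hX0.le, Real.rpow_natCast]
    exact Real.rpow_le_rpow (by positivity) h (by unfold tt; positivity)
  have h2 : Real.sqrt (X ^ m) / X = X ^ ((m:ℝ)/2 - 1) := by
    rw [Real.rpow_sub hX0, Real.rpow_one, Real.sqrt_eq_rpow, ← Real.rpow_natCast, ← Real.rpow_mul hX0.le]
    ring_nf
  rw [h2]
  calc X ^ ((m:ℝ)/2 - 1) ≤ X ^ ((m:ℝ) * tt m + (-(5/4))) := by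
        apply Real.rpow_le_rpow_of_exponent_le hX
        have : (m:ℝ) * tt m = m/2 + 1/2 := by unfold tt; field_simp
        rw [this]; linarith
    _ = X ^ ((m:ℝ) * tt m) * X ^ (-(5/4) : ℝ) := Real.rpow_add hX0 _ _
    _ ≤ _ := by gcongr

theorem young2 (hm : 3 ≤ m) {X L : ℝ} (hX : 1 ≤ X) (hL : 0 < L) (h : L ≤ X ^ m) :
    L / (Real.sqrt (X ^ m) * X) ≤ L ^ tt m * X ^ (-(5/4) : ℝ) := by
  have hX0 : 0 < X := by linarith
  have hm3 : (3:ℝ) ≤ m := by exact_mod_cast hm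
  have hm0 : (0:ℝ) < m := by positivity
  have ht : tt m ≤ 1 := by
    have : 1 / (2 * (m:ℝ)) ≤ 1 / 2 := one_div_le_one_div_of_le (by norm_num) (by linarith)
    unfold tt; linarith
  have h1 : L ^ (1 - tt m) ≤ X ^ ((m:ℝ) * (1 - tt m)) := by
    rw [Real.rpow_mul hX0.le, Real.rpow_natCast]
    exact Real.rpow_le_rpow hL.le h (by linarith)
  have h2 : Real.sqrt (X ^ m) * X = X ^ ((m:ℝ)/2 + 1) := by
    rw [Real.rpow_add hX0, Real.rpow_one, Real.sqrt_eq_rpow, ← Real.rpow_natCast, ← Real.rpow_mul hX0.le]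
    ring_nf
  have h3 : L = L ^ tt m * L ^ (1 - tt m) := by rw [← Real.rpow_add hL]; simp
  rw [h2, div_le_iff₀ (by positivity), mul_assoc, ← Real.rpow_add hX0]
  conv_lhs => rw [h3]
  gcongr
  refine h1.trans (Real.rpow_le_rpow_of_exponent_le hX ?_)
  have : (m:ℝ) * (1 - tt m) = m/2 - 1/2 := by unfold tt; field_simp; ring
  rw [this]; linarith

theorem le_of_sq' {δ Q r : ℝ} (hδ : 0 ≤ δ) (hr : 0 ≤ r) (h : δ ^ 2 * Q ^ 2 ≤ r ^ 2) : δ * Q ≤ r := by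
  apply le_of_sq_le_sq _ hr; rwa [mul_pow]

theorem cmp_pt (hB : Bas m p A c0 l0) {c : ℝ} (hc : 0 < c) (hc1 : c ≤ 1) : ∃ Λ C : ℝ, 1 ≤ Λ ∧ 0 < C ∧ ∀ lam ∈ Sec c Λ, ∀ x : ℝ, 0 ≤ x →
    ‖dR p l0 lam x - dR (p0 m) 0 lam x‖ ≤ C * ‖lam‖ ^ tt m * jj x := by
  have hm := hB.pb.hm
  obtain ⟨Λ, C, c', hΛ, hC, hc', H⟩ := sec_ln hB.pb hc hc1
  obtain ⟨δ, hδ, d1, d2, d3⟩ : ∃ δ : ℝ, 0 < δ ∧ δ ^ 2 ≤ c0 / 2 ∧ δ ^ 2 ≤ c' / 2 ∧ δ ^ 2 ≤ c * 1 / (8 * 2 ^ m) := by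
    have := hB.c0p
    refine ⟨Real.sqrt (min (c0/2) (min (c'/2) (c * 1 / (8 * 2 ^ m)))), by positivity, ?_⟩
    rw [Real.sq_sqrt (by positivity)]
    exact ⟨min_le_left _ _, (min_le_right _ _).trans (min_le_left _ _), (min_le_right _ _).trans (min_le_right _ _)⟩
  have hA := hB.pb.A1
  refine ⟨Λ, 2 * A / δ + 2 * A * (1 + ‖l0‖) / δ ^ 3 + ‖l0‖ / δ, hΛ, by positivity, fun lam hl x hx => ?_⟩
  have hg := (H lam hl 0 le_rfl).1 x hx
  have hL : 1 ≤ ‖lam‖ := hΛ.trans hl.1.le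
  have hL0 : 0 < ‖lam‖ := by linarith
  set X := 1 + x with hXd
  have hX : 1 ≤ X := by linarith
  set Q := Real.sqrt (X ^ m) with hQd
  have hQ : 0 < Q := by positivity
  have hQ2 : Q ^ 2 = X ^ m := Real.sq_sqrt (by positivity)
  have nx : ‖(x:ℂ)‖ = x := by rw [Complex.norm_real, Real.norm_of_nonneg hx]
  have r1 : δ * Q ≤ (RR p l0 x).re := by
    have := (hB.g0 x (Vr_real hm hx)).re_sq
    rw [nx, ← hXd, ← hQ2] at this
    apply le_of_sq' hδ.le (RR_re_nonneg _ _ _)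
    have h0 := hB.c0p
    nlinarith [sq_nonneg Q]
  have r2 : δ * Q ≤ (RR p lam x).re := by
    have := hg.re_sq
    rw [nx, ← hXd, ← hQ2] at this
    apply le_of_sq' hδ.le (RR_re_nonneg _ _ _)
    nlinarith [sq_nonneg Q]
  have r3 : δ * Q ≤ (RR (p0 m) lam x).re := by
    have := sec0 (m := m) hc hc1 one_pos le_rfl hx (show lam ∈ Sec c 1 from ⟨hΛ.trans_lt hl.1, hl.2⟩)
    rw [← hXd, ← hQ2] at this
    apply le_of_sq' hδ.le (RR_re_nonneg _ _ _)
    nlinarith [sq_nonneg Q]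
  have hδQ : 0 < δ * Q := by positivity
  have hP : (RR p lam x) ^ 2 - (RR (p0 m) lam x) ^ 2 = p.eval (x:ℂ) - (x:ℂ) ^ m := by
    rw [RR_sq, RR_sq, p0_eval]; ring
  have hP0 : (RR p l0 x) ^ 2 - (RR (p0 m) 0 x) ^ 2 = (p.eval (x:ℂ) - (x:ℂ) ^ m) + l0 := by
    rw [RR_sq, RR_sq, p0_eval]; ring
  have hE : ∀ r v : ℝ, δ * Q ≤ r → v ≤ (1 + ‖l0‖) * ‖lam‖ → v / r ≤ ((1 + ‖l0‖) * ‖lam‖ / δ) / Q := by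
    intro r v hr hv
    rw [div_div]
    exact div_le_div₀ (by positivity) hv hδQ hr
  have key := cmp_abs (E := (1 + ‖l0‖) * ‖lam‖ / δ) hQ hδ hP hP0
    (by rw [Complex.add_re]; linarith) (by rw [Complex.add_re]; linarith [RR_re_nonneg (p0 m) 0 x])
    ((RR_sub_le p (hδQ.trans_le r1)).trans (hE _ _ r1 (by
      refine (norm_sub_le _ _).trans ?_
      nlinarith [norm_nonneg l0])))
    (by
      rw [norm_sub_rev]
      refine (RR_sub_le (p0 m) (hδQ.trans_le r3)).trans (hE _ _ r3 ?_)
      rw [zero_sub, norm_neg]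
      nlinarith [norm_nonneg l0])
  have hPn : ‖p.eval (x:ℂ) - (x:ℂ) ^ m‖ ≤ A * (Q ^ 2 / X) := by
    refine (hB.pb.lo x).trans ?_
    rw [nx, ← hXd, hQ2]
    apply le_of_eq; congr 1
    rw [eq_div_iff (by linarith), ← pow_succ]; congr 1; omega
  have hj : X ^ (-(5/4) : ℝ) = jj x := rfl
  have hjp := jj_pos hx
  have hLt : 1 ≤ ‖lam‖ ^ tt m := Real.one_le_rpow hL (by unfold tt; positivity)
  have hl0 : ‖l0‖ / (δ * Q) ≤ ‖l0‖ / δ * (‖lam‖ ^ tt m * jj x) := by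
    have h1 := (inv_le_jj hm (δ := 1) one_pos hQ.le hx (by rw [hQ2, one_mul])).2
    rw [Real.sqrt_one] at h1
    rw [div_mul_eq_div_mul_one_div]
    apply mul_le_mul_of_nonneg_left _ (by positivity)
    refine h1.trans ?_
    nlinarith
  have hsum : ∀ a b d Z : ℝ, 0 ≤ a → 0 ≤ b → 0 ≤ d → 0 ≤ Z → (a * Z + d * Z ≤ (a + b + d) * Z) ∧ b * Z + d * Z ≤ (a + b + d) * Z := by
    intro a b d Z ha hb hd hZ
    constructor <;> nlinarith [mul_nonneg ha hZ, mul_nonneg hb hZ]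
  obtain ⟨s1, s2⟩ := hsum (2 * A / δ) (2 * A * (1 + ‖l0‖) / δ ^ 3) (‖l0‖ / δ) (‖lam‖ ^ tt m * jj x) (by positivity) (by positivity) (by positivity) (by positivity)
  rw [mul_assoc _ (‖lam‖ ^ tt m)]
  rcases le_total (X ^ m) ‖lam‖ with hc | hc
  · have y := young1 hm hX hc
    rw [← hQd, hj] at y
    refine key.1.trans (le_trans (add_le_add ?_ hl0) s1)
    calc ‖p.eval (x:ℂ) - (x:ℂ) ^ m‖ * (2 / (δ * Q)) ≤ A * (Q ^ 2 / X) * (2 / (δ * Q)) := by gcongr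
      _ = 2 * A / δ * (Q / X) := by field_simp
      _ ≤ _ := by gcongr
  · have y := young2 hm hX hL0 hc
    rw [← hQd, hj] at y
    refine key.2.trans (le_trans (add_le_add ?_ hl0) s2)
    calc ‖p.eval (x:ℂ) - (x:ℂ) ^ m‖ * (2 * ((1 + ‖l0‖) * ‖lam‖ / δ) / (δ ^ 2 * Q ^ 3))
        ≤ A * (Q ^ 2 / X) * (2 * ((1 + ‖l0‖) * ‖lam‖ / δ) / (δ ^ 2 * Q ^ 3)) := by gcongr
      _ = 2 * A * (1 + ‖l0‖) / δ ^ 3 * (‖lam‖ / (Q * X)) := by field_simp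
      _ ≤ _ := by gcongr

theorem Sec_slit {c Λ : ℝ} (hc : 0 < c) (hΛ : 0 ≤ Λ) {lam : ℂ} (h : lam ∈ Sec c Λ) : lam ∈ slitPlane := by
  apply slit_of_pos
  have h1 := h.1
  have h2 := h.2
  have : 0 < c * ‖lam‖ := mul_pos hc (by linarith)
  linarith

theorem Sec_mono {c Λ Λ' : ℝ} (h : Λ ≤ Λ') {lam : ℂ} (hl : lam ∈ Sec c Λ') : lam ∈ Sec c Λ := ⟨h.trans_lt hl.1, hl.2⟩

theorem Tl_cmp (hB : Bas m p A c0 l0) {c : ℝ} (hc : 0 < c) (hc1 : c ≤ 1) : ∃ Λ C : ℝ, 1 ≤ Λ ∧ 0 < C ∧ ∀ lam ∈ Sec c Λ,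
    ‖Tl p l0 lam 0 - KK m * lam ^ (al m : ℂ)‖ ≤ C * ‖lam‖ ^ tt m := by
  have hm := hB.pb.hm
  obtain ⟨Λ, C, hΛ, hC, H⟩ := cmp_pt hB hc hc1
  obtain ⟨Λ', C', c', hΛ', hC', hc', H'⟩ := sec_ln hB.pb hc hc1
  refine ⟨max Λ Λ', 4 * C, hΛ.trans (le_max_left _ _), by positivity, fun lam hl => ?_⟩
  have hl1 := Sec_mono (le_max_left _ _) hl
  have hL := (H' lam (Sec_mono (le_max_right _ _) hl) 0 le_rfl).2
  have hs := Sec_slit hc (zero_le_one.trans hΛ) hl1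
  rw [← NN_one hm, ← NN_eq hm hs, Tl, NN]
  have hi := dR_intOn hB hL
  simp only [Complex.ofReal_zero, zero_add] at hi ⊢
  rw [← integral_sub hi (NN_int hm hs)]
  have h2 : ∫ t in Ioi 0, C * ‖lam‖ ^ tt m * jj t = 4 * C * ‖lam‖ ^ tt m := by
    rw [integral_const_mul, jj_int.2]; ring
  rw [← h2]
  refine norm_integral_le_of_norm_le (jj_int.1.const_mul _) ?_
  filter_upwards [ae_restrict_mem measurableSet_Ioi] with x hx
  exact H lam hl1 x (le_of_lt hx)

end

end Sib


namespace Sib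

section
variable {m : ℕ}

noncomputable def ell (m : ℕ) (hm : 3 ≤ m) (a : ℕ → ℂ) (lam : ℂ) : ℂ :=
  -(1/4 : ℂ) * Complex.log lam - Xi (qp m a) (bl m hm a) lam 0 + Complex.log (Hh (qp m a) (bl m hm a) lam 0)

theorem SS_zero (hm : 3 ≤ m) (a : ℕ → ℂ) (lam : ℂ) : SS (qp m a) lam 0 = lam ^ (1/4 : ℂ) := by
  rw [SS, (bas m hm a).pb.h0, zero_add]

theorem tt_lt_al (hm : 3 ≤ m) : tt m < al m := by
  rw [al_eq hm, tt]
  have : (0:ℝ) < m := by positivity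
  have : 1 / (2 * (m:ℝ)) < 1 / m := one_div_lt_one_div_of_lt this (by linarith)
  linarith

theorem tendsto_small {s t : ℝ} (h : s < t) (C : ℝ) : Tendsto (fun x : ℝ => C * x ^ s / x ^ t) atTop (nhds 0) := by
  have h1 : Tendsto (fun x : ℝ => C * x ^ (-(t - s))) atTop (nhds (C * 0)) :=
    (tendsto_rpow_neg_atTop (by linarith)).const_mul C
  rw [mul_zero] at h1
  refine h1.congr' ?_
  filter_upwards [eventually_gt_atTop 0] with x hx
  rw [neg_sub, Real.rpow_sub hx]; ring

theorem ell_main (hm : 3 ≤ m) (a : ℕ → ℂ) {c : ℝ} (hc : 0 < c) (hc1 : c ≤ 1) : ∃ Λ0 : ℝ, 1 ≤ Λ0 ∧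
    DifferentiableOn ℂ (ell m hm a) (Sec c Λ0) ∧ (∀ lam ∈ Sec c Λ0, F0 m hm a lam = Complex.exp (ell m hm a lam)) ∧
    (∀ ε > 0, ∃ Λ ≥ Λ0, ∀ lam ∈ Sec c Λ, ‖ell m hm a lam - KK m * lam ^ (al m : ℂ)‖ ≤ ε * ‖lam‖ ^ al m) ∧
    (∀ ε > 0, ∃ Λ ≥ Λ0, ∀ lam ∈ Sec c Λ, ‖F1 m hm a lam + lam ^ (1/2 : ℂ) * F0 m hm a lam‖ ≤ ε * ‖lam ^ (1/2 : ℂ) * F0 m hm a lam‖) := by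
  have hB := bas m hm a
  obtain ⟨Λ, C, c', hΛ, hC, hc', H⟩ := sec_ln hB.pb hc hc1
  obtain ⟨Λ2, C2, hΛ2, hC2, H2⟩ := Tl_cmp hB hc hc1
  set Λ0 := max Λ (max Λ2 ((16 * C) ^ 2)) with hΛ0
  have hΛ01 : 1 ≤ Λ0 := hΛ.trans (le_max_left _ _)
  have hκ : ∀ lam ∈ Sec c Λ0, C / Real.sqrt ‖lam‖ * dd 0 ≤ 1/16 := by
    intro lam hl
    have h1 : 16 * C ≤ Real.sqrt ‖lam‖ := by
      apply Real.le_sqrt_of_sq_le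
      exact ((le_max_right _ _).trans (le_max_right _ _)).trans hl.1.le
    have h2 : dd 0 = 1 := by simp [dd]
    rw [h2, mul_one, div_le_iff₀ (by linarith)]; linarith
  have hdd : dd 0 = 1 := by simp [dd]
  have hLn0 : ∀ lam ∈ Sec c Λ0, Ln m (qp m a) c' (C / Real.sqrt ‖lam‖) lam 0 := by
    intro lam hl
    have := (H lam (Sec_mono (le_max_left _ _) hl) 0 le_rfl).2
    rw [hdd, mul_one] at this
    simpa using this
  have hLn : ∀ lam ∈ Sec c Λ0, Ln m (qp m a) c' (1/16) lam 0 := by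
    intro lam hl
    refine (hLn0 lam hl).weaken ?_ (by norm_num)
    have := hκ lam hl
    rwa [hdd, mul_one] at this
  have hH : ∀ lam ∈ Sec c Λ0, ‖Hh (qp m a) (bl m hm a) lam 0 - 1‖ ≤ 1/2 := by
    intro lam hl
    have := (hLn lam hl).H_le hB
    linarith
  have hHs : ∀ lam ∈ Sec c Λ0, Hh (qp m a) (bl m hm a) lam 0 ∈ slitPlane := by
    intro lam hl
    have h1 := hH lam hl
    have h2 := (Complex.abs_re_le_norm _).trans h1
    rw [Complex.sub_re, Complex.one_re, abs_le] at h2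
    left; linarith [h2.1]
  have hline : ∀ lam ∈ Sec c Λ0, F0 m hm a lam = yy (qp m a) (bl m hm a) lam 0 ∧ F1 m hm a lam = y1 (qp m a) (bl m hm a) lam 0 :=
    fun lam hl => FF_line hB (hLn lam hl)
  have hslit : ∀ lam ∈ Sec c Λ0, lam ∈ slitPlane := fun lam hl => Sec_slit hc (by linarith) hl
  refine ⟨Λ0, hΛ01, ?_, ?_, ?_, ?_⟩
  · intro lam hl
    set U := Sec c Λ0 ∩ Metric.ball 0 (‖lam‖ + 1) with hU
    have hUo : IsOpen U := (Sec_open _ _).inter Metric.isOpen_ball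
    have hlU : lam ∈ U := ⟨hl, by simp⟩
    have hn : ∀ u ∈ U, ‖u‖ ≤ ‖lam‖ + 1 := fun u hu => by
      have := hu.2; rw [mem_ball_zero_iff] at this; exact this.le
    have a1 := Xi_diff hB hUo (l := fun u => u) (w := fun _ => 0) differentiableOn_id (differentiableOn_const _) hn (fun u hu => hLn u hu.1)
    have a2 := (HB_diff hB hUo (l := fun u => u) (w := fun _ => 0) differentiableOn_id (differentiableOn_const _) hn (fun u hu => hLn u hu.1)).1
    have b1 := a1.differentiableAt (hUo.mem_nhds hlU)
    have b2 := (a2.differentiableAt (hUo.mem_nhds hlU)).clog (hHs lam hl)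
    have b3 := (differentiableAt_id (𝕜 := ℂ) (x := lam)).clog (hslit lam hl)
    exact (((b3.const_mul (-(1/4 : ℂ))).sub b1).add b2).differentiableWithinAt
  · intro lam hl
    have h0 := slitPlane_ne_zero (hslit lam hl)
    rw [(hline lam hl).1, yy, ell, Complex.exp_add, Complex.exp_log (slitPlane_ne_zero (hHs lam hl)), sub_eq_add_neg, Complex.exp_add,
      SS_zero hm, Complex.cpow_def_of_ne_zero h0, neg_mul, Complex.exp_neg (1/4 * Complex.log lam), mul_comm (Complex.log lam)]
    ring
  · intro ε hε
    have hev : ∀ᶠ x : ℝ in atTop, (C2 * x ^ tt m / x ^ al m ≤ ε / 3) ∧ (1/4 * Real.log x / x ^ al m ≤ ε / 3) ∧ (2 * x ^ (0:ℝ) / x ^ al m ≤ ε / 3) := by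
      have t1 := tendsto_small (tt_lt_al hm) C2
      have t2 := ((isLittleO_log_rpow_atTop (al_pos hm)).tendsto_div_nhds_zero).const_mul (1/4 : ℝ)
      have t3 := tendsto_small (al_pos hm) 2
      rw [mul_zero] at t2
      refine (t1.eventually_le_const (by positivity)).and (Eventually.and ?_ (t3.eventually_le_const (by positivity)))
      filter_upwards [t2.eventually_le_const (show 0 < ε / 3 by positivity)] with x hx
      rwa [mul_div_assoc]
    obtain ⟨Λ3, h3⟩ := eventually_atTop.1 hev
    refine ⟨max Λ0 Λ3, le_max_left _ _, fun lam hl => ?_⟩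
    have hl0 := Sec_mono (le_max_left _ _) hl
    have hl1 : 1 < ‖lam‖ := hΛ01.trans_lt hl0.1
    have hL0 : 0 < ‖lam‖ := by linarith
    obtain ⟨e1, e2, e3⟩ := h3 ‖lam‖ ((le_max_right _ _).trans hl.1.le)
    have hp : 0 < ‖lam‖ ^ al m := by positivity
    rw [div_le_iff₀ hp] at e1 e2 e3
    rw [Real.rpow_zero, mul_one] at e3
    have hT := H2 lam (Sec_mono ((le_max_left _ _).trans (le_max_right _ _)) hl0)
    have hXi : Xi (qp m a) (bl m hm a) lam 0 = -Tl (qp m a) (bl m hm a) lam 0 := by rw [Xi, xi_zero, zero_sub]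
    have hlog : ‖-(1/4 : ℂ) * Complex.log lam‖ ≤ 1/4 * Real.log ‖lam‖ + 1 := by
      rw [norm_mul, norm_neg]
      have h1 := Complex.norm_le_abs_re_add_abs_im (Complex.log lam)
      rw [Complex.log_re, Complex.log_im, abs_of_nonneg (Real.log_nonneg hl1.le)] at h1
      have h2 := Complex.abs_arg_le_pi lam
      have := Real.pi_le_four
      norm_num
      linarith
    have hlogH : ‖Complex.log (Hh (qp m a) (bl m hm a) lam 0)‖ ≤ 1 := by
      have h1 := hH lam hl0
      have h2 := Complex.norm_log_one_add_half_le_self h1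
      rw [add_sub_cancel] at h2
      linarith
    have : ell m hm a lam - KK m * lam ^ (al m : ℂ) = -(1/4 : ℂ) * Complex.log lam + Complex.log (Hh (qp m a) (bl m hm a) lam 0)
        + (Tl (qp m a) (bl m hm a) lam 0 - KK m * lam ^ (al m : ℂ)) := by
      rw [ell, hXi]; ring
    rw [this]
    refine (norm_add₃_le).trans ?_
    linarith
  · intro ε hε
    set D := ‖(qp m a).derivative.eval 0‖ with hD
    obtain ⟨Λ3, h3⟩ := eventually_atTop.1 ((tendsto_small (s := -(1/2)) (t := 0) (by norm_num) (D / 4 + 16 * C)).eventually_le_const hε)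
    refine ⟨max Λ0 Λ3, le_max_left _ _, fun lam hl => ?_⟩
    have hl0 := Sec_mono (le_max_left _ _) hl
    have hl1 : 1 < ‖lam‖ := hΛ01.trans_lt hl0.1
    have hL0 : 0 < ‖lam‖ := by linarith
    have e1 := h3 ‖lam‖ ((le_max_right _ _).trans hl.1.le)
    rw [Real.rpow_zero, div_one, Real.rpow_neg hL0.le, ← Real.sqrt_eq_rpow] at e1
    have hS4 := SS_pow4 (qp m a) lam 0
    rw [(bas m hm a).pb.h0, zero_add] at hS4
    have hR : lam ^ (1/2 : ℂ) = SS (qp m a) lam 0 ^ 2 := by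
      have := RR_eq (qp m a) lam 0
      rw [(bas m hm a).pb.h0, zero_add] at this
      rw [← this, RR]
    have hS0 : SS (qp m a) lam 0 ≠ 0 := by
      intro h; rw [h] at hS4; have := slitPlane_ne_zero (hslit lam hl0); apply this; rw [← hS4]; norm_num
    set S := SS (qp m a) lam 0 with hSd
    set E := Complex.exp (-Xi (qp m a) (bl m hm a) lam 0) with hE
    set Hv := Hh (qp m a) (bl m hm a) lam 0 with hHv
    set Bv := Bb (qp m a) (bl m hm a) lam 0 with hBv
    have hBl : ‖Bv‖ ≤ 8 * (C / Real.sqrt ‖lam‖) := (hLn0 lam hl0).B_le hB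
    have hHl : 1/2 ≤ ‖Hv‖ := by
      have h1 := hH lam hl0
      have h2 := norm_sub_norm_le (1:ℂ) Hv
      rw [norm_sub_rev, norm_one] at h2
      linarith
    have hHne : Hv ≠ 0 := slitPlane_ne_zero (hHs lam hl0)
    have eF : lam ^ (1/2 : ℂ) * F0 m hm a lam = E * S * Hv := by
      rw [(hline lam hl0).1, yy, hR, ← hSd, ← hE, ← hHv]; field_simp
    have eF1 : F1 m hm a lam + lam ^ (1/2 : ℂ) * F0 m hm a lam = E * S * Hv * (-((qp m a).derivative.eval 0) / (4 * S ^ 6) + Bv / Hv) := by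
      rw [eF, (hline lam hl0).2, y1, ← hSd, ← hE, ← hHv, ← hBv]; field_simp; ring
    rw [eF1, eF, norm_mul, mul_comm]
    gcongr
    refine le_trans (norm_add_le _ _) (le_trans ?_ e1)
    have hS2 : ‖S‖ ^ 2 = Real.sqrt ‖lam‖ := by
      rw [← hS4, norm_pow, show ‖S‖ ^ 4 = (‖S‖ ^ 2) ^ 2 by ring, Real.sqrt_sq (by positivity)]
    have hq1 : 1 ≤ Real.sqrt ‖lam‖ := by rw [Real.one_le_sqrt]; exact hl1.le
    have q1 : ‖-((qp m a).derivative.eval 0) / (4 * S ^ 6)‖ ≤ D / 4 * (Real.sqrt ‖lam‖)⁻¹ := by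
      rw [norm_div, norm_neg, norm_mul, norm_pow, show ‖S‖ ^ 6 = (‖S‖ ^ 2) ^ 3 by ring, hS2, Complex.norm_ofNat, ← hD, ← div_div,
        div_eq_mul_inv]
      gcongr
      exact le_self_pow₀ hq1 (by norm_num)
    have q2 : ‖Bv / Hv‖ ≤ 16 * C * (Real.sqrt ‖lam‖)⁻¹ := by
      rw [norm_div, div_le_iff₀ (by linarith)]
      have : 0 ≤ 16 * C * (Real.sqrt ‖lam‖)⁻¹ := by positivity
      have e : 8 * (C / Real.sqrt ‖lam‖) = 16 * C * (Real.sqrt ‖lam‖)⁻¹ * (1/2) := by rw [div_eq_mul_inv]; ring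
      rw [e] at hBl
      exact hBl.trans (by gcongr)
    linarith

end

end Sib


namespace Sib

section

theorem abs_lemma {θ R0 T : ℝ} (hθ : 0 < θ) (hθ2 : θ < π / 2) (hT : 0 < T) (c2 : ℂ) {h : ℂ → ℂ}
    (hd : DifferentiableOn ℂ h {κ | |arg κ| < θ ∧ R0 < ‖κ‖})
    (hh : ∀ ε > 0, ∃ R ≥ R0, ∀ κ : ℂ, |arg κ| < θ → R < ‖κ‖ → ‖h κ - κ‖ ≤ ε * ‖κ‖) :
    ∃ (N0 : ℕ) (κ : ℕ → ℂ), (∀ n ≥ N0, |arg (κ n)| < θ ∧ R0 < ‖κ n‖ ∧ h (κ n) = T * n + c2) ∧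
      Tendsto (fun n => κ n / (T * n)) atTop (nhds 1) ∧
      ∃ R ≥ R0, ∀ z : ℂ, |arg z| < θ → R < ‖z‖ → ∀ k : ℤ, h z = T * k + c2 → ∃ n ≥ N0, z = κ n := by
  -- radius
  obtain ⟨r, hr, hr4, hrarg⟩ : ∃ r : ℝ, 0 < r ∧ r ≤ 1/4 ∧ ∀ z : ℂ, ‖z - 1‖ ≤ 2 * r → |arg z| < θ := by
    have hc : ContinuousAt (fun z => |arg z|) 1 := (continuousAt_arg one_mem_slitPlane).abs
    have h1 : ∀ᶠ z in nhds (1:ℂ), |arg z| < θ := by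
      apply hc.eventually_lt_const; simpa using hθ
    obtain ⟨δ, hδ, h2⟩ := Metric.eventually_nhds_iff.1 h1
    refine ⟨min (δ / 4) (1/4), by positivity, min_le_right _ _, fun z hz => h2 ?_⟩
    rw [dist_eq_norm]
    have := min_le_left (δ / 4) (1/4)
    linarith
  -- geometry of the discs
  have geo : ∀ n : ℝ, 0 < n → ∀ z : ℂ, ‖z - (T * n : ℝ)‖ ≤ 2 * r * (T * n) → |arg z| < θ ∧ ‖z‖ ≤ 2 * (T * n) ∧ T * n / 2 ≤ ‖z‖ := by
    intro n hn z hz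
    have hTn : 0 < T * n := by positivity
    have nT : ‖((T * n : ℝ) : ℂ)‖ = T * n := by rw [Complex.norm_real, Real.norm_of_nonneg hTn.le]
    have hTc : ((T * n : ℝ) : ℂ) ≠ 0 := by exact_mod_cast hTn.ne'
    have hr2 : 2 * r * (T * n) ≤ T * n / 2 := by nlinarith
    refine ⟨?_, ?_, ?_⟩
    · have e : z = ((T * n : ℝ) : ℂ) * (z / (T * n : ℝ)) := by field_simp
      rw [e, Complex.arg_real_mul _ hTn]
      apply hrarg
      rw [div_sub_one hTc, norm_div, nT, div_le_iff₀ hTn]; exact hz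
    · have := norm_sub_norm_le z (T * n : ℝ)
      linarith
    · have := norm_sub_norm_le ((T * n : ℝ) : ℂ) z
      rw [norm_sub_rev] at this
      linarith
  obtain ⟨R1, hR1, hh1⟩ := hh (r / 8) (by positivity)
  obtain ⟨N1, hN1⟩ := exists_nat_gt (max (2 * R1 / T) (max (2 * ‖c2‖ / (r * T)) 0))
  have hbig : ∀ n : ℕ, N1 ≤ n → 0 < (n:ℝ) ∧ R1 < T * n / 2 ∧ ‖c2‖ ≤ r * (T * n) / 2 := by
    intro n hn
    have h0 : (N1:ℝ) ≤ n := by exact_mod_cast hn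
    have h1 := (le_max_left _ _).trans_lt hN1
    have h2 := ((le_max_left _ _).trans (le_max_right _ _)).trans_lt hN1
    have h3 := ((le_max_right _ _).trans (le_max_right _ _)).trans_lt hN1
    rw [div_lt_iff₀ hT] at h1
    rw [div_lt_iff₀ (by positivity)] at h2
    have h4 : (N1:ℝ) * T ≤ n * T := by gcongr
    have h5 : (N1:ℝ) * (r * T) ≤ n * (r * T) := by gcongr
    refine ⟨by linarith, by linarith, by linarith⟩
  set η : ℂ → ℂ := fun z => h z - z with hη
  set V : Set ℂ := {κ | |arg κ| < θ ∧ R0 < ‖κ‖} with hV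
  -- the big disc lies in V
  have hDV : ∀ n : ℕ, N1 ≤ n → ∀ z : ℂ, ‖z - (T * n : ℝ)‖ ≤ 2 * r * (T * n) → |arg z| < θ ∧ R1 < ‖z‖ ∧ ‖η z‖ ≤ r / 4 * (T * n) := by
    intro n hn z hz
    obtain ⟨b0, b1, b2⟩ := hbig n hn
    obtain ⟨g1, g2, g3⟩ := geo n b0 z hz
    have : R1 < ‖z‖ := by linarith
    refine ⟨g1, this, (hh1 z g1 this).trans ?_⟩
    nlinarith
  have hLip : ∀ n : ℕ, N1 ≤ n → LipschitzOnWith (1/2) η (Metric.closedBall ((T * n : ℝ) : ℂ) (r * (T * n))) := by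
    intro n hn
    obtain ⟨b0, b1, b2⟩ := hbig n hn
    have hTn : 0 < T * n := by positivity
    have hrT : 0 < r * (T * n) := by positivity
    have hsub : ∀ x ∈ Metric.closedBall ((T * n : ℝ) : ℂ) (r * (T * n)), ∀ y ∈ Metric.closedBall x (r * (T * n)), ‖y - (T * n : ℝ)‖ ≤ 2 * r * (T * n) := by
      intro x hx y hy
      rw [mem_closedBall_iff_norm] at hx hy
      calc ‖y - (T * n : ℝ)‖ = ‖(y - x) + (x - (T * n : ℝ))‖ := by ring_nf
        _ ≤ _ := norm_add_le _ _
        _ ≤ _ := by linarith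
    have hdiff : ∀ z : ℂ, ‖z - (T * n : ℝ)‖ ≤ 2 * r * (T * n) → DifferentiableWithinAt ℂ η V z := by
      intro z hz
      obtain ⟨g1, g2, g3⟩ := hDV n hn z hz
      exact (hd z ⟨g1, lt_of_le_of_lt hR1 g2⟩).sub differentiableWithinAt_id
    have hballV : ∀ x ∈ Metric.closedBall ((T * n : ℝ) : ℂ) (r * (T * n)), Metric.closedBall x (r * (T * n)) ⊆ V := by
      intro x hx y hy
      obtain ⟨g1, g2, g3⟩ := hDV n hn y (hsub x hx y hy)
      exact ⟨g1, lt_of_le_of_lt hR1 g2⟩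
    refine (convex_closedBall _ _).lipschitzOnWith_of_nnnorm_deriv_le (𝕜 := ℂ) ?_ ?_
    · intro x hx
      exact (hdiff x (hsub x hx x (Metric.mem_closedBall_self hrT.le))).differentiableAt
        (mem_of_superset (Metric.closedBall_mem_nhds x hrT) (hballV x hx))
    · intro x hx
      have := Complex.norm_deriv_le_of_forall_mem_sphere_norm_le (f := η) (c := x) (C := r / 4 * (T * n)) hrT (by
        apply DifferentiableOn.diffContOnCl
        rw [closure_ball _ hrT.ne']
        intro y hy
        exact (hdiff y (hsub x hx y hy)).mono (hballV x hx))
        (fun y hy => (hDV n hn y (hsub x hx y (Metric.sphere_subset_closedBall hy))).2.2)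
      rw [← NNReal.coe_le_coe, coe_nnnorm]
      refine this.trans ?_
      have : r / 4 * (T * n) / (r * (T * n)) = 1/4 := by field_simp
      rw [this]
      norm_num
  have hex : ∀ n : ℕ, ∃ z : ℂ, N1 ≤ n → ‖z - (T * n : ℝ)‖ ≤ r * (T * n) ∧ h z = T * n + c2 := by
    intro n
    by_cases hn : N1 ≤ n
    swap
    · exact ⟨0, fun h => absurd h hn⟩
    obtain ⟨b0, b1, b2⟩ := hbig n hn
    have hTn : 0 < T * n := by positivity
    have hrT : 0 < r * (T * n) := by positivity
    set D := Metric.closedBall ((T * n : ℝ) : ℂ) (r * (T * n)) with hD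
    set f : ℂ → ℂ := fun z => (T * n : ℝ) + c2 - η z with hf
    have hmaps : MapsTo f D D := by
      intro z hz
      rw [hD, mem_closedBall_iff_norm] at hz ⊢
      have := (hDV n hn z (by linarith)).2.2
      calc ‖f z - (T * n : ℝ)‖ = ‖c2 - η z‖ := by simp only [hf]; ring_nf
        _ ≤ _ := norm_sub_le _ _
        _ ≤ _ := by linarith
    have hfl : LipschitzOnWith (1/2) f D := by
      apply LipschitzOnWith.of_dist_le_mul
      intro x hx y hy
      have := (hLip n hn).dist_le_mul x hx y hy
      rw [dist_eq_norm] at this ⊢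
      rw [dist_eq_norm] at this
      calc ‖f x - f y‖ = ‖η x - η y‖ := by rw [← norm_neg]; simp only [hf]; ring_nf
        _ ≤ _ := by rwa [dist_eq_norm]
    have hcon : ContractingWith (1/2) (hmaps.restrict f D D) := by
      refine ⟨?_, ?_⟩
      · rw [← NNReal.coe_lt_coe]; norm_num
      · intro x y
        exact hfl x.2 y.2
    obtain ⟨y, hy, hfix, -⟩ := hcon.exists_fixedPoint' (x := ((T * n : ℝ) : ℂ)) Metric.isClosed_closedBall.isComplete hmaps
      (Metric.mem_closedBall_self hrT.le) (edist_ne_top _ _)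
    refine ⟨y, fun _ => ⟨by rwa [hD, mem_closedBall_iff_norm] at hy, ?_⟩⟩
    have : f y = y := hfix
    simp only [hf, hη] at this
    push_cast at this
    linear_combination -this
  choose κ hκ using hex
  have hκ' : ∀ n ≥ N1, |arg (κ n)| < θ ∧ R1 < ‖κ n‖ ∧ h (κ n) = T * n + c2 := by
    intro n hn
    obtain ⟨b0, -, -⟩ := hbig n hn
    have hrT : 0 < r * (T * n) := by positivity
    obtain ⟨h1, h2⟩ := hκ n hn
    obtain ⟨g1, g2, -⟩ := hDV n hn (κ n) (by linarith)
    exact ⟨g1, g2, h2⟩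
  have huniq : ∀ n ≥ N1, ∀ z : ℂ, ‖z - (T * n : ℝ)‖ ≤ r * (T * n) → h z = T * n + c2 → z = κ n := by
    intro n hn z hz hz2
    have h1 := (hLip n hn).dist_le_mul z (mem_closedBall_iff_norm.2 hz) (κ n) (mem_closedBall_iff_norm.2 (hκ n hn).1)
    have e : η z - η (κ n) = κ n - z := by simp only [hη]; rw [hz2, (hκ n hn).2]; ring
    rw [dist_eq_norm, dist_eq_norm, e, norm_sub_rev] at h1
    have h3 : ‖z - κ n‖ ≤ 1/2 * ‖z - κ n‖ := by
      convert h1 using 2; norm_num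
    have : ‖z - κ n‖ = 0 := by linarith [norm_nonneg (z - κ n)]
    exact sub_eq_zero.1 (norm_eq_zero.1 this)
  refine ⟨N1, κ, fun n hn => ⟨(hκ' n hn).1, lt_of_le_of_lt hR1 (hκ' n hn).2.1, (hκ' n hn).2.2⟩, ?_, ?_⟩
  · rw [Metric.tendsto_atTop]
    intro ε hε
    obtain ⟨R2, hR2, hh2⟩ := hh (ε / 8) (by positivity)
    obtain ⟨N2, hN2⟩ := exists_nat_gt (max (2 * R2 / T) (4 * ‖c2‖ / (ε * T)))
    refine ⟨max N1 N2, fun n hn => ?_⟩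
    have hn1 := (le_max_left _ _).trans hn
    obtain ⟨b0, -, -⟩ := hbig n hn1
    have hTn : 0 < T * n := by positivity
    have h0 : (N2:ℝ) ≤ n := by exact_mod_cast (le_max_right _ _).trans hn
    have h1 := (le_max_left _ _).trans_lt hN2
    have h2 := (le_max_right _ _).trans_lt hN2
    rw [div_lt_iff₀ hT] at h1
    rw [div_lt_iff₀ (by positivity)] at h2
    have h4 : (N2:ℝ) * T ≤ n * T := by gcongr
    have h5 : (N2:ℝ) * (ε * T) ≤ n * (ε * T) := by gcongr
    obtain ⟨q1, q2⟩ := hκ n hn1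
    have hrT : 0 < r * (T * n) := by positivity
    obtain ⟨g1, g2, g3⟩ := geo n b0 (κ n) (by linarith)
    have hz := hh2 (κ n) g1 (by linarith)
    have hTc : (T * n : ℂ) ≠ 0 := by exact_mod_cast hTn.ne'
    rw [dist_eq_norm, div_sub_one hTc, norm_div]
    have nT : ‖(T * n : ℂ)‖ = T * n := by
      have : (T * n : ℂ) = ((T * n : ℝ) : ℂ) := by push_cast; rfl
      rw [this, Complex.norm_real, Real.norm_of_nonneg hTn.le]
    rw [nT, div_lt_iff₀ hTn]
    have e : κ n - T * n = c2 - (h (κ n) - κ n) := by rw [q2]; ring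
    rw [e]
    refine (norm_sub_le _ _).trans_lt ?_
    nlinarith
  · set ct := Real.cos θ with hct
    have hctp : 0 < ct := Real.cos_pos_of_mem_Ioo ⟨by linarith, hθ2⟩
    obtain ⟨ε, hε, e1, e2⟩ : ∃ ε : ℝ, 0 < ε ∧ ε ≤ r / 8 ∧ ε ≤ ct / 8 :=
      ⟨min (r/8) (ct/8), by positivity, min_le_left _ _, min_le_right _ _⟩
    obtain ⟨R2, hR2, hh2⟩ := hh ε hε
    refine ⟨max R2 (max (‖c2‖ / ε) (2 * T * N1)), hR2.le.trans (le_max_left _ _), fun z hz hzR k hk => ?_⟩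
    have z1 := (le_max_left _ _).trans_lt hzR
    have z2 := ((le_max_left _ _).trans (le_max_right _ _)).trans_lt hzR
    have z3 := ((le_max_right _ _).trans (le_max_right _ _)).trans_lt hzR
    rw [div_lt_iff₀ hε] at z2
    have hzz := hh2 z hz z1
    have hz0 : 0 < ‖z‖ := lt_of_le_of_lt (by positivity) z3
    have hd1 : ‖z - (T * k : ℝ)‖ ≤ 2 * ε * ‖z‖ := by
      have e : z - (T * k : ℝ) = c2 - (h z - z) := by rw [hk]; push_cast; ring
      rw [e]
      refine (norm_sub_le _ _).trans ?_
      linarith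
    have hre : ct * ‖z‖ ≤ z.re := by
      rw [← Complex.norm_mul_cos_arg z, mul_comm]
      gcongr
      rw [hct, ← Real.cos_abs (arg z)]
      exact Real.cos_le_cos_of_nonneg_of_le_pi (abs_nonneg _) (by linarith [Real.pi_pos]) hz.le
    have hre2 := (Complex.abs_re_le_norm _).trans hd1
    rw [Complex.sub_re, Complex.ofReal_re, abs_le] at hre2
    have hTk : ct / 2 * ‖z‖ ≤ T * k := by nlinarith [hre2.2]
    have hkpos : 0 < (k:ℝ) := by
      have : 0 < T * k := lt_of_lt_of_le (by positivity) hTk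
      exact (pos_iff_pos_of_mul_pos this).1 hT
    have hr8 : ε ≤ 1/32 := by linarith
    have hzk : ‖z‖ ≤ 2 * (T * k) := by
      have h1 := norm_sub_norm_le z (T * k : ℝ)
      rw [Complex.norm_real, Real.norm_of_nonneg (by positivity)] at h1
      nlinarith
    obtain ⟨n, rfl⟩ : ∃ n : ℕ, k = n := ⟨k.toNat, by
      have : 0 < k := by exact_mod_cast hkpos
      omega⟩
    have hn : N1 ≤ n := by
      have : 2 * T * N1 < 2 * (T * n) := by
        have := z3.trans_le hzk
        simpa using this
      have h2 : (N1:ℝ) < n := by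
        by_contra hcon
        push Not at hcon
        have : T * n ≤ T * N1 := by gcongr
        linarith
      exact_mod_cast h2.le
    refine ⟨n, hn, huniq n hn z ?_ (by simpa using hk)⟩
    simp only [Int.cast_natCast] at hd1 hzk hkpos
    refine hd1.trans ?_
    have : 0 < T * n := by positivity
    nlinarith

end

end Sib


namespace Sib

theorem polar_norm {ρ : ℝ} (hρ : 0 < ρ) (ψ : ℝ) : ‖(ρ:ℂ) * Complex.exp (ψ * I)‖ = ρ := by
  rw [norm_mul, Complex.norm_exp_ofReal_mul_I, mul_one, Complex.norm_real, Real.norm_of_nonneg hρ.le]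

theorem polar_cpow {ρ : ℝ} (hρ : 0 < ρ) {ψ : ℝ} (h : |ψ| < π) (s : ℝ) :
    ((ρ:ℂ) * Complex.exp (ψ * I)) ^ (s:ℂ) = ((ρ ^ s : ℝ) : ℂ) * Complex.exp ((s * ψ : ℝ) * I) := by
  have hl : Complex.log (Complex.exp (ψ * I)) = ψ * I := by
    apply Complex.log_exp <;> simp <;> linarith [(abs_lt.1 h).1, (abs_lt.1 h).2]
  rw [real_mul_cpow hρ (Complex.exp_ne_zero _), Complex.cpow_def_of_ne_zero (Complex.exp_ne_zero (ψ * I)), hl,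
    Complex.ofReal_cpow hρ.le]
  congr 2; push_cast; ring

/-- opening constant of the sector -/
noncomputable def cS (m : ℕ) : ℝ := (1 - Real.cos (π / (2 * ((m:ℝ) + 2)))) / 2

theorem cS_pos (m : ℕ) : 0 < cS m ∧ cS m ≤ 1 := by
  have h1 : 0 < π / (2 * ((m:ℝ) + 2)) := by positivity
  have h2 : π / (2 * ((m:ℝ) + 2)) ≤ π := by
    apply div_le_self pi_pos.le
    have : (0:ℝ) ≤ m := m.cast_nonneg
    linarith
  have := Real.cos_lt_cos_of_nonneg_of_le_pi le_rfl h2 h1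
  rw [Real.cos_zero] at this
  have h3 := Real.neg_one_le_cos (π / (2 * ((m:ℝ) + 2)))
  unfold cS
  constructor <;> linarith

theorem polar_Sec (m : ℕ) {ρ Λ ψ : ℝ} (hρ : 0 < ρ) (hΛ : Λ < ρ) (h : |ψ| ≤ π - π / (2 * ((m:ℝ) + 2))) :
    (ρ:ℂ) * Complex.exp (ψ * I) ∈ Sec (cS m) Λ := by
  have hc := (cS_pos m).1
  have hre : ((ρ:ℂ) * Complex.exp (ψ * I)).re = ρ * Real.cos ψ := by
    rw [Complex.re_ofReal_mul, Complex.exp_ofReal_mul_I_re]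
  refine ⟨by rwa [polar_norm hρ], ?_⟩
  rw [polar_norm hρ, hre]
  have h1 : 0 < π / (2 * ((m:ℝ) + 2)) := by positivity
  have := Real.cos_le_cos_of_nonneg_of_le_pi (abs_nonneg ψ) (by linarith) h
  rw [Real.cos_abs, Real.cos_pi_sub] at this
  have h2 : cS m < 1 + Real.cos ψ := by unfold cS at hc ⊢; linarith
  nlinarith

noncomputable def ph (m : ℕ) : ℝ := π - 9 * π / (2 * ((m:ℝ) + 2))

/-- rotation with sign -/
noncomputable def us (m : ℕ) (σ : ℝ) : ℂ := Complex.exp ((σ * (2 * π / ((m:ℝ) + 2)) : ℝ) * I)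

theorem us_one (m : ℕ) : us m 1 = om m := by rw [us, om, one_mul]
theorem us_neg (m : ℕ) : us m (-1) = (om m)⁻¹ := by
  rw [us, om, ← Complex.exp_neg]; congr 1; push_cast; ring

theorem Wr_anti {m : ℕ} (hm : 3 ≤ m) (a : ℕ → ℂ) (w v lam : ℂ) : Wr m hm a w v lam = - Wr m hm a v w lam := by
  unfold Wr; ring

theorem Wr_adjs {m : ℕ} (hm : 3 ≤ m) (a : ℕ → ℂ) {σ : ℝ} (hσ : σ = 1 ∨ σ = -1) {w : ℂ} (hw : w ≠ 0) :
    ∃ K : ℂ, K ≠ 0 ∧ ∀ lam, Wr m hm a w (w * us m σ) lam = K := by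
  rcases hσ with rfl | rfl
  · rw [us_one]; exact Wr_adj hm a hw
  · rw [us_neg]
    obtain ⟨K, hK, h⟩ := Wr_adj hm a (mul_ne_zero hw (inv_ne_zero (om_ne m)))
    refine ⟨-K, neg_ne_zero.2 hK, fun lam => ?_⟩
    rw [Wr_anti, ← h lam, inv_mul_cancel_right₀ (om_ne m)]

theorem Wr_pl {m : ℕ} (hm : 3 ≤ m) (a : ℕ → ℂ) (p q r s lam : ℂ) :
    Wr m hm a p q lam * Wr m hm a r s lam - Wr m hm a p r lam * Wr m hm a q s lam
      + Wr m hm a p s lam * Wr m hm a q r lam = 0 := by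
  unfold Wr; ring

theorem reg2_const {m : ℕ} (hm : 3 ≤ m) (a : ℕ → ℂ) {σ : ℝ} (hσ : σ = 1 ∨ σ = -1) :
    ∃ C : ℂ, ∀ lam, Wr m hm a (us m σ)⁻¹ (us m σ) lam = 0 → Wr m hm a (us m σ)⁻¹ ((us m σ) ^ 2) lam = C := by
  set u := us m σ with hu
  have hu0 : u ≠ 0 := Complex.exp_ne_zero _
  obtain ⟨K1, h1, H1⟩ := Wr_adjs hm a hσ (inv_ne_zero hu0)
  obtain ⟨K2, h2, H2⟩ := Wr_adjs hm a hσ one_ne_zero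
  obtain ⟨K3, h3, H3⟩ := Wr_adjs hm a hσ hu0
  rw [← hu, inv_mul_cancel₀ hu0] at H1
  rw [← hu, one_mul] at H2
  rw [← hu, ← sq] at H3
  refine ⟨- (K1 * K3) / K2, fun lam h0 => ?_⟩
  have := Wr_pl hm a u⁻¹ 1 u (u ^ 2) lam
  rw [H1, H2, H3, h0] at this
  rw [eq_div_iff h2]
  linear_combination this

section
variable {m : ℕ}

theorem angles (hm : 3 ≤ m) {φ : ℝ} (h1 : ph m ≤ φ) (h2 : φ ≤ π) :
    |φ - 4 * π / ((m:ℝ) + 2)| ≤ π - π / (2 * ((m:ℝ) + 2)) ∧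
    |φ + 8 * π / ((m:ℝ) + 2) - 2 * π| ≤ π - π / (2 * ((m:ℝ) + 2)) ∧
    |al m * φ - π / 2| ≤ 5 * π / (4 * m) := by
  have hm' : (3:ℝ) ≤ m := by exact_mod_cast hm
  have hp := pi_pos
  set δ := π / (2 * ((m:ℝ) + 2)) with hδ
  have e1 : 4 * π / ((m:ℝ) + 2) = 8 * δ := by rw [hδ]; field_simp; ring
  have e2 : 8 * π / ((m:ℝ) + 2) = 16 * δ := by rw [hδ]; field_simp; ring
  have e3 : ph m = π - 9 * δ := by rw [ph, hδ]; ring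
  have e4 : 10 * δ ≤ π := by
    rw [hδ, ← mul_div_assoc, div_le_iff₀ (by positivity)]; nlinarith
  have hδ0 : 0 < δ := by positivity
  rw [e1, e2]; rw [e3] at h1
  refine ⟨abs_le.2 ⟨by linarith, by linarith⟩, abs_le.2 ⟨by linarith, by linarith⟩, ?_⟩
  have ha := al_pos (m := m) hm
  have f1 : al m * π = π / 2 + π / m := by rw [al_eq hm]; ring
  have f2 : al m * (9 * δ) = 9 * π / (4 * m) := by rw [hδ, al]; field_simp; ring
  have f3 : 5 * π / (4 * (m:ℝ)) = 9 * π / (4 * m) - π / m := by field_simp; ring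
  have f4 : π / m ≤ 5 * π / (4 * m) := by
    rw [div_le_div_iff₀ (by positivity) (by positivity)]; nlinarith
  have g1 := mul_le_mul_of_nonneg_left h1 ha.le
  have g2 := mul_le_mul_of_nonneg_left h2 ha.le
  rw [abs_le]
  constructor
  · rw [mul_sub, f1, f2] at g1; linarith
  · linarith

theorem reg2_re (hm : 3 ≤ m) {φ : ℝ} (h1 : ph m ≤ φ) (h2 : φ ≤ π) {σ : ℝ} (hσ : σ = 1 ∨ σ = -1) :
    2 * Real.cos (5 * π / (4 * m)) * Real.sin (2 * π / m) ≤
      Real.cos (al m * (σ * (φ - 4 * π / ((m:ℝ) + 2)))) + Real.cos (al m * (σ * (φ + 8 * π / ((m:ℝ) + 2) - 2 * π))) := by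
  obtain ⟨-, -, h⟩ := angles hm h1 h2
  have hm' : (3:ℝ) ≤ m := by exact_mod_cast hm
  have hp := pi_pos
  have e1 : al m * (φ - 4 * π / ((m:ℝ) + 2)) = al m * φ - 2 * π / m := by
    rw [mul_sub]; congr 1; rw [al]; field_simp; ring
  have e2 : al m * (φ + 8 * π / ((m:ℝ) + 2) - 2 * π) = (al m * φ + 2 * π / m) - π := by
    rw [al]; field_simp; ring
  have e : ∀ x : ℝ, Real.cos (al m * (σ * x)) = Real.cos (al m * x) := by
    intro x
    rcases hσ with rfl | rfl
    · rw [one_mul]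
    · rw [show al m * (-1 * x) = - (al m * x) by ring, Real.cos_neg]
  rw [e, e, e1, e2, Real.cos_sub_pi, Real.cos_sub, Real.cos_add]
  have h5 : Real.cos (5 * π / (4 * m)) ≤ Real.sin (al m * φ) := by
    rw [← Real.cos_sub_pi_div_two, ← Real.cos_abs (al m * φ - π / 2)]
    apply Real.cos_le_cos_of_nonneg_of_le_pi (abs_nonneg _) _ h
    rw [div_le_iff₀ (by positivity)]; nlinarith
  have := (trig_pos hm).2.2
  nlinarith

set_option maxHeartbeats 2000000 in
theorem reg2 (hm : 3 ≤ m) (a : ℕ → ℂ) {σ : ℝ} (hσ : σ = 1 ∨ σ = -1) :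
    ∃ Λ : ℝ, ∀ ρ φ : ℝ, Λ < ρ → ph m ≤ φ → φ ≤ π →
      Wr m hm a (us m σ)⁻¹ (us m σ) ((ρ:ℂ) * Complex.exp ((σ * φ : ℝ) * I)) ≠ 0 := by
  have hm' : (3:ℝ) ≤ m := by exact_mod_cast hm
  have hp := pi_pos
  obtain ⟨C, hC⟩ := reg2_const hm a hσ
  set u := us m σ with hu
  have hu0 : u ≠ 0 := Complex.exp_ne_zero _
  have hun : ‖u‖ = 1 := Complex.norm_exp_ofReal_mul_I _
  set s0 := KK m * (2 * Real.cos (5 * π / (4 * m)) * Real.sin (2 * π / m)) with hs0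
  have hs0p : 0 < s0 := by
    have := KK_pos hm
    have := (trig_pos hm).2.2
    have : 0 < Real.cos (5 * π / (4 * m)) := by
      apply Real.cos_pos_of_mem_Ioo
      have : 0 < 5 * π / (4 * m) := by positivity
      refine ⟨by linarith, ?_⟩
      rw [div_lt_div_iff₀ (by positivity) (by positivity)]; nlinarith
    positivity
  obtain ⟨hc, hc1⟩ := cS_pos m
  obtain ⟨A0, hA0, -, hAe, hAl, hAF⟩ := ell_main hm (rot a u⁻¹) hc hc1
  obtain ⟨B0, hB0, -, hBe, hBl, hBF⟩ := ell_main hm (rot a (u ^ 2)) hc hc1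
  obtain ⟨A1, hA1, HA1⟩ := hAl (s0 / 4) (by positivity)
  obtain ⟨B1, hB1, HB1⟩ := hBl (s0 / 4) (by positivity)
  obtain ⟨A2, hA2, HA2⟩ := hAF (1/2) (by positivity)
  obtain ⟨B2, hB2, HB2⟩ := hBF (1/2) (by positivity)
  have hlim : Tendsto (fun ρ : ℝ => Real.exp (s0 / 2 * ρ ^ al m)) atTop atTop :=
    Real.tendsto_exp_atTop.comp ((tendsto_rpow_atTop (al_pos hm)).const_mul_atTop (by positivity))
  obtain ⟨L, hL⟩ := eventually_atTop.1 (hlim.eventually_gt_atTop ‖C‖)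
  refine ⟨max (max A1 B1) (max (max A2 B2) L), fun ρ φ hρ h1 h2 h0 => ?_⟩
  simp only [max_lt_iff] at hρ
  obtain ⟨⟨r1, r2⟩, ⟨r3, r4⟩, r5⟩ := hρ
  have hρ1 : 1 ≤ ρ := by linarith
  have hρ0 : 0 < ρ := by linarith
  obtain ⟨g1, g2, -⟩ := angles hm h1 h2
  have hre := reg2_re hm h1 h2 hσ
  have hW := hC _ h0
  set lam := (ρ:ℂ) * Complex.exp ((σ * φ : ℝ) * I) with hlam
  set ψ1 := σ * (φ - 4 * π / ((m:ℝ) + 2)) with hψ1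
  set ψ2 := σ * (φ + 8 * π / ((m:ℝ) + 2) - 2 * π) with hψ2
  have hab : ∀ x, |σ * x| = |x| := by rcases hσ with rfl | rfl <;> simp
  rw [← hab] at g1 g2
  have hδ0 : 0 < π / (2 * ((m:ℝ) + 2)) := by positivity
  have hm1 : u⁻¹ ^ 2 * lam = (ρ:ℂ) * Complex.exp (ψ1 * I) := by
    rw [hu, us, hlam, ← Complex.exp_neg, ← Complex.exp_nat_mul, mul_left_comm, ← Complex.exp_add]
    congr 2; rw [hψ1]; push_cast; ring
  have hsig : Complex.exp ((σ * (2 * π) : ℝ) * I) = 1 := by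
    rcases hσ with rfl | rfl
    · rw [one_mul]; push_cast; exact Complex.exp_two_pi_mul_I
    · rw [show ((-1 * (2 * π) : ℝ) : ℂ) * I = -(2 * π * I) by push_cast; ring, Complex.exp_neg, Complex.exp_two_pi_mul_I, inv_one]
  have hsig2 : Complex.exp ((σ * π : ℝ) * I) = -1 := by
    rcases hσ with rfl | rfl
    · rw [one_mul]; exact Complex.exp_pi_mul_I
    · rw [show ((-1 * π : ℝ) : ℂ) * I = -(π * I) by push_cast; ring, Complex.exp_neg, Complex.exp_pi_mul_I]; norm_num
  have hm2 : (u ^ 2) ^ 2 * lam = (ρ:ℂ) * Complex.exp (ψ2 * I) := by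
    rw [← mul_one (Complex.exp (ψ2 * I)), ← hsig, ← Complex.exp_add, hu, us, hlam, ← pow_mul, ← Complex.exp_nat_mul,
      mul_left_comm, ← Complex.exp_add]
    congr 2; rw [hψ2]; push_cast; ring
  have hs1 : |ψ1| < π := by linarith
  have hs2 : |ψ2| < π := by linarith
  set q := ((ρ ^ (1/2 : ℝ) : ℝ) : ℂ) * Complex.exp ((σ * φ / 2 : ℝ) * I) with hq
  have hqn : 1 ≤ ‖q‖ := by
    rw [hq, polar_norm (by positivity)]
    exact Real.one_le_rpow hρ1 (by norm_num)
  have hh : (1/2 : ℂ) = ((1/2 : ℝ) : ℂ) := by push_cast; rfl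
  have hq1 : u * (u⁻¹ ^ 2 * lam) ^ (1/2 : ℂ) = q := by
    rw [hm1, hh, polar_cpow hρ0 hs1, hu, us, hq, mul_left_comm, ← Complex.exp_add]
    congr 2; rw [hψ1]; push_cast; ring
  have hq2 : (u ^ 2)⁻¹ * ((u ^ 2) ^ 2 * lam) ^ (1/2 : ℂ) = -q := by
    rw [hm2, hh, polar_cpow hρ0 hs2, hu, us, hq, ← mul_neg, ← mul_neg_one (Complex.exp _), ← hsig2, ← Complex.exp_nat_mul,
      ← Complex.exp_neg,
      mul_left_comm, ← Complex.exp_add, ← Complex.exp_add]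
    congr 1
    rw [Complex.exp_eq_exp_iff_exists_int]
    rcases hσ with rfl | rfl
    · refine ⟨-1, ?_⟩; rw [hψ2]; push_cast; ring
    · refine ⟨1, ?_⟩; rw [hψ2]; push_cast; ring
  have k1 := polar_Sec m hρ0 r1 g1
  have k2 := polar_Sec m hρ0 r2 g2
  have k3 := polar_Sec m hρ0 r3 g1
  have k4 := polar_Sec m hρ0 r4 g2
  have E1 := hAe _ (Sec_mono hA1 k1)
  have E2 := hBe _ (Sec_mono hB1 k2)
  have L1 := HA1 _ k1
  have L2 := HB1 _ k2
  have X1 := HA2 _ k3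
  have X2 := HB2 _ k4
  rw [polar_cpow hρ0 hs1, polar_norm hρ0] at L1
  rw [polar_cpow hρ0 hs2, polar_norm hρ0] at L2
  rw [← hm1] at X1 E1 L1
  rw [← hm2] at X2 E2 L2
  rw [Wr, Sib.G0, Sib.G0, Sib.G1, Sib.G1, inv_inv] at hW
  set FA := F0 m hm (rot a u⁻¹) (u⁻¹ ^ 2 * lam)
  set FB := F0 m hm (rot a (u ^ 2)) ((u ^ 2) ^ 2 * lam)
  set DA := F1 m hm (rot a u⁻¹) (u⁻¹ ^ 2 * lam)
  set DB := F1 m hm (rot a (u ^ 2)) ((u ^ 2) ^ 2 * lam)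
  set lA := ell m hm (rot a u⁻¹) (u⁻¹ ^ 2 * lam)
  set lB := ell m hm (rot a (u ^ 2)) ((u ^ 2) ^ 2 * lam)
  set sA := (u⁻¹ ^ 2 * lam) ^ (1/2 : ℂ)
  set sB := ((u ^ 2) ^ 2 * lam) ^ (1/2 : ℂ)
  have hsA : ‖sA‖ = ‖q‖ := by rw [← hq1, norm_mul, hun, one_mul]
  have hsB : ‖sB‖ = ‖q‖ := by rw [← norm_neg q, ← hq2, norm_mul, norm_inv, norm_pow, hun]; simp
  have hid : C = 2 * (q * FA * FB) + (FA * ((u ^ 2)⁻¹ * (DB + sB * FB)) - u * (DA + sA * FA) * FB) := by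
    rw [← hW]
    linear_combination (-(FA * FB)) * hq2 + FA * FB * hq1
  have hb : ‖FA * ((u ^ 2)⁻¹ * (DB + sB * FB)) - u * (DA + sA * FA) * FB‖ ≤ ‖q‖ * ‖FA‖ * ‖FB‖ := by
    refine (norm_sub_le _ _).trans ?_
    rw [norm_mul, norm_mul, norm_inv, norm_pow, norm_mul, norm_mul, hun]
    rw [norm_mul, hsA] at X1
    rw [norm_mul, hsB] at X2
    have y1 := mul_le_mul_of_nonneg_left X2 (norm_nonneg FA)
    have y2 := mul_le_mul_of_nonneg_right X1 (norm_nonneg FB)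
    norm_num
    nlinarith
  have hCn : ‖FA‖ * ‖FB‖ ≤ ‖C‖ := by
    have : 2 * (q * FA * FB) = C - (FA * ((u ^ 2)⁻¹ * (DB + sB * FB)) - u * (DA + sA * FA) * FB) := by
      rw [hid]; ring
    have h3 := congrArg norm this
    have h4 := norm_sub_le C (FA * ((u ^ 2)⁻¹ * (DB + sB * FB)) - u * (DA + sA * FA) * FB)
    rw [← h3, norm_mul, norm_mul, norm_mul] at h4
    norm_num at h4
    have h5 : 0 ≤ ‖FA‖ * ‖FB‖ := by positivity
    nlinarith [mul_le_mul_of_nonneg_right hqn h5]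
  rw [E1, E2, Complex.norm_exp, Complex.norm_exp, ← Real.exp_add] at hCn
  have := hL ρ r5.le
  have hlt := Real.exp_lt_exp.1 (this.trans_le' hCn)
  have R1 := (abs_le.1 ((Complex.abs_re_le_norm _).trans L1)).1
  have R2 := (abs_le.1 ((Complex.abs_re_le_norm _).trans L2)).1
  rw [Complex.sub_re, Complex.re_ofReal_mul, Complex.re_ofReal_mul, Complex.exp_ofReal_mul_I_re] at R1 R2
  have hP : 0 < ρ ^ al m := by positivity
  have hK := KK_pos hm
  have z1 := mul_le_mul_of_nonneg_left hre (mul_pos hK hP).le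
  nlinarith

theorem reg2_final (hm : 3 ≤ m) (a : ℕ → ℂ) :
    ∃ Λ : ℝ, ∀ lam : ℂ, Λ < ‖lam‖ → ph m ≤ |arg lam| → Wr m hm a (om m)⁻¹ (om m) lam ≠ 0 := by
  obtain ⟨L1, H1⟩ := reg2 hm a (σ := 1) (Or.inl rfl)
  obtain ⟨L2, H2⟩ := reg2 hm a (σ := -1) (Or.inr rfl)
  refine ⟨max L1 L2, fun lam hl ha => ?_⟩
  have hp : (‖lam‖ : ℂ) * Complex.exp ((arg lam : ℝ) * I) = lam := norm_mul_exp_arg_mul_I lam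
  have hpi : |arg lam| ≤ π := abs_arg_le_pi lam
  rcases le_total 0 (arg lam) with h | h
  · have := H1 ‖lam‖ |arg lam| ((le_max_left _ _).trans_lt hl) ha hpi
    rwa [us_one, abs_of_nonneg h, one_mul, hp] at this
  · have := H2 ‖lam‖ |arg lam| ((le_max_right _ _).trans_lt hl) ha hpi
    rw [us_neg, abs_of_nonpos h, neg_mul_neg, one_mul, hp, inv_inv] at this
    rw [Wr_anti]
    exact neg_ne_zero.2 this

end
end Sib


namespace Sib

section
variable {m : ℕ}

noncomputable def be (m : ℕ) : ℝ := 2 * (m:ℝ) / ((m:ℝ) + 2)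

theorem be_pos (hm : 3 ≤ m) : 0 < be m := by
  have : (0:ℝ) < m := by exact_mod_cast (by omega : 0 < m)
  unfold be; positivity

theorem be_al (hm : 3 ≤ m) : be m * al m = 1 := by
  have : (0:ℝ) < m := by exact_mod_cast (by omega : 0 < m)
  rw [be, al]; field_simp

theorem ph_bd (hm : 3 ≤ m) : 0 < ph m ∧ ph m ≤ π - π / (2 * ((m:ℝ) + 2)) ∧ al m * ph m < π / 2 ∧ ph m < π ∧
    ph m + 4 * π / ((m:ℝ) + 2) = π - π / (2 * ((m:ℝ) + 2)) := by
  have hm' : (3:ℝ) ≤ m := by exact_mod_cast hm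
  have hp := pi_pos
  have e1 : 0 < π / (2 * ((m:ℝ) + 2)) := by positivity
  have e2 : 9 * π / (2 * ((m:ℝ) + 2)) = 9 * (π / (2 * ((m:ℝ) + 2))) := by ring
  have e3 : 10 * (π / (2 * ((m:ℝ) + 2))) ≤ π := by
    rw [← mul_div_assoc, div_le_iff₀ (by positivity)]; nlinarith
  have e4 : al m * ph m = π / 2 - 5 * π / (4 * m) := by
    rw [al, ph]; field_simp; ring
  have e5 : 0 < 5 * π / (4 * (m:ℝ)) := by positivity
  have e6 : 4 * π / ((m:ℝ) + 2) = 8 * (π / (2 * ((m:ℝ) + 2))) := by field_simp; ring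
  refine ⟨?_, ?_, by linarith, ?_, ?_⟩
  · rw [ph, e2]; linarith
  · rw [ph, e2]; linarith
  · rw [ph, e2]; linarith
  · rw [ph, e2, e6]; ring

theorem pol (z : ℂ) : (‖z‖ : ℂ) * Complex.exp ((arg z : ℝ) * I) = z := norm_mul_exp_arg_mul_I z

theorem cpow_norm_arg {z : ℂ} (hz : z ≠ 0) {s : ℝ} (h1 : |arg z| < π) (h2 : |s * arg z| < π) :
    ‖z ^ (s:ℂ)‖ = ‖z‖ ^ s ∧ arg (z ^ (s:ℂ)) = s * arg z := by
  have hn : 0 < ‖z‖ := norm_pos_iff.2 hz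
  have e : z ^ (s:ℂ) = ((‖z‖ ^ s : ℝ) : ℂ) * Complex.exp ((s * arg z : ℝ) * I) := by
    conv_lhs => rw [← pol z]
    exact polar_cpow hn h1 s
  have hn' : 0 < ‖z‖ ^ s := by positivity
  rw [e]
  refine ⟨polar_norm hn' _, ?_⟩
  rw [Complex.arg_real_mul _ hn', Complex.arg_exp_mul_I, toIocMod_eq_self]
  have := abs_lt.1 h2
  constructor <;> linarith [this.1, this.2]

theorem cpow_cpow_inv {z : ℂ} (hz : z ≠ 0) {s t : ℝ} (hst : s * t = 1) (h1 : |arg z| < π) (h2 : |s * arg z| < π) :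
    (z ^ (s:ℂ)) ^ (t:ℂ) = z := by
  have := (abs_lt.1 h2)
  have e : (Complex.log z * (s:ℂ)).im = s * arg z := by rw [Complex.im_mul_ofReal, Complex.log_im, mul_comm]
  rw [← Complex.cpow_mul, ← Complex.ofReal_mul, hst, Complex.ofReal_one, Complex.cpow_one]
  · rw [e]; linarith [this.1]
  · rw [e]; linarith [this.2]

/-- from kappa to lambda -/
theorem up (hm : 3 ≤ m) {κ : ℂ} (h0 : κ ≠ 0) (h : |arg κ| < al m * ph m) :
    κ ^ (be m : ℂ) ≠ 0 ∧ ‖κ ^ (be m : ℂ)‖ = ‖κ‖ ^ be m ∧ |arg (κ ^ (be m : ℂ))| < ph m ∧ (κ ^ (be m : ℂ)) ^ (al m : ℂ) = κ := by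
  obtain ⟨p1, p2, p3, p4, -⟩ := ph_bd hm
  have hb := be_pos hm
  have hp := pi_pos
  have h1 : |arg κ| < π := by linarith
  have h2 : |be m * arg κ| < ph m := by
    rw [abs_mul, abs_of_pos hb]
    calc _ < be m * (al m * ph m) := mul_lt_mul_of_pos_left h hb
      _ = ph m := by rw [← mul_assoc, be_al hm, one_mul]
  obtain ⟨q1, q2⟩ := cpow_norm_arg h0 h1 (h2.trans p4)
  refine ⟨by rw [Complex.cpow_ne_zero_iff]; exact Or.inl h0, q1, by rwa [q2], cpow_cpow_inv h0 (be_al hm) h1 (h2.trans p4)⟩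

theorem down (hm : 3 ≤ m) {lam : ℂ} (h0 : lam ≠ 0) (h : |arg lam| < ph m) :
    lam ^ (al m : ℂ) ≠ 0 ∧ ‖lam ^ (al m : ℂ)‖ = ‖lam‖ ^ al m ∧ |arg (lam ^ (al m : ℂ))| < al m * ph m ∧
      (lam ^ (al m : ℂ)) ^ (be m : ℂ) = lam ∧ arg (lam ^ (al m : ℂ)) = al m * arg lam := by
  obtain ⟨p1, p2, p3, p4, -⟩ := ph_bd hm
  have hb := al_pos hm
  have hp := pi_pos
  have h2 : |al m * arg lam| < al m * ph m := by
    rw [abs_mul, abs_of_pos hb]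
    exact mul_lt_mul_of_pos_left h hb
  obtain ⟨q1, q2⟩ := cpow_norm_arg h0 (h.trans p4) (h2.trans (by linarith))
  refine ⟨by rw [Complex.cpow_ne_zero_iff]; exact Or.inl h0, q1, by rwa [q2],
    cpow_cpow_inv h0 (by rw [mul_comm]; exact be_al hm) (h.trans p4) (h2.trans (by linarith)), q2⟩

/-- rotated spectral parameter -/
theorem rotl (hm : 3 ≤ m) {lam : ℂ} {Λ : ℝ} (h0 : lam ≠ 0) (hL : Λ < ‖lam‖) (h : |arg lam| < ph m) {σ : ℝ} (hσ : |σ| = 1) :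
    us m σ ^ 2 * lam ∈ Sec (cS m) Λ ∧ ‖us m σ ^ 2 * lam‖ = ‖lam‖ ∧
      (us m σ ^ 2 * lam) ^ (al m : ℂ) = lam ^ (al m : ℂ) * Complex.exp ((σ * (2 * π / m) : ℝ) * I) := by
  obtain ⟨p1, p2, p3, p4, p5⟩ := ph_bd hm
  have hm' : (3:ℝ) ≤ m := by exact_mod_cast hm
  have hp := pi_pos
  have hn : 0 < ‖lam‖ := norm_pos_iff.2 h0
  have e1 : us m σ ^ 2 * lam = (‖lam‖ : ℂ) * Complex.exp ((arg lam + σ * (4 * π / ((m:ℝ) + 2)) : ℝ) * I) := by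
    conv_lhs => rw [← pol lam]
    rw [us, ← Complex.exp_nat_mul, mul_left_comm, ← Complex.exp_add]
    congr 2; push_cast; ring
  have e2 : |arg lam + σ * (4 * π / ((m:ℝ) + 2))| ≤ π - π / (2 * ((m:ℝ) + 2)) := by
    refine (abs_add_le _ _).trans ?_
    have h4 : 0 ≤ 4 * π / ((m:ℝ) + 2) := by positivity
    rw [abs_mul, hσ, one_mul, abs_of_nonneg h4]
    linarith
  have e3 : 0 < π / (2 * ((m:ℝ) + 2)) := by positivity
  refine ⟨by rw [e1]; exact polar_Sec m hn hL e2, by rw [e1, polar_norm hn], ?_⟩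
  rw [e1, polar_cpow hn (by linarith)]
  conv_rhs => rw [← pol lam, polar_cpow hn (h.trans p4)]
  rw [mul_assoc, ← Complex.exp_add, ← add_mul, ← Complex.ofReal_add]
  congr 4
  rw [mul_add]; congr 1; rw [al]; field_simp; ring

/-- the counting function -/
noncomputable def hf (m : ℕ) (hm : 3 ≤ m) (a : ℕ → ℂ) (κ : ℂ) : ℂ :=
  I * (ell m hm (rot a (us m (-1))) (us m (-1) ^ 2 * κ ^ (be m : ℂ)) - ell m hm (rot a (us m 1)) (us m 1 ^ 2 * κ ^ (be m : ℂ)))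
    / ((2 * (KK m * Real.sin (2 * π / m)) : ℝ) : ℂ)

theorem pow_gt (hm : 3 ≤ m) {x Λ : ℝ} (hΛ : 0 < Λ) (h : Λ ^ al m < x) : Λ < x ^ be m := by
  have := Real.rpow_lt_rpow (by positivity) h (be_pos hm)
  rwa [← Real.rpow_mul hΛ.le, mul_comm, be_al hm, Real.rpow_one] at this

theorem hf_props (hm : 3 ≤ m) (a : ℕ → ℂ) : ∃ R0 : ℝ, 0 < R0 ∧ ∃ c2 : ℂ,
    DifferentiableOn ℂ (hf m hm a) {κ | |arg κ| < al m * ph m ∧ R0 < ‖κ‖} ∧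
    (∀ ε > 0, ∃ R ≥ R0, ∀ κ : ℂ, |arg κ| < al m * ph m → R < ‖κ‖ → ‖hf m hm a κ - κ‖ ≤ ε * ‖κ‖) ∧
    (∀ κ : ℂ, |arg κ| < al m * ph m → R0 < ‖κ‖ → (Wr m hm a (om m)⁻¹ (om m) (κ ^ (be m : ℂ)) = 0 ↔
      ∃ k : ℤ, hf m hm a κ = ((π / (KK m * Real.sin (2 * π / m)) : ℝ) : ℂ) * k + c2)) := by
  obtain ⟨hc, hc1⟩ := cS_pos m
  obtain ⟨A0, hA0, hAd, hAe, hAl, -⟩ := ell_main hm (rot a (us m (-1))) hc hc1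
  obtain ⟨B0, hB0, hBd, hBe, hBl, -⟩ := ell_main hm (rot a (us m 1)) hc hc1
  obtain ⟨C0, hC0, -, hCe, -, -⟩ := ell_main hm (rot a 1) hc hc1
  set M := max A0 (max B0 C0) with hM
  have hM1 : 1 ≤ M := hA0.trans (le_max_left _ _)
  have hMA : A0 ≤ M := le_max_left _ _
  have hMB : B0 ≤ M := (le_max_left _ _).trans (le_max_right _ _)
  have hMC : C0 ≤ M := (le_max_right _ _).trans (le_max_right _ _)
  have hK := KK_pos hm
  have hS := (trig_pos hm).2.2
  have hKS : 0 < KK m * Real.sin (2 * π / m) := mul_pos hK hS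
  have hKSc : ((KK m * Real.sin (2 * π / m) : ℝ) : ℂ) ≠ 0 := by exact_mod_cast hKS.ne'
  obtain ⟨p1, p2, p3, p4, p5⟩ := ph_bd hm
  have hp := pi_pos
  obtain ⟨K1, hK1, HK1⟩ := Wr_adj hm a (inv_ne_zero (om_ne m))
  obtain ⟨K2, hK2, HK2⟩ := Wr_adj hm a (w := 1) one_ne_zero
  rw [inv_mul_cancel₀ (om_ne m)] at HK1
  rw [one_mul] at HK2
  set c1 := Complex.log (-K1 / K2) with hc1d
  have hR0 : 0 < M ^ al m := by positivity
  have hne : ∀ {κ : ℂ} {R : ℝ}, M ^ al m ≤ R → R < ‖κ‖ → κ ≠ 0 := by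
    intro κ R h1 h2
    exact norm_pos_iff.1 (by linarith)
  refine ⟨M ^ al m, hR0, I * c1 / ((2 * (KK m * Real.sin (2 * π / m)) : ℝ) : ℂ), ?_, ?_, ?_⟩
  · have hd : DifferentiableOn ℂ (fun κ : ℂ => κ ^ (be m : ℂ)) {κ | |arg κ| < al m * ph m ∧ M ^ al m < ‖κ‖} := by
      intro κ hκ
      have hs : κ ∈ slitPlane := by
        rw [mem_slitPlane_iff_arg]
        refine ⟨?_, hne le_rfl hκ.2⟩
        intro h
        have := hκ.1
        rw [h, abs_of_pos hp] at this
        linarith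
      exact ((differentiableAt_id.cpow_const hs)).differentiableWithinAt
    have hmap : ∀ σ : ℝ, |σ| = 1 → ∀ B ≤ M, MapsTo (fun κ : ℂ => us m σ ^ 2 * κ ^ (be m : ℂ))
        {κ | |arg κ| < al m * ph m ∧ M ^ al m < ‖κ‖} (Sec (cS m) B) := by
      intro σ hσ B hB κ hκ
      obtain ⟨q1, q2, q3, q4⟩ := up hm (hne le_rfl hκ.2) hκ.1
      exact (rotl hm q1 (by rw [q2]; exact hB.trans_lt (pow_gt hm (by linarith) hκ.2)) q3 hσ).1
    have d1 := hAd.comp (hd.const_mul (us m (-1) ^ 2)) (hmap (-1) (by simp) A0 hMA)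
    have d2 := hBd.comp (hd.const_mul (us m 1 ^ 2)) (hmap 1 (by simp) B0 hMB)
    exact ((d1.sub d2).const_mul I).div_const _
  · intro ε hε
    obtain ⟨A1, hA1, HA1⟩ := hAl (ε * (KK m * Real.sin (2 * π / m))) (by positivity)
    obtain ⟨B1, hB1, HB1⟩ := hBl (ε * (KK m * Real.sin (2 * π / m))) (by positivity)
    refine ⟨max M (max A1 B1) ^ al m, Real.rpow_le_rpow (by linarith) (le_max_left _ _) (al_pos hm).le, ?_⟩
    intro κ k1 k2
    have k0 : κ ≠ 0 := hne (Real.rpow_le_rpow (by linarith) (le_max_left _ _) (al_pos hm).le) k2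
    obtain ⟨q1, q2, q3, q4⟩ := up hm k0 k1
    have hg : max M (max A1 B1) < ‖κ ^ (be m : ℂ)‖ := by
      rw [q2]; exact pow_gt hm (by linarith [le_max_left M (max A1 B1)]) k2
    have hnn : ‖κ ^ (be m : ℂ)‖ ^ al m = ‖κ‖ := by
      rw [q2, ← Real.rpow_mul (norm_nonneg _), be_al hm, Real.rpow_one]
    obtain ⟨s1, s2, s3⟩ := rotl hm q1 (((le_max_left A1 B1).trans (le_max_right M _)).trans_lt hg) q3 (σ := -1) (by simp)
    obtain ⟨t1, t2, t3⟩ := rotl hm q1 (((le_max_right A1 B1).trans (le_max_right M _)).trans_lt hg) q3 (σ := 1) (by simp)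
    have L1 := HA1 _ s1
    have L2 := HB1 _ t1
    rw [s2, s3, q4, hnn] at L1
    rw [t2, t3, q4, hnn] at L2
    rw [hf]
    set lA := ell m hm (rot a (us m (-1))) (us m (-1) ^ 2 * κ ^ (be m : ℂ))
    set lB := ell m hm (rot a (us m 1)) (us m 1 ^ 2 * κ ^ (be m : ℂ))
    set y := 2 * π / (m:ℝ) with hy
    have hsin : Complex.exp ((-1 * y : ℝ) * I) - Complex.exp ((1 * y : ℝ) * I) = -2 * I * (Real.sin y : ℂ) := by
      rw [Complex.exp_mul_I, Complex.exp_mul_I]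
      push_cast
      rw [one_mul, neg_one_mul, Complex.cos_neg, Complex.sin_neg]
      ring
    have hid : I * (lA - lB) / ((2 * (KK m * Real.sin y) : ℝ) : ℂ) - κ =
        I * ((lA - KK m * (κ * Complex.exp ((-1 * y : ℝ) * I))) - (lB - KK m * (κ * Complex.exp ((1 * y : ℝ) * I))))
          / ((2 * (KK m * Real.sin y) : ℝ) : ℂ) := by
      have h2 : ((2 * (KK m * Real.sin y) : ℝ) : ℂ) ≠ 0 := by
        exact_mod_cast (by positivity : 2 * (KK m * Real.sin y) ≠ 0)
      rw [eq_div_iff h2, sub_mul, div_mul_cancel₀ _ h2, Complex.ofReal_mul, Complex.ofReal_mul, Complex.ofReal_ofNat]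
      linear_combination (I * KK m * κ) * hsin - (2 * KK m * κ * (Real.sin y : ℂ)) * I_sq
    rw [hid, norm_div, norm_mul, norm_I, one_mul, Complex.norm_real, Real.norm_of_nonneg (by positivity), div_le_iff₀ (by positivity)]
    refine (norm_sub_le _ _).trans ?_
    linarith
  · intro κ k1 k2
    have k0 : κ ≠ 0 := hne le_rfl k2
    obtain ⟨q1, q2, q3, q4⟩ := up hm k0 k1
    have hg : M < ‖κ ^ (be m : ℂ)‖ := by
      rw [q2]; exact pow_gt hm (by linarith) k2
    obtain ⟨s1, -, -⟩ := rotl hm q1 (hMA.trans_lt hg) q3 (σ := -1) (by simp)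
    obtain ⟨t1, -, -⟩ := rotl hm q1 (hMB.trans_lt hg) q3 (σ := 1) (by simp)
    have v1 : κ ^ (be m : ℂ) ∈ Sec (cS m) C0 := by
      rw [← pol (κ ^ (be m : ℂ))]
      exact polar_Sec m (by linarith) (hMC.trans_lt hg) (q3.le.trans p2)
    have E1 := hAe _ s1
    have E2 := hBe _ t1
    have E3 := hCe _ v1
    rw [hf]
    set lam := κ ^ (be m : ℂ)
    have hid : Sib.G0 m hm a (om m)⁻¹ lam * Wr m hm a 1 (om m) lam - Sib.G0 m hm a 1 lam * Wr m hm a (om m)⁻¹ (om m) lam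
        + Sib.G0 m hm a (om m) lam * Wr m hm a (om m)⁻¹ 1 lam = 0 := by
      unfold Wr; ring
    rw [HK1, HK2, Sib.G0, Sib.G0, Sib.G0, ← us_neg, ← us_one, E1, E2, one_pow, one_mul, E3, us_neg, us_one] at hid
    rw [us_neg, us_one]
    set lA := ell m hm (rot a (om m)⁻¹) ((om m)⁻¹ ^ 2 * lam)
    set lB := ell m hm (rot a (om m)) ((om m) ^ 2 * lam)
    have hquot : -K1 / K2 ≠ 0 := div_ne_zero (neg_ne_zero.2 hK1) hK2
    have step1 : Wr m hm a (om m)⁻¹ (om m) lam = 0 ↔ Complex.exp (lA - lB) = Complex.exp c1 := by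
      rw [hc1d, Complex.exp_log hquot, Complex.exp_sub, div_eq_div_iff (Complex.exp_ne_zero _) hK2]
      constructor
      · intro h; rw [h] at hid; linear_combination hid
      · intro h
        have : Complex.exp (ell m hm (rot a 1) lam) * Wr m hm a (om m)⁻¹ (om m) lam = 0 := by
          linear_combination h - hid
        exact (mul_eq_zero.1 this).resolve_left (Complex.exp_ne_zero _)
    rw [step1, Complex.exp_eq_exp_iff_exists_int]
    have e2 : ((2 * (KK m * Real.sin (2 * π / m)) : ℝ) : ℂ) = 2 * ((KK m * Real.sin (2 * π / m) : ℝ) : ℂ) := by push_cast; ring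
    have e3 : ((π / (KK m * Real.sin (2 * π / m)) : ℝ) : ℂ) = π / ((KK m * Real.sin (2 * π / m) : ℝ) : ℂ) := by push_cast; ring
    rw [e2, e3]
    set Q := ((KK m * Real.sin (2 * π / m) : ℝ) : ℂ)
    constructor
    · rintro ⟨n, hn⟩
      refine ⟨-n, ?_⟩
      rw [hn]; push_cast; field_simp
      linear_combination (2 * π * (n:ℂ)) * I_sq
    · rintro ⟨k, hk⟩
      refine ⟨-k, ?_⟩
      field_simp at hk
      push_cast
      linear_combination (-I) * hk + (lA - lB - c1) * I_sq

theorem zeros_finite (hm : 3 ≤ m) (a : ℕ → ℂ) (M : ℝ) :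
    {z : ℂ | Wr m hm a (om m)⁻¹ (om m) z = 0 ∧ ‖z‖ ≤ M}.Finite := by
  obtain ⟨Λ, hΛ⟩ := reg2_final hm a
  set D := Wr m hm a (om m)⁻¹ (om m) with hD
  have hA : AnalyticOnNhd ℂ D univ := fun z _ => (Wr_entire hm a _ _).analyticAt z
  have hne : ∃ z, D z ≠ 0 := by
    refine ⟨((-(|Λ| + 1) : ℝ) : ℂ), hΛ _ ?_ ?_⟩
    · rw [Complex.norm_real, Real.norm_eq_abs, abs_neg, abs_of_pos (by positivity)]
      linarith [le_abs_self Λ]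
    · rw [Complex.arg_ofReal_of_neg (by linarith [abs_nonneg Λ]), abs_of_pos pi_pos]
      exact (ph_bd hm).2.2.2.1.le
  obtain ⟨z0, hz0⟩ := hne
  by_contra hinf
  have hinf : {z : ℂ | D z = 0 ∧ ‖z‖ ≤ M}.Infinite := hinf
  obtain ⟨x, -, hx⟩ := hinf.exists_accPt_of_subset_isCompact (isCompact_closedBall (0:ℂ) M)
    (fun z hz => by rw [mem_closedBall_zero_iff]; exact hz.2)
  have hfr : ∃ᶠ z in nhdsWithin x {x}ᶜ, D z = 0 := by
    rw [accPt_iff_frequently_nhdsNE] at hx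
    exact hx.mono fun z hz => hz.1
  exact hz0 (hA.eqOn_zero_of_preconnected_of_frequently_eq_zero isPreconnected_univ (mem_univ x) hfr (mem_univ z0))

theorem final (hm : 3 ≤ m) (a : ℕ → ℂ) :
    ∃ (lam : ℕ → ℂ) (err : ℕ → ℂ),
      Function.Injective lam ∧
      (∀ n : ℕ, IsEigenvalue m a (lam n)) ∧
      {mu : ℂ | IsEigenvalue m a mu ∧ mu ∉ Set.range lam}.Finite ∧
      Filter.Tendsto err Filter.atTop (nhds 0) ∧
      (∀ᶠ n : ℕ in Filter.atTop, lam n =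
        (((Real.Gamma (3 / 2 + 1 / (m : ℝ)) * Real.sqrt Real.pi * ((n : ℝ) - 1 / 2) /
            (Real.sin (Real.pi / (m : ℝ)) * Real.Gamma (1 + 1 / (m : ℝ))))
          ^ (2 * (m : ℝ) / ((m : ℝ) + 2)) : ℝ) : ℂ) * (1 + err n)) := by
  obtain ⟨p1, p2, p3, p4, p5⟩ := ph_bd hm
  obtain ⟨R0, hR0, c2, hd, hh, hiff⟩ := hf_props hm a
  have hT : 0 < π / (KK m * Real.sin (2 * π / m)) := div_pos pi_pos (mul_pos (KK_pos hm) (trig_pos hm).2.2)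
  have hTar : ∀ n : ℕ, Real.Gamma (3 / 2 + 1 / (m : ℝ)) * Real.sqrt Real.pi * ((n : ℝ) - 1 / 2) /
            (Real.sin (Real.pi / (m : ℝ)) * Real.Gamma (1 + 1 / (m : ℝ))) = π / (KK m * Real.sin (2 * π / m)) * ((n:ℝ) - 1/2) := by
    intro n; rw [KK_final hm]; ring
  obtain ⟨N0, κ, hκ, hlim, R, hR, hcov⟩ := abs_lemma (mul_pos (al_pos hm) p1) p3 hT c2 hd hh
  set T := π / (KK m * Real.sin (2 * π / m)) with hTd
  have hκ0 : ∀ n ≥ N0, κ n ≠ 0 := fun n hn => norm_pos_iff.1 (hR0.trans (hκ n hn).2.1)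
  have hTc : (T:ℂ) ≠ 0 := by exact_mod_cast hT.ne'
  have hge : ∀ n, N0 ≤ n + N0 := fun n => Nat.le_add_left _ _
  set lam : ℕ → ℂ := fun n => κ (n + N0) ^ (be m : ℂ) with hlam
  have hback : ∀ n, lam n ^ (al m : ℂ) = κ (n + N0) := fun n =>
    (up hm (hκ0 _ (hge n)) (hκ _ (hge n)).1).2.2.2
  obtain ⟨Λ2, hΛ2⟩ := reg2_final hm a
  simp only [hTar]
  change ∃ (lam : ℕ → ℂ) (err : ℕ → ℂ), _ ∧ _ ∧ _ ∧ _ ∧ (∀ᶠ n : ℕ in Filter.atTop, lam n =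
    (((T * ((n:ℝ) - 1 / 2)) ^ (be m) : ℝ) : ℂ) * (1 + err n))
  refine ⟨lam, fun n => lam n / (((T * ((n:ℝ) - 1 / 2)) ^ (be m) : ℝ) : ℂ) - 1, ?_, ?_, ?_, ?_, ?_⟩
  · intro i j hij
    have h1 : κ (i + N0) = κ (j + N0) := by rw [← hback, ← hback, hij]
    have h2 := (hκ _ (hge i)).2.2
    rw [h1, (hκ _ (hge j)).2.2] at h2
    have h3 : (((j + N0 : ℕ)) : ℂ) = ((i + N0 : ℕ) : ℂ) := mul_left_cancel₀ hTc (add_right_cancel h2)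
    have := Nat.cast_injective h3
    omega
  · intro n
    rw [eig_iff hm]
    have := hκ _ (hge n)
    exact (hiff _ this.1 this.2.1).2 ⟨((n + N0 : ℕ) : ℤ), by rw [this.2.2]; push_cast; rfl⟩
  · refine (zeros_finite hm a (max Λ2 (R ^ be m))).subset ?_
    rintro mu ⟨h1, h2⟩
    rw [eig_iff hm] at h1
    refine ⟨h1, ?_⟩
    by_contra hlt
    push Not at hlt
    rw [max_lt_iff] at hlt
    have hRp : 0 < R := hR0.trans_le hR
    have hmu : mu ≠ 0 := norm_pos_iff.1 (lt_of_le_of_lt (by positivity) hlt.2)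
    have harg : |arg mu| < ph m := by
      by_contra hc
      exact hΛ2 mu hlt.1 (not_lt.1 hc) h1
    obtain ⟨d1, d2, d3, d4, -⟩ := down hm hmu harg
    have hRl : R < ‖mu ^ (al m : ℂ)‖ := by
      rw [d2]
      have := Real.rpow_lt_rpow (by positivity) hlt.2 (al_pos hm)
      rwa [← Real.rpow_mul hRp.le, be_al hm, Real.rpow_one] at this
    obtain ⟨k, hk⟩ := (hiff _ d3 (hR.trans_lt hRl)).1 (by rw [d4]; exact h1)
    obtain ⟨n, hn, hz⟩ := hcov _ d3 hRl k hk
    refine h2 ⟨n - N0, ?_⟩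
    rw [hlam]
    simp only
    rw [Nat.sub_add_cancel hn, ← hz, d4]
  · have hl1 : Tendsto (fun n : ℕ => κ (n + N0) / (T * ((n:ℝ) - 1/2 : ℝ))) atTop (nhds 1) := by
      have ha := hlim.comp (tendsto_add_atTop_nat N0)
      have hb : Tendsto (fun n : ℕ => (((n:ℝ) + N0) / ((n:ℝ) - 1/2) : ℝ)) atTop (nhds 1) := by
        have hc : Tendsto (fun n : ℕ => (1:ℝ) + (N0 + 1/2) / ((n:ℝ) - 1/2)) atTop (nhds (1 + 0)) :=
          tendsto_const_nhds.add (tendsto_const_nhds.div_atTop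
            (tendsto_atTop_add_const_right _ (-(1/2)) tendsto_natCast_atTop_atTop))
        rw [add_zero] at hc
        refine hc.congr' ?_
        filter_upwards [eventually_ge_atTop 1] with n hn
        have : (1:ℝ) ≤ n := by exact_mod_cast hn
        have : (n:ℝ) - 1/2 ≠ 0 := by linarith
        rw [eq_div_iff this, add_mul, div_mul_cancel₀ _ this]; ring
      have hb' := (Complex.continuous_ofReal.tendsto 1).comp hb
      have := ha.mul hb'
      rw [Complex.ofReal_one, mul_one] at this
      refine this.congr' ?_
      filter_upwards [eventually_ge_atTop 1] with n hn
      have h1 : (1:ℝ) ≤ n := by exact_mod_cast hn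
      have h3 : ((n:ℂ) + N0) ≠ 0 := by exact_mod_cast (by omega : n + N0 ≠ 0)
      simp only [Function.comp_apply]
      push_cast
      rw [div_mul_div_comm, mul_comm (T * ((n:ℂ) + N0)), mul_comm (κ (n + N0)), ← mul_assoc, mul_comm _ ((n:ℂ) + N0),
        mul_div_mul_left _ _ h3, mul_comm _ (T:ℂ)]
    have hl2 : Tendsto (fun n : ℕ => (κ (n + N0) / (T * ((n:ℝ) - 1/2 : ℝ))) ^ (be m : ℂ)) atTop (nhds 1) := by
      have hc : ContinuousAt (fun z : ℂ => z ^ (be m : ℂ)) 1 :=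
        (differentiableAt_id.cpow_const one_mem_slitPlane).continuousAt
      have := hc.tendsto.comp hl1
      simpa [Function.comp_def] using this
    have hl3 : Tendsto (fun n : ℕ => lam n / (((T * ((n:ℝ) - 1 / 2)) ^ (be m) : ℝ) : ℂ)) atTop (nhds 1) := by
      refine hl2.congr' ?_
      filter_upwards [eventually_ge_atTop 1] with n hn
      have h1 : (1:ℝ) ≤ n := by exact_mod_cast hn
      have hr : 0 < T * ((n:ℝ) - 1/2) := mul_pos hT (by linarith)
      have hrc : ((T * ((n:ℝ) - 1/2) : ℝ) : ℂ) ≠ 0 := by exact_mod_cast hr.ne'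
      rw [← Complex.ofReal_mul]
      set q := κ (n + N0) / ((T * ((n:ℝ) - 1/2) : ℝ) : ℂ) with hq
      have e : κ (n + N0) = ((T * ((n:ℝ) - 1/2) : ℝ) : ℂ) * q := by rw [hq, mul_div_cancel₀ _ hrc]
      have hq0 : q ≠ 0 := div_ne_zero (hκ0 _ (hge n)) hrc
      rw [hlam]
      simp only
      rw [e, real_mul_cpow hr hq0, Complex.ofReal_cpow hr.le, mul_div_cancel_left₀]
      rw [Complex.cpow_ne_zero_iff]; exact Or.inl hrc
    have := hl3.sub_const 1
    rwa [sub_self] at this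
  · filter_upwards [eventually_ge_atTop 1] with n hn
    have h1 : (1:ℝ) ≤ n := by exact_mod_cast hn
    have hr : 0 < T * ((n:ℝ) - 1/2) := mul_pos hT (by linarith)
    have h0 : ((((T * ((n:ℝ) - 1 / 2)) ^ (be m) : ℝ)) : ℂ) ≠ 0 := by
      exact_mod_cast (Real.rpow_pos_of_pos hr _).ne'
    rw [add_sub_cancel, mul_div_cancel₀ _ h0]

end
end Sib

/-- Asymptotic expansion of the eigenvalues of `H(m,a)` (Sibuya-type leading order):
`λ_n = (Γ(3/2+1/m) √π (n-1/2) / (sin(π/m) Γ(1+1/m)))^{2m/(m+2)} (1+o(1))`. -/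
theorem stmt5 (m : ℕ) (hm : 3 ≤ m) (a : ℕ → ℂ) :
    ∃ (lam : ℕ → ℂ) (err : ℕ → ℂ),
      Function.Injective lam ∧
      (∀ n : ℕ, IsEigenvalue m a (lam n)) ∧
      {mu : ℂ | IsEigenvalue m a mu ∧ mu ∉ Set.range lam}.Finite ∧
      Filter.Tendsto err Filter.atTop (nhds 0) ∧
      (∀ᶠ n : ℕ in Filter.atTop, lam n =
        (((Real.Gamma (3 / 2 + 1 / (m : ℝ)) * Real.sqrt Real.pi * ((n : ℝ) - 1 / 2) /
            (Real.sin (Real.pi / (m : ℝ)) * Real.Gamma (1 + 1 / (m : ℝ))))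
          ^ (2 * (m : ℝ) / ((m : ℝ) + 2)) : ℝ) : ℂ) * (1 + err n)) := by
  exact Sib.final hm a
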